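/- Let d ≥ 5 be an integer. Denote by M(e), for a general pencil of plane curves of degree e over ℂ and a general point x ∈ ℙ², the number of lines through x that are bitangent to some member of the pencil. Then M(d) = M(d−2) + 4(d−2)(3d−10). -/

import Mathlib

noncomputable section

/-- The restriction of the form `F` to the line through `[v]` and `[w]`,
parametrized by `t ↦ v + t • w`, as a polynomial in `t`. -/
def linePoly (F : MvPolynomial (Fin 3) ℂ) (v w : Fin 3 → ℂ) : Polynomial ℂ :=
  MvPolynomial.aeval (fun i => Polynomial.C (v i) + Polynomial.X * Polynomial.C (w i)) F

/-- The line through the two (projectively distinct) points `[v]`, `[w]` has contact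
order at least `m` with the curve `{F = 0}` at the point `[v]`. -/
def ContactLE (F : MvPolynomial (Fin 3) ℂ) (v w : Fin 3 → ℂ) (m : ℕ) : Prop :=
  (Polynomial.X : Polynomial ℂ) ^ m ∣ linePoly F v w

/-- The member of the pencil spanned by `F` and `G` corresponding to `c ∈ ℙ¹`. -/
def pencilMember (F G : MvPolynomial (Fin 3) ℂ) (c : Projectivization ℂ (Fin 2 → ℂ)) :
    MvPolynomial (Fin 3) ℂ :=
  c.rep 0 • F + c.rep 1 • G

/-- The coefficient vector of a pair of forms. -/
def coeffs2 (F G : MvPolynomial (Fin 3) ℂ) : (Fin 3 →₀ ℕ) ⊕ (Fin 3 →₀ ℕ) → ℂ :=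
  Sum.elim (fun m => MvPolynomial.coeff m F) (fun m => MvPolynomial.coeff m G)

/-- The set of lines (2-dimensional linear subspaces of `ℂ³`) through the point `[x]`
which are bitangent to some member of the pencil spanned by `F` and `G`. -/
def bitangentLinesThrough (F G : MvPolynomial (Fin 3) ℂ) (x : Fin 3 → ℂ) :
    Set (Submodule ℂ (Fin 3 → ℂ)) :=
  {W | x ∈ W ∧ Module.finrank ℂ ↥W = 2 ∧
    ∃ (c : Projectivization ℂ (Fin 2 → ℂ)) (v w : Fin 3 → ℂ),
      v ∈ W ∧ w ∈ W ∧ LinearIndependent ℂ ![v, w] ∧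
      ContactLE (pencilMember F G c) v w 2 ∧ ContactLE (pencilMember F G c) w v 2}

/-- `M e = N`: for a general pencil of degree-`e` plane curves and a general point
`[x] ∈ ℙ²`, the number of lines through `[x]` bitangent to some member is `N`. -/
def BitangentLinesCountEq (e N : ℕ) : Prop :=
  ∃ Q : MvPolynomial (((Fin 3 →₀ ℕ) ⊕ (Fin 3 →₀ ℕ)) ⊕ Fin 3) ℂ,
    (∃ (F G : MvPolynomial (Fin 3) ℂ) (x : Fin 3 → ℂ),
        F.IsHomogeneous e ∧ G.IsHomogeneous e ∧ LinearIndependent ℂ ![F, G] ∧ x ≠ 0 ∧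
        MvPolynomial.eval (Sum.elim (coeffs2 F G) x) Q ≠ 0) ∧
    ∀ (F G : MvPolynomial (Fin 3) ℂ) (x : Fin 3 → ℂ),
      F.IsHomogeneous e → G.IsHomogeneous e → LinearIndependent ℂ ![F, G] → x ≠ 0 →
      MvPolynomial.eval (Sum.elim (coeffs2 F G) x) Q ≠ 0 →
        (bitangentLinesThrough F G x).Finite ∧ (bitangentLinesThrough F G x).ncard = N

section Aux
open Polynomial

/-- Row indices of the resultant-type matrix. -/
abbrev BRow (n : ℕ) : Type :=
  (Fin (n + 1) × Fin (2 * n + 4) × Fin (2 * n + 6)) ⊕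
    ((Fin (2 * n + 2) × Fin (2 * n + 4)) ⊕ (Fin (2 * n + 2) × Fin (2 * n + 4)))

/-- Column indices of the resultant-type matrix. -/
abbrev BCol (n : ℕ) : Type := Fin (n + 5) × Fin (2 * n + 2) × Fin (2 * n + 4)

/-- Coefficients of `(1 - t)^2`, shifted by `i`. -/
def sqE (R : Type*) [CommRing R] (i i' : ℕ) : R :=
  if i' = i then 1 else if i' = i + 1 then -2 else if i' = i + 2 then 1 else 0

theorem sum_sqE {R : Type*} [CommRing R] (N i : ℕ) (hi : i + 2 < N) (F : ℕ → R) :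
    ∑ x : Fin N, sqE R i x * F x = F i - 2 * F (i + 1) + F (i + 2) := by
  rw [Fin.sum_univ_eq_sum_range (fun x => sqE R i x * F x) N]
  have hs : ({i, i + 1, i + 2} : Finset ℕ) ⊆ Finset.range N := by
    intro y hy
    simp only [Finset.mem_insert, Finset.mem_singleton] at hy
    simp only [Finset.mem_range]
    omega
  rw [← Finset.sum_subset hs]
  · rw [Finset.sum_insert (by simp), Finset.sum_insert (by simp), Finset.sum_singleton]
    simp [sqE]
    ring
  · intro y _ hy
    simp only [Finset.mem_insert, Finset.mem_singleton, not_or] at hy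
    simp [sqE, hy.1, hy.2.1, hy.2.2]

/-- The resultant-type matrix. -/
def BMat {R : Type*} [CommRing R] (n : ℕ) (f g : Fin (n + 5) → R) : Matrix (BRow n) (BCol n) R :=
  fun r c => match r with
    | Sum.inl (l, i', j') => sqE R c.2.1 i' * (sqE R c.2.2 j' *
        if (c.1 : ℕ) + i' + j' = l + 4 + c.2.1 + c.2.2 then 1 else 0)
    | Sum.inr (Sum.inl r) => if r = c.2 then f c.1 else 0
    | Sum.inr (Sum.inr r) => if r = c.2 then g c.1 else 0

theorem bcard (n : ℕ) : Fintype.card (BRow n) = Fintype.card (BCol n) := by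
  simp only [Fintype.card_sum, Fintype.card_prod, Fintype.card_fin]
  ring

def bequiv (n : ℕ) : BRow n ≃ BCol n := Fintype.equivOfCardEq (bcard n)

/-- square version -/
def BSq {R : Type*} [CommRing R] (n : ℕ) (f g : Fin (n + 5) → R) : Matrix (BCol n) (BCol n) R :=
  (BMat n f g).submatrix (bequiv n).symm id

/-- The determinant. -/
def BDet {R : Type*} [CommRing R] (n : ℕ) (f g : Fin (n + 5) → R) : R := (BSq n f g).det

theorem sqE_map {R S : Type*} [CommRing R] [CommRing S] (φ : R →+* S) (i i' : ℕ) :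
    φ (sqE R i i') = sqE S i i' := by
  unfold sqE
  split_ifs <;> simp [map_ofNat]

theorem BMat_map {R S : Type*} [CommRing R] [CommRing S] (φ : R →+* S) (n : ℕ)
    (f g : Fin (n + 5) → R) : (BMat n f g).map φ = BMat n (fun k => φ (f k)) (fun k => φ (g k)) := by
  ext r c
  rcases r with ⟨l, i', j'⟩ | r | r
  · simp only [BMat, Matrix.map_apply, map_mul, sqE_map]
    split_ifs <;> simp
  · simp only [BMat, Matrix.map_apply]
    split_ifs <;> simp
  · simp only [BMat, Matrix.map_apply]
    split_ifs <;> simp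

theorem BSq_map {R S : Type*} [CommRing R] [CommRing S] (φ : R →+* S) (n : ℕ)
    (f g : Fin (n + 5) → R) : (BSq n f g).map φ = BSq n (fun k => φ (f k)) (fun k => φ (g k)) := by
  unfold BSq
  rw [← BMat_map]
  rfl

theorem BDet_map {R S : Type*} [CommRing R] [CommRing S] (φ : R →+* S) (n : ℕ)
    (f g : Fin (n + 5) → R) : φ (BDet n f g) = BDet n (fun k => φ (f k)) (fun k => φ (g k)) := by
  unfold BDet
  rw [← BSq_map, RingHom.map_det]
  rfl

/-- polynomial with given coefficients -/
def cpoly {R : Type*} [CommRing R] {N : ℕ} (f : Fin N → R) : R[X] := ∑ k, C (f k) * X ^ (k : ℕ)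

theorem cpoly_coeff {R : Type*} [CommRing R] {N : ℕ} (f : Fin N → R) (k : Fin N) :
    (cpoly f).coeff k = f k := by
  simp [cpoly, Polynomial.coeff_X_pow, Fin.val_inj]

theorem cpoly_degree {R : Type*} [CommRing R] {N : ℕ} (f : Fin N → R) :
    (cpoly f).degree < N := by
  unfold cpoly
  refine lt_of_le_of_lt (Polynomial.degree_sum_le _ _) ?_
  refine (Finset.sup_lt_iff (WithBot.bot_lt_coe N)).2 ?_
  intro b _
  refine lt_of_le_of_lt (Polynomial.degree_C_mul_X_pow_le _ _) ?_
  exact Nat.cast_lt.2 b.2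

theorem cpoly_of {R : Type*} [CommRing R] {N : ℕ} (p : R[X]) (hp : p.degree < N) :
    cpoly (fun k : Fin N => p.coeff k) = p := by
  unfold cpoly
  rw [Fin.sum_univ_eq_sum_range (fun k => C (p.coeff k) * X ^ k) N]
  by_cases h : p = 0
  · simp [h]
  · exact (p.as_sum_range_C_mul_X_pow' ((natDegree_lt_iff_degree_lt h).2 hp)).symm

/-- left kernel vector from a solution -/
def kerVec {R : Type*} [CommRing R] (n : ℕ) (c0 c1 a0 a1 b0 b1 : R) (h : R[X]) : BRow n → R :=
  fun r => match r with
    | Sum.inl (l, i', j') => h.coeff l * (a1 ^ (i' : ℕ) * a0 ^ (2 * n + 3 - (i' : ℕ))) *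
        (b1 ^ (j' : ℕ) * b0 ^ (2 * n + 5 - (j' : ℕ)))
    | Sum.inr (Sum.inl r) => - c0 * (a1 ^ (r.1 : ℕ) * a0 ^ (2 * n + 1 - (r.1 : ℕ))) *
        (b1 ^ (r.2 : ℕ) * b0 ^ (2 * n + 3 - (r.2 : ℕ)))
    | Sum.inr (Sum.inr r) => - c1 * (a1 ^ (r.1 : ℕ) * a0 ^ (2 * n + 1 - (r.1 : ℕ))) *
        (b1 ^ (r.2 : ℕ) * b0 ^ (2 * n + 3 - (r.2 : ℕ)))

theorem coeff_shift {R : Type*} [CommRing R] (n : ℕ) (h : R[X]) (hh : h.degree < (n + 1 : ℕ))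
    (k e : ℕ) :
    (h * X ^ e).coeff k = ∑ l : Fin (n + 1), h.coeff l * if k = l + e then 1 else 0 := by
  rw [Fin.sum_univ_eq_sum_range (fun l => h.coeff l * if k = l + e then 1 else 0) (n + 1),
    Polynomial.coeff_mul_X_pow']
  split_ifs with hk
  · by_cases h2 : k - e < n + 1
    · rw [Finset.sum_eq_single (k - e)]
      · simp [Nat.sub_add_cancel hk]
      · intro b _ hb
        rw [if_neg (by omega)]; simp
      · intro hb
        simp only [Finset.mem_range] at hb; omega
    · rw [Finset.sum_eq_zero]
      · apply Polynomial.coeff_eq_zero_of_degree_lt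
        refine lt_of_lt_of_le hh ?_
        exact_mod_cast (not_lt.1 h2)
      · intro b hb
        simp only [Finset.mem_range] at hb
        rw [if_neg (by omega)]; simp
  · rw [Finset.sum_eq_zero]
    intro b _
    rw [if_neg (by omega)]; simp

theorem kerVec_mul {R : Type*} [CommRing R] (n : ℕ) (c0 c1 a0 a1 b0 b1 : R) (h : R[X])
    (hh : h.degree < (n + 1 : ℕ)) (f g : Fin (n + 5) → R)
    (hs : C c0 * cpoly f + C c1 * cpoly g = (C a0 * X - C a1) ^ 2 * (C b0 * X - C b1) ^ 2 * h) :
    Matrix.vecMul (kerVec n c0 c1 a0 a1 b0 b1 h) (BMat n f g) = 0 := by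
  funext c
  obtain ⟨k, i, j⟩ := c
  have hk := congrArg (fun p => p.coeff (k : ℕ)) hs
  simp only [coeff_add, coeff_C_mul, cpoly_coeff] at hk
  have hexp : (C a0 * X - C a1) ^ 2 * (C b0 * X - C b1) ^ 2 * h =
      C (a0 ^ 2 * b0 ^ 2) * (h * X ^ 4) - C (2 * a0 ^ 2 * b0 * b1) * (h * X ^ 3)
      + C (a0 ^ 2 * b1 ^ 2) * (h * X ^ 2)
      - C (2 * (a0 * a1) * b0 ^ 2) * (h * X ^ 3) + C (4 * (a0 * a1) * (b0 * b1)) * (h * X ^ 2)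
      - C (2 * (a0 * a1) * b1 ^ 2) * (h * X ^ 1)
      + C (a1 ^ 2 * b0 ^ 2) * (h * X ^ 2) - C (2 * a1 ^ 2 * (b0 * b1)) * (h * X ^ 1)
      + C (a1 ^ 2 * b1 ^ 2) * (h * X ^ 0) := by
    simp only [map_mul, map_pow, map_ofNat]
    ring
  rw [hexp] at hk
  simp only [coeff_add, coeff_sub, coeff_C_mul, coeff_shift n h hh] at hk
  simp only [Matrix.vecMul, dotProduct, Fintype.sum_sum_type, kerVec, BMat, Pi.zero_apply]
  have e1 : ∀ c : R, ∀ t : R, ∑ r : Fin (2 * n + 2) × Fin (2 * n + 4),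
      -c * (a1 ^ (r.1 : ℕ) * a0 ^ (2 * n + 1 - (r.1 : ℕ))) *
        (b1 ^ (r.2 : ℕ) * b0 ^ (2 * n + 3 - (r.2 : ℕ))) * (if r = (i, j) then t else 0) =
      -c * (a1 ^ (i : ℕ) * a0 ^ (2 * n + 1 - (i : ℕ))) *
        (b1 ^ (j : ℕ) * b0 ^ (2 * n + 3 - (j : ℕ))) * t := by
    intro c t
    simp
  rw [e1, e1]
  have e2 : ∀ l : Fin (n + 1), ∑ p : Fin (2 * n + 4) × Fin (2 * n + 6),
      h.coeff l * (a1 ^ (p.1 : ℕ) * a0 ^ (2 * n + 3 - (p.1 : ℕ))) *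
        (b1 ^ (p.2 : ℕ) * b0 ^ (2 * n + 5 - (p.2 : ℕ))) *
       (sqE R i p.1 * (sqE R j p.2 * if (k : ℕ) + p.1 + p.2 = l + 4 + i + j then 1 else 0)) =
      (a1 ^ (i : ℕ) * a0 ^ (2 * n + 1 - (i : ℕ))) *
        (b1 ^ (j : ℕ) * b0 ^ (2 * n + 3 - (j : ℕ))) *
      ( (a0 ^ 2 * b0 ^ 2) * (h.coeff l * if (k : ℕ) = l + 4 then 1 else 0)
       - (2 * a0 ^ 2 * b0 * b1) * (h.coeff l * if (k : ℕ) = l + 3 then 1 else 0)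
      + (a0 ^ 2 * b1 ^ 2) * (h.coeff l * if (k : ℕ) = l + 2 then 1 else 0)
      - (2 * (a0 * a1) * b0 ^ 2) * (h.coeff l * if (k : ℕ) = l + 3 then 1 else 0)
      + (4 * (a0 * a1) * (b0 * b1)) * (h.coeff l * if (k : ℕ) = l + 2 then 1 else 0)
      - (2 * (a0 * a1) * b1 ^ 2) * (h.coeff l * if (k : ℕ) = l + 1 then 1 else 0)
      + (a1 ^ 2 * b0 ^ 2) * (h.coeff l * if (k : ℕ) = l + 2 then 1 else 0)
      - (2 * a1 ^ 2 * (b0 * b1)) * (h.coeff l * if (k : ℕ) = l + 1 then 1 else 0)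
      + (a1 ^ 2 * b1 ^ 2) * (h.coeff l * if (k : ℕ) = l + 0 then 1 else 0)) := by
    intro l
    rw [Fintype.sum_prod_type]
    obtain ⟨G, hG⟩ : ∃ G : ℕ → ℕ → R, G = fun x y =>
        h.coeff l * (a1 ^ x * a0 ^ (2 * n + 3 - x)) * (b1 ^ y * b0 ^ (2 * n + 5 - y)) *
          if (k : ℕ) + x + y = l + 4 + i + j then 1 else 0 := ⟨_, rfl⟩
    have hA : ∀ x : Fin (2 * n + 4), ∑ y : Fin (2 * n + 6),
      h.coeff l * (a1 ^ (x : ℕ) * a0 ^ (2 * n + 3 - (x : ℕ))) *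
        (b1 ^ (y : ℕ) * b0 ^ (2 * n + 5 - (y : ℕ))) *
       (sqE R i x * (sqE R j y * if (k : ℕ) + x + y = l + 4 + i + j then 1 else 0)) =
       sqE R i x * (G x j - 2 * G x (j + 1) + G x (j + 2)) := by
      intro x
      rw [← sum_sqE (2 * n + 6) j (by omega) (fun y : ℕ => G x y), Finset.mul_sum]
      refine Finset.sum_congr rfl fun y _ => ?_
      rw [hG]
      ring
    rw [Finset.sum_congr rfl (fun x _ => hA x), sum_sqE (2 * n + 4) i (by omega)
      (fun x => G x j - 2 * G x (j + 1) + G x (j + 2))]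
    rw [hG]
    have hi := i.2
    have hj := j.2
    have r0 : 2 * n + 3 - (i : ℕ) = (2 * n + 1 - i) + 2 := by omega
    have r1 : 2 * n + 3 - ((i : ℕ) + 1) = (2 * n + 1 - i) + 1 := by omega
    have r2 : 2 * n + 3 - ((i : ℕ) + 2) = (2 * n + 1 - i) := by omega
    have s0 : 2 * n + 5 - (j : ℕ) = (2 * n + 3 - j) + 2 := by omega
    have s1 : 2 * n + 5 - ((j : ℕ) + 1) = (2 * n + 3 - j) + 1 := by omega
    have s2 : 2 * n + 5 - ((j : ℕ) + 2) = (2 * n + 3 - j) := by omega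
    have t00 : ((k : ℕ) + i + j = l + 4 + i + j) = ((k : ℕ) = l + 4) := by
      apply propext; omega
    have t01 : ((k : ℕ) + i + (j + 1) = l + 4 + i + j) = ((k : ℕ) = l + 3) := by
      apply propext; omega
    have t02 : ((k : ℕ) + i + (j + 2) = l + 4 + i + j) = ((k : ℕ) = l + 2) := by
      apply propext; omega
    have t10 : ((k : ℕ) + (i + 1) + j = l + 4 + i + j) = ((k : ℕ) = l + 3) := by
      apply propext; omega
    have t11 : ((k : ℕ) + (i + 1) + (j + 1) = l + 4 + i + j) = ((k : ℕ) = l + 2) := by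
      apply propext; omega
    have t12 : ((k : ℕ) + (i + 1) + (j + 2) = l + 4 + i + j) = ((k : ℕ) = l + 1) := by
      apply propext; omega
    have t20 : ((k : ℕ) + (i + 2) + j = l + 4 + i + j) = ((k : ℕ) = l + 2) := by
      apply propext; omega
    have t21 : ((k : ℕ) + (i + 2) + (j + 1) = l + 4 + i + j) = ((k : ℕ) = l + 1) := by
      apply propext; omega
    have t22 : ((k : ℕ) + (i + 2) + (j + 2) = l + 4 + i + j) = ((k : ℕ) = l + 0) := by
      apply propext; omega
    simp only [r0, r1, r2, s0, s1, s2, t00, t01, t02, t10, t11, t12, t20, t21, t22]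
    ring
  rw [Fintype.sum_prod_type, Finset.sum_congr rfl (fun x _ => e2 x), ← Finset.mul_sum]
  simp only [Finset.sum_add_distrib, Finset.sum_sub_distrib, ← Finset.mul_sum]
  rw [← hk]
  ring

/-- The pencil spanned by `f`, `g` (polynomials of degree at most `n+4`) has a member with two
double roots (possibly equal, possibly at infinity). -/
def BSol (n : ℕ) (f g : Fin (n + 5) → ℂ) : Prop :=
  ∃ (c0 c1 a0 a1 b0 b1 : ℂ) (h : ℂ[X]), (c0 ≠ 0 ∨ c1 ≠ 0) ∧ (a0 ≠ 0 ∨ a1 ≠ 0) ∧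
    (b0 ≠ 0 ∨ b1 ≠ 0) ∧ h.degree < (n + 1 : ℕ) ∧
    C c0 * cpoly f + C c1 * cpoly g = (C a0 * X - C a1) ^ 2 * (C b0 * X - C b1) ^ 2 * h

/-- Same with distinct finite double roots. -/
def BSolF (n : ℕ) (f g : Fin (n + 5) → ℂ) : Prop :=
  ∃ (c0 c1 a b : ℂ) (h : ℂ[X]), (c0 ≠ 0 ∨ c1 ≠ 0) ∧ a ≠ b ∧ h.degree < (n + 1 : ℕ) ∧
    C c0 * cpoly f + C c1 * cpoly g = (X - C a) ^ 2 * (X - C b) ^ 2 * h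

theorem vecMul_BSq {R : Type*} [CommRing R] (n : ℕ) (f g : Fin (n + 5) → R) (y : BRow n → R) :
    Matrix.vecMul (fun c => y ((bequiv n).symm c)) (BSq n f g) = Matrix.vecMul y (BMat n f g) := by
  funext c
  simp only [Matrix.vecMul, dotProduct, BSq, Matrix.submatrix_apply, id]
  exact Equiv.sum_comp (bequiv n).symm (fun r => y r * BMat n f g r c)

theorem BDet_eq_zero_of_sol (n : ℕ) (f g : Fin (n + 5) → ℂ) (hs : BSol n f g) :
    BDet n f g = 0 := by
  obtain ⟨c0, c1, a0, a1, b0, b1, h, hc, ha, hb, hh, hs⟩ := hs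
  have key := kerVec_mul n c0 c1 a0 a1 b0 b1 h hh f g hs
  unfold BDet
  rw [← Matrix.exists_vecMul_eq_zero_iff]
  refine ⟨fun c => kerVec n c0 c1 a0 a1 b0 b1 h ((bequiv n).symm c), ?_, ?_⟩
  · intro h0
    have h1 : ∀ r, kerVec n c0 c1 a0 a1 b0 b1 h r = 0 := fun r => by
      have := congrFun h0 (bequiv n r)
      simpa using this
    have hA : ∃ i : Fin (2 * n + 2), a1 ^ (i : ℕ) * a0 ^ (2 * n + 1 - (i : ℕ)) ≠ 0 := by
      rcases ha with h | h
      · exact ⟨⟨0, by omega⟩, by simpa using h⟩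
      · exact ⟨⟨2 * n + 1, by omega⟩, by simpa using h⟩
    have hB : ∃ i : Fin (2 * n + 4), b1 ^ (i : ℕ) * b0 ^ (2 * n + 3 - (i : ℕ)) ≠ 0 := by
      rcases hb with h | h
      · exact ⟨⟨0, by omega⟩, by simpa using h⟩
      · exact ⟨⟨2 * n + 3, by omega⟩, by simpa using h⟩
    obtain ⟨i, hi⟩ := hA
    obtain ⟨j, hj⟩ := hB
    rcases hc with h | h
    · have := h1 (Sum.inr (Sum.inl (i, j)))
      simp only [kerVec] at this
      exact mul_ne_zero (mul_ne_zero (neg_ne_zero.2 h) hi) hj this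
    · have := h1 (Sum.inr (Sum.inr (i, j)))
      simp only [kerVec] at this
      exact mul_ne_zero (mul_ne_zero (neg_ne_zero.2 h) hi) hj this
  · rw [vecMul_BSq, key]

theorem adjugate_eq_zero_of_two {ι : Type*} [Fintype ι] [DecidableEq ι] (M : Matrix ι ι ℂ)
    (y z : ι → ℂ) (hy : Matrix.vecMul y M = 0) (hz : Matrix.vecMul z M = 0)
    (hyz : ∀ α β : ℂ, α • y + β • z = 0 → α = 0 ∧ β = 0) : M.adjugate = 0 := by
  ext i j
  rw [Matrix.adjugate_apply, Matrix.zero_apply]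
  obtain ⟨w, hw0, hwM, hwj⟩ : ∃ w : ι → ℂ, w ≠ 0 ∧ Matrix.vecMul w M = 0 ∧ w j = 0 := by
    by_cases h : z j = 0
    · refine ⟨z, ?_, hz, h⟩
      intro h0
      have := (hyz 0 1 (by simp [h0])).2
      simp at this
    · refine ⟨z j • y + (- y j) • z, ?_, ?_, ?_⟩
      · intro h0
        exact h (hyz _ _ h0).1
      · rw [Matrix.add_vecMul, Matrix.smul_vecMul, Matrix.smul_vecMul, hy, hz]; simp
      · simp; ring
  rw [← Matrix.exists_vecMul_eq_zero_iff]
  refine ⟨w, hw0, ?_⟩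
  rw [← hwM]
  funext c
  simp only [Matrix.vecMul, dotProduct]
  refine Finset.sum_congr rfl fun r _ => ?_
  by_cases hr : r = j
  · subst hr; simp [hwj]
  · rw [Matrix.updateRow_ne hr]

theorem adjugate_eq_zero_of_solF (n : ℕ) (f g : Fin (n + 5) → ℂ) (hs : BSolF n f g) :
    (BSq n f g).adjugate = 0 := by
  obtain ⟨c0, c1, a, b, h, hc, hab, hh, hs⟩ := hs
  have k1 := kerVec_mul n c0 c1 1 a 1 b h hh f g (by rw [hs]; simp)
  have k2 := kerVec_mul n c0 c1 1 b 1 a h hh f g (by rw [hs, C_1]; ring)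
  refine adjugate_eq_zero_of_two _ (fun c => kerVec n c0 c1 1 a 1 b h ((bequiv n).symm c))
    (fun c => kerVec n c0 c1 1 b 1 a h ((bequiv n).symm c)) (by rw [vecMul_BSq, k1])
    (by rw [vecMul_BSq, k2]) ?_
  intro α β h0
  have h1 : ∀ r, α * kerVec n c0 c1 1 a 1 b h r + β * kerVec n c0 c1 1 b 1 a h r = 0 := fun r => by
    have := congrFun h0 (bequiv n r)
    simpa using this
  have h2 : α + β = 0 ∧ α * a + β * b = 0 := by
    rcases hc with hc | hc
    · have e0 := h1 (Sum.inr (Sum.inl (⟨0, by omega⟩, ⟨0, by omega⟩)))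
      have e1 := h1 (Sum.inr (Sum.inl (⟨1, by omega⟩, ⟨0, by omega⟩)))
      simp only [kerVec] at e0 e1
      constructor
      · apply mul_left_cancel₀ hc; linear_combination - e0
      · apply mul_left_cancel₀ hc; linear_combination - e1
    · have e0 := h1 (Sum.inr (Sum.inr (⟨0, by omega⟩, ⟨0, by omega⟩)))
      have e1 := h1 (Sum.inr (Sum.inr (⟨1, by omega⟩, ⟨0, by omega⟩)))
      simp only [kerVec] at e0 e1
      constructor
      · apply mul_left_cancel₀ hc; linear_combination - e0
      · apply mul_left_cancel₀ hc; linear_combination - e1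
  have h3 : α = 0 := by
    apply mul_left_cancel₀ (sub_ne_zero.2 hab)
    linear_combination h2.2 - b * h2.1
  refine ⟨h3, ?_⟩
  have := h2.1
  rw [h3] at this
  simpa using this

theorem BDet_scale {R : Type*} [CommRing R] (n : ℕ) (f g f' g' : Fin (n + 5) → R)
    (cw : BCol n → R) (rw' : BRow n → R)
    (h : ∀ r c, cw c * BMat n f' g' r c = rw' r * BMat n f g r c) :
    (∏ c, cw c) * BDet n f' g' = (∏ r, rw' r) * BDet n f g := by
  unfold BDet
  rw [← Matrix.det_mul_row, ← Equiv.prod_comp (bequiv n).symm rw', ← Matrix.det_mul_column]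
  congr 1
  ext i j
  simpa [BSq] using h ((bequiv n).symm i) j

theorem BDet_smul_left {R : Type*} [CommRing R] (n : ℕ) (f g : Fin (n + 5) → R) (t : R) :
    BDet n (fun k => t * f k) g = t ^ ((2 * n + 2) * (2 * n + 4)) * BDet n f g := by
  have := BDet_scale n f g (fun k => t * f k) g (fun _ => 1)
    (fun r => match r with
      | Sum.inl _ => 1
      | Sum.inr (Sum.inl _) => t
      | Sum.inr (Sum.inr _) => 1) (by
      intro r c
      rcases r with r | r | r <;> simp [BMat])
  rw [Fintype.prod_sum_type, Fintype.prod_sum_type] at this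
  simpa using this

theorem BDet_smul_right {R : Type*} [CommRing R] (n : ℕ) (f g : Fin (n + 5) → R) (t : R) :
    BDet n f (fun k => t * g k) = t ^ ((2 * n + 2) * (2 * n + 4)) * BDet n f g := by
  have := BDet_scale n f g f (fun k => t * g k) (fun _ => 1)
    (fun r => match r with
      | Sum.inl _ => 1
      | Sum.inr (Sum.inl _) => 1
      | Sum.inr (Sum.inr _) => t) (by
      intro r c
      rcases r with r | r | r <;> simp [BMat])
  rw [Fintype.prod_sum_type, Fintype.prod_sum_type] at this
  simpa using this

def wCol (n : ℕ) (c : BCol n) : ℕ := c.1 + (2 * n + 1 - c.2.1) + (2 * n + 3 - c.2.2)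

def wRow (n : ℕ) (r : BRow n) : ℕ := match r with
  | Sum.inl (l, i', j') => l + (2 * n + 3 - i') + (2 * n + 5 - j')
  | Sum.inr (Sum.inl r) => n + 4 + (2 * n + 1 - r.1) + (2 * n + 3 - r.2)
  | Sum.inr (Sum.inr r) => n + 4 + (2 * n + 1 - r.1) + (2 * n + 3 - r.2)

theorem sum_fin_q (N : ℕ) : ∑ i : Fin N, ((i : ℕ) : ℚ) = N * (N - 1) / 2 := by
  rw [Fin.sum_univ_eq_sum_range (fun i => (i : ℚ)) N]
  induction N with
  | zero => simp
  | succ k ih => rw [Finset.sum_range_succ, ih]; push_cast; ring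

theorem sum_fin_rev_q (N M : ℕ) (h : N = M + 1) :
    ∑ i : Fin N, ((M - (i : ℕ) : ℕ) : ℚ) = N * (N - 1) / 2 := by
  have : ∀ i : Fin N, ((M - (i : ℕ) : ℕ) : ℚ) = M - ((i : ℕ) : ℚ) := fun i => by
    rw [Nat.cast_sub (by omega)]
  rw [Finset.sum_congr rfl (fun i _ => this i), Finset.sum_sub_distrib, sum_fin_q]
  simp [h]
  ring

theorem sum_weights (n : ℕ) :
    ∑ r, wRow n r = ∑ c, wCol n c + 2 * ((n + 4) * (2 * (n + 1) * (n + 2))) := by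
  have : ((∑ r, wRow n r : ℕ) : ℚ) =
      ((∑ c, wCol n c + 2 * ((n + 4) * (2 * (n + 1) * (n + 2))) : ℕ) : ℚ) := by
    push_cast
    rw [Fintype.sum_sum_type, Fintype.sum_sum_type]
    simp only [Fintype.sum_prod_type, wRow, wCol, Nat.cast_add, Finset.sum_add_distrib,
      Finset.sum_const, Finset.card_univ, Fintype.card_fin, Fintype.card_prod, nsmul_eq_mul]
    simp only [← Finset.mul_sum, sum_fin_q, sum_fin_rev_q (2 * n + 4) (2 * n + 3) rfl,
      sum_fin_rev_q (2 * n + 6) (2 * n + 5) rfl, sum_fin_rev_q (2 * n + 2) (2 * n + 1) rfl]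
    push_cast
    ring
  exact_mod_cast this

theorem BDet_weight {R : Type*} [CommRing R] [IsDomain R] (n : ℕ) (f g : Fin (n + 5) → R) (t : R)
    (ht : t ≠ 0) :
    BDet n (fun k => t ^ (n + 4 - (k : ℕ)) * f k) (fun k => t ^ (n + 4 - (k : ℕ)) * g k) =
      t ^ (2 * ((n + 4) * (2 * (n + 1) * (n + 2)))) * BDet n f g := by
  have := BDet_scale n f g (fun k => t ^ (n + 4 - (k : ℕ)) * f k)
    (fun k => t ^ (n + 4 - (k : ℕ)) * g k) (fun c => t ^ wCol n c) (fun r => t ^ wRow n r) (by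
      intro r c
      obtain ⟨k, i, j⟩ := c
      have hk := k.2
      have hi := i.2
      have hj := j.2
      rcases r with ⟨l, i', j'⟩ | r | r
      · simp only [BMat, wCol, wRow]
        have hi' := i'.2
        have hj' := j'.2
        split_ifs with hh
        · rw [show (k : ℕ) + (2 * n + 1 - i) + (2 * n + 3 - j) =
            l + (2 * n + 3 - i') + (2 * n + 5 - j') by omega]
        · simp
      · simp only [BMat, wCol, wRow]
        split_ifs with hh
        · rw [hh, ← mul_assoc, ← pow_add]
          congr 2
          dsimp only
          omega
        · simp
      · simp only [BMat, wCol, wRow]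
        split_ifs with hh
        · rw [hh, ← mul_assoc, ← pow_add]
          congr 2
          dsimp only
          omega
        · simp)
  rw [Finset.prod_pow_eq_pow_sum, Finset.prod_pow_eq_pow_sum, sum_weights, pow_add, mul_assoc] at this
  exact mul_left_cancel₀ (pow_ne_zero _ ht) this

theorem sq_dvd_of_mul_eq {R : ℂ[X]} (z : ℂ) (e U : ℂ[X]) (he : e.eval z ≠ 0)
    (h : R * e = (X - C z) ^ 2 * U) : (X - C z) ^ 2 ∣ R := by
  have hc : IsCoprime ((X - C z) ^ 2) e := by
    apply IsCoprime.pow_left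
    rw [(Polynomial.irreducible_X_sub_C z).coprime_iff_not_dvd, Polynomial.dvd_iff_isRoot]
    exact he
  exact hc.dvd_of_dvd_mul_right ⟨U, h⟩

theorem eq_zero_of_forall_sq_dvd {ι : Type*} (s : Finset ι) (z : ι → ℂ) (hz : Function.Injective z)
    (R : ℂ[X]) (hR : R.degree < (2 * s.card : ℕ)) (h : ∀ i ∈ s, (X - C (z i)) ^ 2 ∣ R) : R = 0 := by
  have hd : ∏ i ∈ s, (X - C (z i)) ^ 2 ∣ R := by
    apply Finset.prod_dvd_of_coprime _ h
    intro i _ j _ hij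
    apply IsCoprime.pow
    exact Polynomial.pairwise_coprime_X_sub_C hz hij
  have hm : (∏ i ∈ s, (X - C (z i)) ^ 2).Monic :=
    Polynomial.monic_prod_of_monic _ _ fun i _ => (monic_X_sub_C _).pow 2
  by_contra h0
  have := Polynomial.degree_le_of_dvd hd h0
  rw [Polynomial.degree_eq_natDegree hm.ne_zero] at this
  have e : (∏ i ∈ s, (X - C (z i)) ^ 2).natDegree = 2 * s.card := by
    rw [Polynomial.natDegree_prod_of_monic _ _ fun i _ => (monic_X_sub_C _).pow 2]
    simp [mul_comm]
  rw [e] at this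
  exact absurd (lt_of_le_of_lt this hR) (lt_irrefl _)

theorem eval_C_degree (N : ℕ) (T : ℂ[X][X]) (hT : ∀ j, T.coeff j ∈ degreeLT ℂ N) (y : ℂ) :
    (T.eval (C y)) ∈ degreeLT ℂ N := by
  rw [eval_eq_sum_range]
  refine Submodule.sum_mem _ fun j _ => ?_
  rw [← C_pow, mul_comm, ← smul_eq_C_mul]
  exact Submodule.smul_mem _ _ (hT j)

theorem derivative_coeff_mem (N : ℕ) (T : ℂ[X][X]) (hT : ∀ j, T.coeff j ∈ degreeLT ℂ N) (j : ℕ) :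
    (derivative T).coeff j ∈ degreeLT ℂ N := by
  rw [coeff_derivative]
  have : T.coeff (j + 1) * ((j : ℂ[X]) + 1) = ((j : ℂ) + 1) • T.coeff (j + 1) := by
    rw [smul_eq_C_mul]; simp; ring
  rw [this]
  exact Submodule.smul_mem _ _ (hT _)

theorem sq_dvd_of_eval {R : Type*} [CommRing R] (T : R[X]) (r : R) (h0 : T.eval r = 0)
    (h1 : (derivative T).eval r = 0) : (X - C r) ^ 2 ∣ T := by
  obtain ⟨U, rfl⟩ := dvd_iff_isRoot.2 h0
  rw [derivative_mul] at h1
  simp at h1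
  obtain ⟨W, rfl⟩ := dvd_iff_isRoot.2 h1
  exact ⟨W, by ring⟩

/-- the embedding of constants -/
def kap : ℂ →+* ℂ[X][X] := (C : ℂ[X] →+* ℂ[X][X]).comp (C : ℂ →+* ℂ[X])

theorem core_vanish (n : ℕ) (z : Fin (n + 2) → ℂ) (hz : Function.Injective z) (t : ℂ)
    (ht : ∀ i j, i ≠ j → t ≠ z i * z j) (T : ℂ[X][X]) (S : Fin (n + 2) → ℂ[X][X])
    (hT : ∀ j, T.coeff j ∈ degreeLT ℂ (2 * n + 2)) (hTd : T.degree < (2 * n + 4 : ℕ))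
    (hS : ∀ i j, (S i).coeff j ∈ degreeLT ℂ (2 * n + 2))
    (hst : ∀ i j, i ≠ j →
      ((kap (z i) - C X) * (kap (z i) - X)) ^ 2 * S i
        - ((kap (z j) - C X) * (kap (z j) - X)) ^ 2 * S j
        + (kap (z i) - kap (z j)) * (T * (kap (z i) * kap (z j)
          + 2 * (C X * X - kap (z i) * kap (z j))
          + (kap (z i) + kap (z j) - C X - X) ^ 2 - kap t)) = 0) :
    T = 0 ∧ ∀ i, S i = 0 := by
  have hzne : ∀ i j, i ≠ j → z i - z j ≠ 0 := fun i j h => sub_ne_zero.2 (hz.ne h)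
  have hcard : ∀ j : Fin (n + 2), (Finset.univ.erase j).card = n + 1 := fun j => by
    rw [Finset.card_erase_of_mem (Finset.mem_univ _)]; simp
  have step1 : ∀ j, T.eval (C (z j)) = 0 := by
    intro j
    apply eq_zero_of_forall_sq_dvd (Finset.univ.erase j) z hz
    · rw [hcard]
      have := mem_degreeLT.1 (eval_C_degree _ T hT (z j))
      rwa [mul_add, mul_one]
    · intro i hi
      have hij := Finset.ne_of_mem_erase hi
      have h1 := congrArg (eval (C (z j))) (hst i j hij)
      simp only [kap, RingHom.comp_apply, eval_add, eval_sub, eval_mul, eval_pow, eval_C, eval_X,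
        eval_ofNat, eval_zero] at h1
      apply sq_dvd_of_mul_eq (z i) (C (z i) * C (z j)
          + 2 * (X * C (z j) - C (z i) * C (z j)) + (C (z i) + C (z j) - X - C (z j)) ^ 2 - C t)
          (-C (z i - z j)⁻¹ * ((C (z i) - C (z j)) ^ 2 * eval (C (z j)) (S i)))
      · simp only [eval_add, eval_sub, eval_mul, eval_pow, eval_C, eval_X, eval_ofNat]
        intro h
        apply ht i j hij
        linear_combination -h
      · have hc : (C (z i) - C (z j)) * C ((z i - z j)⁻¹) = (1 : ℂ[X]) := by
          rw [← C_sub, ← C_mul, mul_inv_cancel₀ (hzne i j hij), C_1]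
        linear_combination (C ((z i - z j)⁻¹)) * h1 - (T.eval (C (z j)) * (C (z i) * C (z j)
          + 2 * (X * C (z j) - C (z i) * C (z j)) + (C (z i) + C (z j) - X - C (z j)) ^ 2 - C t)) * hc
  have step2 : ∀ j, (derivative T).eval (C (z j)) = 0 := by
    intro j
    apply eq_zero_of_forall_sq_dvd (Finset.univ.erase j) z hz
    · rw [hcard]
      have := mem_degreeLT.1 (eval_C_degree _ _ (derivative_coeff_mem _ T hT) (z j))
      rwa [mul_add, mul_one]
    · intro i hi
      have hij := Finset.ne_of_mem_erase hi
      have h1 := congrArg (fun p => eval (C (z j)) (derivative p)) (hst i j hij)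
      simp only [kap, RingHom.comp_apply, derivative_add, derivative_sub, derivative_mul, derivative_pow,
        derivative_C, derivative_X, derivative_ofNat, eval_add, eval_sub, eval_mul, eval_pow,
        eval_C, eval_X, eval_ofNat, eval_zero, eval_one, derivative_zero, step1 j] at h1
      apply sq_dvd_of_mul_eq (z i) (C (z i) * C (z j)
          + 2 * (X * C (z j) - C (z i) * C (z j)) + (C (z i) + C (z j) - X - C (z j)) ^ 2 - C t)
          (-C (z i - z j)⁻¹ * ((C (z i) - C (z j)) ^ 2 * eval (C (z j)) (derivative (S i))
            - 2 * (C (z i) - C (z j)) * eval (C (z j)) (S i)))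
      · simp only [eval_add, eval_sub, eval_mul, eval_pow, eval_C, eval_X, eval_ofNat]
        intro h
        apply ht i j hij
        linear_combination -h
      · have hc : (C (z i) - C (z j)) * C ((z i - z j)⁻¹) = (1 : ℂ[X]) := by
          rw [← C_sub, ← C_mul, mul_inv_cancel₀ (hzne i j hij), C_1]
        push_cast at h1
        linear_combination (C ((z i - z j)⁻¹)) * h1 - ((derivative T).eval (C (z j)) * (C (z i) * C (z j)
          + 2 * (X * C (z j) - C (z i) * C (z j)) + (C (z i) + C (z j) - X - C (z j)) ^ 2 - C t)) * hc
  have hT0 : T = 0 := by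
    have hd : ∏ i, (X - C (C (z i))) ^ 2 ∣ T := by
      apply Finset.prod_dvd_of_coprime _ (fun i _ => sq_dvd_of_eval _ _ (step1 i) (step2 i))
      intro i _ j _ hij
      apply IsCoprime.pow
      apply isCoprime_X_sub_C_of_isUnit_sub
      rw [← C_sub, isUnit_C]
      exact (hzne i j hij).isUnit
    have hm : (∏ i, (X - C (C (z i))) ^ 2).Monic :=
      Polynomial.monic_prod_of_monic _ _ fun i _ => (monic_X_sub_C _).pow 2
    by_contra h0
    have := Polynomial.degree_le_of_dvd hd h0
    rw [Polynomial.degree_eq_natDegree hm.ne_zero] at this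
    have e : (∏ i, (X - C (C (z i))) ^ 2).natDegree = 2 * n + 4 := by
      rw [Polynomial.natDegree_prod_of_monic _ _ fun i _ => (monic_X_sub_C _).pow 2]
      simp [-map_sum]; ring
    rw [e] at this
    exact absurd (lt_of_le_of_lt this hTd) (lt_irrefl _)
  refine ⟨hT0, ?_⟩
  have hsig : ∀ i j, ((kap (z i) - C X) * (kap (z i) - X)) ^ 2 * S i =
      ((kap (z j) - C X) * (kap (z j) - X)) ^ 2 * S j := by
    intro i j
    by_cases hij : i = j
    · rw [hij]
    · have := hst i j hij
      rw [hT0] at this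
      linear_combination this
  intro i
  apply Polynomial.eq_zero_of_infinite_isRoot
  have hinf : (Set.range (fun y : ℂ => (C y : ℂ[X])) \ {C (z i)}).Infinite := by
    apply Set.Infinite.sdiff _ (Set.finite_singleton _)
    exact Set.infinite_range_of_injective C_injective
  refine hinf.mono ?_
  rintro _ ⟨⟨y, rfl⟩, hy⟩
  have hy' : z i - y ≠ 0 := by
    intro h
    apply hy
    rw [← sub_eq_zero.1 h]; rfl
  have hsy : ∀ i j, (C (z i) - X) ^ 2 * ((C (z i) - C y) ^ 2 * (S i).eval (C y)) =
      (C (z j) - X) ^ 2 * ((C (z j) - C y) ^ 2 * (S j).eval (C y)) := by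
    intro i j
    have h1 := congrArg (eval (C y)) (hsig i j)
    simp only [kap, RingHom.comp_apply, eval_sub, eval_mul, eval_pow, eval_C, eval_X] at h1
    linear_combination h1
  have h0 : (C (z i) - X) ^ 2 * ((C (z i) - C y) ^ 2 * (S i).eval (C y)) = 0 := by
    apply eq_zero_of_forall_sq_dvd Finset.univ z hz
    · by_cases hs : (S i).eval (C y) = 0
      · rw [hs, mul_zero, mul_zero, degree_zero]; exact WithBot.bot_lt_coe _
      have hd := mem_degreeLT.1 (eval_C_degree _ _ (hS i) y)
      rw [← natDegree_lt_iff_degree_lt hs] at hd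
      refine lt_of_le_of_lt (degree_le_natDegree) ?_
      rw [← C_sub, ← C_pow]
      have h3 : ((C (z i) - X) ^ 2 * (C ((z i - y) ^ 2) * (S i).eval (C y))).natDegree ≤
          2 + (S i |>.eval (C y)).natDegree := by
        refine natDegree_mul_le.trans (add_le_add ?_ (natDegree_C_mul_le _ _))
        refine natDegree_pow_le.trans ?_
        have : (C (z i) - X : ℂ[X]).natDegree ≤ 1 := by
          refine (natDegree_sub_le _ _).trans ?_
          simp
        omega
      refine Nat.cast_lt.2 ?_
      simp only [Finset.card_univ, Fintype.card_fin]
      omega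
    · intro k _
      rw [hsy i k]
      exact ⟨((C (z k) - C y) ^ 2 * (S k).eval (C y)), by ring⟩
  have hx : (C (z i) - X : ℂ[X]) ≠ 0 := by
    rw [← neg_ne_zero, neg_sub]; exact X_sub_C_ne_zero _
  have hcy : (C (z i) - C y : ℂ[X]) ≠ 0 := by
    rw [← C_sub]; exact C_ne_zero.2 hy'
  have := (mul_eq_zero.1 ((mul_eq_zero.1 h0).resolve_left (pow_ne_zero _ hx))).resolve_left
    (pow_ne_zero _ hcy)
  exact this

/-- the bivariate polynomial attached to a column vector -/
def thp (n : ℕ) (θ : BCol n → ℂ) (k : Fin (n + 5)) : ℂ[X][X] :=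
  ∑ r : Fin (2 * n + 2) × Fin (2 * n + 4), kap (θ (k, r)) * (C X ^ (r.1 : ℕ) * X ^ (r.2 : ℕ))

/-- the associated functional -/
def Thet (n : ℕ) (θ : BCol n → ℂ) (v : ℂ[X][X][X]) : ℂ[X][X] :=
  ∑ k : Fin (n + 5), v.coeff k * thp n θ k

theorem Thet_add (n : ℕ) (θ : BCol n → ℂ) (v w : ℂ[X][X][X]) :
    Thet n θ (v + w) = Thet n θ v + Thet n θ w := by
  simp [Thet, add_mul, Finset.sum_add_distrib]

theorem Thet_sub (n : ℕ) (θ : BCol n → ℂ) (v w : ℂ[X][X][X]) :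
    Thet n θ (v - w) = Thet n θ v - Thet n θ w := by
  simp [Thet, sub_mul, Finset.sum_sub_distrib]

theorem Thet_C_mul (n : ℕ) (θ : BCol n → ℂ) (c : ℂ[X][X]) (v : ℂ[X][X][X]) :
    Thet n θ (C c * v) = c * Thet n θ v := by
  simp [Thet, Finset.mul_sum, mul_assoc]

theorem Thet_sum {ι : Type*} (s : Finset ι) (n : ℕ) (θ : BCol n → ℂ) (v : ι → ℂ[X][X][X]) :
    Thet n θ (∑ i ∈ s, v i) = ∑ i ∈ s, Thet n θ (v i) := by
  classical
  induction s using Finset.induction_on with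
  | empty => simp [Thet]
  | insert a s ha ih => rw [Finset.sum_insert ha, Thet_add, ih, Finset.sum_insert ha]

theorem Thet_map (n : ℕ) (θ : BCol n → ℂ) (f : Fin (n + 5) → ℂ)
    (h : ∀ r, ∑ k, f k * θ (k, r) = 0) : Thet n θ ((cpoly f).map kap) = 0 := by
  simp only [Thet, coeff_map, cpoly_coeff, thp, Finset.mul_sum]
  rw [Finset.sum_comm]
  apply Finset.sum_eq_zero
  intro r _
  have : kap (∑ k, f k * θ (k, r)) * (C X ^ (r.1 : ℕ) * X ^ (r.2 : ℕ)) = 0 := by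
    rw [h r]; simp
  rw [← this, map_sum, Finset.sum_mul]
  refine Finset.sum_congr rfl fun k _ => ?_
  rw [map_mul]; ring

theorem Thet_sq (n : ℕ) (θ : BCol n → ℂ)
    (hθ : ∀ l, ∑ c, BMat n (0 : Fin (n + 5) → ℂ) 0 (Sum.inl l) c * θ c = 0)
    (h : ℂ[X][X][X]) (hh : h.degree < (n + 1 : ℕ)) :
    Thet n θ ((X - C (C X)) ^ 2 * (X - C X) ^ 2 * h) = 0 := by
  set v : ℂ[X][X][X] := (X - C (C X)) ^ 2 * (X - C X) ^ 2 * h with hv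
  have hvd : v.degree < (n + 5 : ℕ) := by
    by_cases h0 : h = 0
    · rw [hv, h0, mul_zero, degree_zero]; exact WithBot.bot_lt_coe _
    have hm : ((X - C (C X)) ^ 2 * (X - C X) ^ 2 : ℂ[X][X][X]).Monic :=
      ((monic_X_sub_C _).pow 2).mul ((monic_X_sub_C _).pow 2)
    have hv0 : v ≠ 0 := mul_ne_zero hm.ne_zero h0
    rw [← natDegree_lt_iff_degree_lt hv0, hv, natDegree_mul hm.ne_zero h0,
      natDegree_mul ((monic_X_sub_C _).pow 2).ne_zero ((monic_X_sub_C _).pow 2).ne_zero,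
      natDegree_pow, natDegree_pow, natDegree_X_sub_C, natDegree_X_sub_C]
    have := (natDegree_lt_iff_degree_lt h0).2 hh
    omega
  have key := kerVec_mul n (1 : ℂ[X][X]) 0 1 (C X) 1 X h hh (fun k => v.coeff k) 0 (by
    rw [cpoly_of v hvd]; simp [hv])
  have e1 : ∑ c, (Matrix.vecMul (kerVec n (1 : ℂ[X][X]) 0 1 (C X) 1 X h)
      (BMat n (fun k => v.coeff k) 0)) c * kap (θ c) = 0 := by
    rw [key]; simp
  simp only [Matrix.vecMul, dotProduct, Finset.sum_mul] at e1
  rw [Finset.sum_comm, Fintype.sum_sum_type, Fintype.sum_sum_type] at e1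
  have e2 : ∑ x, ∑ c, kerVec n (1 : ℂ[X][X]) 0 1 (C X) 1 X h (Sum.inl x) *
      BMat n (fun k : Fin (n + 5) => v.coeff k) 0 (Sum.inl x) c * kap (θ c) = 0 := by
    apply Finset.sum_eq_zero
    intro x _
    have : kerVec n (1 : ℂ[X][X]) 0 1 (C X) 1 X h (Sum.inl x) *
        kap (∑ c, BMat n (0 : Fin (n + 5) → ℂ) 0 (Sum.inl x) c * θ c) = 0 := by
      rw [hθ x]; simp
    rw [← this, map_sum, Finset.mul_sum]
    refine Finset.sum_congr rfl fun c _ => ?_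
    rw [map_mul]
    have hb := congrFun (congrFun (BMat_map kap n (0 : Fin (n + 5) → ℂ) 0) (Sum.inl x)) c
    rw [Matrix.map_apply] at hb
    rw [hb, mul_assoc]
    rfl
  have e3 : ∑ x, ∑ c, kerVec n (1 : ℂ[X][X]) 0 1 (C X) 1 X h (Sum.inr (Sum.inr x)) *
      BMat n (fun k : Fin (n + 5) => v.coeff k) 0 (Sum.inr (Sum.inr x)) c * kap (θ c) = 0 := by
    simp [kerVec]
  rw [e2, e3, zero_add, add_zero] at e1
  rw [← neg_eq_zero, ← e1, Thet, ← Finset.sum_neg_distrib]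
  simp only [thp, Finset.mul_sum, ← Finset.sum_neg_distrib]
  rw [Finset.sum_comm]
  refine Finset.sum_congr rfl fun r _ => ?_
  rw [Fintype.sum_prod_type]
  refine Finset.sum_congr rfl fun k _ => ?_
  rw [Finset.sum_eq_single r]
  · simp [kerVec, BMat]; ring
  · intro b _ hb
    simp [BMat, hb.symm]
  · simp

theorem thp_coeff_mem (n : ℕ) (θ : BCol n → ℂ) (k : Fin (n + 5)) (j : ℕ) :
    (thp n θ k).coeff j ∈ degreeLT ℂ (2 * n + 2) := by
  simp only [thp, finsetSum_coeff]
  refine Submodule.sum_mem _ fun r _ => ?_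
  rw [kap, RingHom.comp_apply, coeff_C_mul, ← C_pow, coeff_C_mul, ← smul_eq_C_mul]
  apply Submodule.smul_mem
  rw [coeff_X_pow]
  split_ifs
  · rw [mul_one, mem_degreeLT, degree_X_pow]
    exact Nat.cast_lt.2 r.1.2
  · simp

theorem thp_mem (n : ℕ) (θ : BCol n → ℂ) (k : Fin (n + 5)) :
    thp n θ k ∈ degreeLT ℂ[X] (2 * n + 4) := by
  refine Submodule.sum_mem _ fun r _ => ?_
  rw [kap, RingHom.comp_apply, ← C_pow, ← smul_eq_C_mul, ← smul_eq_C_mul]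
  apply Submodule.smul_mem
  apply Submodule.smul_mem
  rw [mem_degreeLT, degree_X_pow]
  exact Nat.cast_lt.2 r.2.2

theorem Thet_coeff_mem (n : ℕ) (θ : BCol n → ℂ) (p : ℂ[X]) (j : ℕ) :
    (Thet n θ (p.map kap)).coeff j ∈ degreeLT ℂ (2 * n + 2) := by
  simp only [Thet, finsetSum_coeff]
  refine Submodule.sum_mem _ fun k _ => ?_
  rw [coeff_map, kap, RingHom.comp_apply, coeff_C_mul, ← smul_eq_C_mul]
  exact Submodule.smul_mem _ _ (thp_coeff_mem n θ k j)

theorem Thet_mem (n : ℕ) (θ : BCol n → ℂ) (p : ℂ[X]) :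
    Thet n θ (p.map kap) ∈ degreeLT ℂ[X] (2 * n + 4) := by
  refine Submodule.sum_mem _ fun k _ => ?_
  rw [coeff_map, kap, RingHom.comp_apply, ← smul_eq_C_mul]
  exact Submodule.smul_mem _ _ (thp_mem n θ k)

theorem thp_eq_zero (n : ℕ) (θ : BCol n → ℂ) (h : ∀ k, thp n θ k = 0) : θ = 0 := by
  funext c
  obtain ⟨k, i, j⟩ := c
  have h1 := congrArg (fun p => (p.coeff (j : ℕ)).coeff (i : ℕ)) (h k)
  simp only [thp, finsetSum_coeff, coeff_zero] at h1
  rw [Finset.sum_eq_single (i, j)] at h1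
  · rw [kap, RingHom.comp_apply, coeff_C_mul, ← C_pow, coeff_C_mul, coeff_C_mul] at h1
    simpa using h1
  · intro r _ hr
    rw [kap, RingHom.comp_apply, coeff_C_mul, ← C_pow, coeff_C_mul, coeff_C_mul]
    by_cases h2 : r.2 = j
    · have : r.1 ≠ i := fun h3 => hr (Prod.ext h3 h2)
      have h4 : (i : ℕ) ≠ r.1 := fun h => this (Fin.ext h.symm)
      simp [h2, coeff_X_pow, h4]
    · have h4 : (j : ℕ) ≠ r.2 := fun h => h2 (Fin.ext h.symm)
      simp [coeff_X_pow, h4]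
  · simp

theorem BDet_ne_zero (n : ℕ) (z : Fin (n + 2) → ℂ) (hz : Function.Injective z) (t : ℂ)
    (ht : ∀ i j, i ≠ j → t ≠ z i * z j) (f g : Fin (n + 5) → ℂ)
    (hf : cpoly f = (∏ i, (X - C (z i))) * (X ^ 2 + C t))
    (hg : cpoly g = (∏ i, (X - C (z i))) * X) : BDet n f g ≠ 0 := by
  intro h0
  unfold BDet at h0
  rw [← Matrix.exists_mulVec_eq_zero_iff] at h0
  obtain ⟨θ, hθ0, hθ⟩ := h0
  apply hθ0
  have hrow : ∀ r, ∑ c, BMat n f g r c * θ c = 0 := fun r => by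
    have := congrFun hθ (bequiv n r)
    simpa [Matrix.mulVec, dotProduct, BSq] using this
  have hinr : ∀ (w : Fin (n + 5) → ℂ) (r : Fin (2 * n + 2) × Fin (2 * n + 4)),
      ∑ c : BCol n, (if r = c.2 then w c.1 else 0) * θ c = ∑ k, w k * θ (k, r) := by
    intro w r
    rw [Fintype.sum_prod_type]
    refine Finset.sum_congr rfl fun k _ => ?_
    rw [Finset.sum_eq_single r]
    · simp
    · intro b _ hb
      simp [hb.symm]
    · simp
  have Hf : Thet n θ ((cpoly f).map kap) = 0 := Thet_map n θ f fun r => by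
    rw [← hinr]; exact hrow (Sum.inr (Sum.inl r))
  have Hg : Thet n θ ((cpoly g).map kap) = 0 := Thet_map n θ g fun r => by
    rw [← hinr]; exact hrow (Sum.inr (Sum.inr r))
  have Hs := Thet_sq n θ (fun l => hrow (Sum.inl l))
  set p : ℂ[X] := ∏ i, (X - C (z i)) with hp
  set P : Fin (n + 2) → ℂ[X] := fun i => ∏ k ∈ Finset.univ.erase i, (X - C (z k)) with hP
  have HpX : Thet n θ ((p.map kap) * X) = 0 := by
    rw [hg] at Hg; simpa using Hg
  have HpX2 : Thet n θ ((p.map kap) * X ^ 2) = - kap t * Thet n θ (p.map kap) := by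
    rw [hf] at Hf
    have e : Polynomial.map kap (p * (X ^ 2 + C t)) = p.map kap * X ^ 2 + C (kap t) * p.map kap := by
      simp [mul_add]; ring
    rw [e, Thet_add, Thet_C_mul] at Hf
    linear_combination Hf
  have core := core_vanish n z hz t ht (Thet n θ (p.map kap)) (fun i => Thet n θ ((P i).map kap))
    (Thet_coeff_mem n θ p) (mem_degreeLT.1 (Thet_mem n θ p)) (fun i => Thet_coeff_mem n θ (P i)) (by
    intro i j hij
    set h : ℂ[X] := ∏ k ∈ (Finset.univ.erase i).erase j, (X - C (z k)) with hh
    have hPi : P i = (X - C (z j)) * h := by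
      rw [hP, hh]
      exact (Finset.mul_prod_erase _ (fun k => X - C (z k)) (by simp [hij.symm])).symm
    have hPj : P j = (X - C (z i)) * h := by
      rw [hP, hh, Finset.erase_right_comm]
      exact (Finset.mul_prod_erase _ (fun k => X - C (z k)) (by simp [hij])).symm
    have hpe : p = (X - C (z i)) * ((X - C (z j)) * h) := by
      rw [← hPi]
      exact (Finset.mul_prod_erase _ (fun k => X - C (z k)) (by simp)).symm
    have hd : (h.map kap).degree < (n + 1 : ℕ) := by
      refine lt_of_le_of_lt degree_map_le ?_
      rw [hh, degree_prod, Finset.sum_congr rfl (fun k _ => degree_X_sub_C (z k))]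
      simp only [Finset.sum_const]
      rw [Finset.card_erase_of_mem (by simp [hij.symm]), Finset.card_erase_of_mem (by simp)]
      simp
      exact WithBot.coe_lt_coe.2 (Nat.lt_succ_self n)
    have H := Hs (h.map kap) hd
    set a : ℂ[X][X] := C X with ha
    set zi := kap (z i) with hzi
    set zj := kap (z j) with hzj
    set w0 : ℂ[X][X] := zi * zj + 2 * (a * X - zi * zj) + (zi + zj - a - X) ^ 2 with hw0
    have hid : C (zi - zj) * ((X - C a) ^ 2 * (X - C X) ^ 2 * h.map kap) =
        C (((zi - a) * (zi - X)) ^ 2) * (P i).map kap - C (((zj - a) * (zj - X)) ^ 2) * (P j).map kap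
        + C (zi - zj) * (C w0 * p.map kap + C (2 * (zi + zj - a - X) - (zi + zj)) * (p.map kap * X)
          + p.map kap * X ^ 2) := by
      rw [hPi, hPj, hpe, hw0]
      simp only [Polynomial.map_mul, Polynomial.map_sub, map_X, map_C, ← hzi, ← hzj]
      simp only [C_mul, C_sub, C_add, C_pow, map_ofNat]
      ring
    have := congrArg (Thet n θ) hid
    rw [Thet_C_mul, H, Thet_add, Thet_sub, Thet_C_mul, Thet_C_mul, Thet_C_mul, Thet_add, Thet_add,
      Thet_C_mul, Thet_C_mul, HpX, HpX2] at this
    rw [hw0] at this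
    linear_combination -this)
  obtain ⟨hT, hS⟩ := core
  apply thp_eq_zero
  intro k
  have hgen : ∀ v : ℂ[X], v.degree < (n + 5 : ℕ) → Thet n θ (v.map kap) = 0 := by
    intro v hv
    have hpm : p.Monic := monic_prod_of_monic _ _ fun i _ => monic_X_sub_C _
    have hpd : p.natDegree = n + 2 := by
      rw [hp, natDegree_prod_of_monic _ _ fun i _ => monic_X_sub_C _]; simp
    have hpdd : p.degree = (n + 2 : ℕ) := by rw [degree_eq_natDegree hpm.ne_zero, hpd]
    have hrd : (v %ₘ p).degree < (Finset.univ : Finset (Fin (n + 2))).card := by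
      have := degree_modByMonic_lt v hpm
      rw [hpdd] at this; simpa using this
    have hr : Thet n θ ((v %ₘ p).map kap) = 0 := by
      rw [Lagrange.eq_interpolate (s := Finset.univ) (v := z) hz.injOn hrd,
        Lagrange.interpolate_apply, Polynomial.map_sum, Thet_sum]
      apply Finset.sum_eq_zero
      intro i _
      have hb : ∃ c : ℂ, Lagrange.basis Finset.univ z i = C c * P i := by
        unfold Lagrange.basis Lagrange.basisDivisor
        rw [Finset.prod_mul_distrib, ← map_prod]
        exact ⟨_, rfl⟩
      obtain ⟨c, hc⟩ := hb
      rw [hc, Polynomial.map_mul, Polynomial.map_mul, map_C, map_C, Thet_C_mul, Thet_C_mul, hS i]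
      simp
    have hq : (v /ₘ p).degree < (3 : ℕ) := by
      by_cases hv0 : v /ₘ p = 0
      · rw [hv0, degree_zero]; exact WithBot.bot_lt_coe _
      rw [← natDegree_lt_iff_degree_lt hv0, natDegree_divByMonic v hpm, hpd]
      have hvv : v ≠ 0 := by rintro rfl; simp at hv0
      have := (natDegree_lt_iff_degree_lt hvv).2 hv
      omega
    obtain ⟨w0, w1, w2, hw⟩ : ∃ w0 w1 w2 : ℂ, v /ₘ p = C w0 + C w1 * X + C w2 * X ^ 2 := by
      have := cpoly_of (v /ₘ p) hq
      rw [cpoly, Fin.sum_univ_three] at this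
      refine ⟨(v /ₘ p).coeff 0, (v /ₘ p).coeff 1, (v /ₘ p).coeff 2, ?_⟩
      simpa using this.symm
    have e : v.map kap = (v %ₘ p).map kap + (C (kap w0) * p.map kap + C (kap w1) * (p.map kap * X) +
        C (kap w2) * (p.map kap * X ^ 2)) := by
      conv_lhs => rw [← modByMonic_add_div v p, hw]
      simp
      ring
    rw [e, Thet_add, Thet_add, Thet_add, hr, Thet_C_mul, Thet_C_mul, Thet_C_mul, HpX, HpX2, hT]
    simp
  have := hgen (X ^ (k : ℕ)) (by rw [degree_X_pow]; exact Nat.cast_lt.2 k.2)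
  rw [Thet, Finset.sum_eq_single k] at this
  · simpa using this
  · intro b _ hb
    have : (b : ℕ) ≠ k := fun h => hb (Fin.ext h)
    simp [coeff_X_pow, this]
  · simp

theorem BDet_shear {R : Type*} [CommRing R] (n : ℕ) (f g : Fin (n + 5) → R) (t : R) :
    BDet n f (fun k => g k + t * f k) = BDet n f g := by
  classical
  let U : Matrix (BRow n) (BRow n) R :=
    Matrix.fromBlocks 1 0 0 (Matrix.fromBlocks 1 0 (t • 1) 1)
  have hU : U.det = 1 := by
    simp [U]
  have hM : BMat n f (fun k => g k + t * f k) = U * BMat n f g := by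
    ext r c
    rw [Matrix.mul_apply, Fintype.sum_sum_type, Fintype.sum_sum_type]
    rcases r with r | r | r
    · simp [U, BMat, Matrix.one_apply, -mul_ite]
    · simp [U, BMat, Matrix.one_apply]
    · simp [U, BMat, Matrix.one_apply]
      by_cases h : r = c.2 <;> simp [h, add_comm]
  have hS : BSq n f (fun k => g k + t * f k) =
      U.submatrix (bequiv n).symm (bequiv n).symm * BSq n f g := by
    unfold BSq
    rw [hM, Matrix.submatrix_mul_equiv]
  unfold BDet
  rw [hS, Matrix.det_mul, Matrix.det_submatrix_equiv_self, hU, one_mul]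

theorem cpoly_map {R S : Type*} [CommRing R] [CommRing S] (φ : R →+* S) {N : ℕ} (f : Fin N → R) :
    (cpoly f).map φ = cpoly (fun k => φ (f k)) := by
  simp [cpoly, Polynomial.map_sum]

/-- The Wronskian. -/
def Jp {R : Type*} [CommRing R] (n : ℕ) (f g : Fin (n + 5) → R) : R[X] :=
  derivative (cpoly f) * cpoly g - cpoly f * derivative (cpoly g)

theorem Jp_map {R S : Type*} [CommRing R] [CommRing S] (φ : R →+* S) (n : ℕ)
    (f g : Fin (n + 5) → R) :
    (Jp n f g).map φ = Jp n (fun k => φ (f k)) (fun k => φ (g k)) := by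
  simp [Jp, cpoly_map, ← derivative_map]

theorem cpoly_natDegree {R : Type*} [CommRing R] {N : ℕ} (f : Fin (N + 1) → R) :
    (cpoly f).natDegree ≤ N := by
  have := cpoly_degree f
  rw [← Order.lt_add_one_iff]
  by_cases h : cpoly f = 0
  · simp [h]
  · exact (natDegree_lt_iff_degree_lt h).2 this

theorem euler_natDegree {R : Type*} [CommRing R] (N : ℕ) (p : R[X]) (hp : p.natDegree ≤ N + 1) :
    (X * derivative p - C ((N + 1 : ℕ) : R) * p).natDegree ≤ N := by
  rw [natDegree_le_iff_coeff_eq_zero]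
  intro k hk
  obtain ⟨k, rfl⟩ : ∃ l, k = l + 1 := ⟨k - 1, by omega⟩
  rw [coeff_sub, coeff_X_mul, coeff_derivative, coeff_C_mul]
  by_cases h : k = N
  · subst h; push_cast; ring
  · rw [coeff_eq_zero_of_natDegree_lt (n := k + 1) (by omega)]; simp

theorem Jp_natDegree {R : Type*} [CommRing R] (n : ℕ) (f g : Fin (n + 5) → R) :
    (Jp n f g).natDegree ≤ 2 * n + 6 := by
  have hf := cpoly_natDegree (N := n + 4) f
  have hg := cpoly_natDegree (N := n + 4) g
  have h1 := euler_natDegree (n + 3) _ hf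
  have h2 := euler_natDegree (n + 3) _ hg
  have h3 : X * Jp n f g =
      (X * derivative (cpoly f) - C ((n + 3 + 1 : ℕ) : R) * cpoly f) * cpoly g -
      cpoly f * (X * derivative (cpoly g) - C ((n + 3 + 1 : ℕ) : R) * cpoly g) := by
    unfold Jp; ring
  have h4 : (X * Jp n f g).natDegree ≤ 2 * n + 7 := by
    rw [h3]
    refine (natDegree_sub_le _ _).trans (max_le ?_ ?_)
    · exact natDegree_mul_le.trans (by omega)
    · exact natDegree_mul_le.trans (by omega)
  rw [natDegree_le_iff_coeff_eq_zero] at h4 ⊢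
  intro k hk
  have := h4 (k + 1) (by omega)
  rwa [coeff_X_mul] at this

/-- The bad locus. -/
def Yd {R : Type*} [CommRing R] (n : ℕ) (f g : Fin (n + 5) → R) : R :=
  (Jp n f g).coeff (2 * n + 6) *
    resultant (Jp n f g) (derivative (Jp n f g)) (2 * n + 6) (2 * n + 5) *
    resultant (Jp n f g) (cpoly g) (2 * n + 6) (n + 4)

theorem Yd_map {R S : Type*} [CommRing R] [CommRing S] (φ : R →+* S) (n : ℕ)
    (f g : Fin (n + 5) → R) :
    φ (Yd n f g) = Yd n (fun k => φ (f k)) (fun k => φ (g k)) := by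
  unfold Yd
  rw [map_mul, map_mul, ← resultant_map_map, ← resultant_map_map, ← derivative_map, Jp_map,
    cpoly_map, ← coeff_map, Jp_map]

/-- branch polynomial -/
def Bp {R : Type*} [CommRing R] (n : ℕ) (f g : Fin (n + 5) → R) : R[X] :=
  resultant ((Jp n f g).map C) ((cpoly f).map C + C X * (cpoly g).map C) (2 * n + 6) (n + 4)

theorem Bp_map {R S : Type*} [CommRing R] [CommRing S] (φ : R →+* S) (n : ℕ)
    (f g : Fin (n + 5) → R) :
    (Bp n f g).map φ = Bp n (fun k => φ (f k)) (fun k => φ (g k)) := by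
  have h : (mapRingHom φ).comp (C : R →+* R[X]) = (C : S →+* S[X]).comp φ := by
    ext; simp
  rw [← coe_mapRingHom, Bp, ← resultant_map_map]
  rw [Polynomial.map_add, Polynomial.map_mul, Polynomial.map_map, Polynomial.map_map,
    Polynomial.map_map, h, map_C]
  rw [← Polynomial.map_map, ← Polynomial.map_map, ← Polynomial.map_map, Jp_map, cpoly_map φ f,
    cpoly_map φ g, coe_mapRingHom, map_X]
  rw [Bp]

/-- discriminant of the branch polynomial -/
def Xd {R : Type*} [CommRing R] (n : ℕ) (f g : Fin (n + 5) → R) : R :=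
  resultant (Bp n f g) (derivative (Bp n f g)) (2 * n + 6) (2 * n + 5)

theorem Xd_map {R S : Type*} [CommRing R] [CommRing S] (φ : R →+* S) (n : ℕ)
    (f g : Fin (n + 5) → R) :
    φ (Xd n f g) = Xd n (fun k => φ (f k)) (fun k => φ (g k)) := by
  unfold Xd
  rw [← resultant_map_map, ← derivative_map, Bp_map]

theorem res_zero_iff (p q : ℂ[X]) (m k : ℕ) (hp : p.natDegree ≤ m) (hpm : p.coeff m ≠ 0)
    (hq : q.natDegree ≤ k) :
    resultant p q m k = 0 ↔ ∃ r, p.eval r = 0 ∧ q.eval r = 0 := by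
  have hm : m = p.natDegree := le_antisymm (le_natDegree_of_ne_zero hpm) hp
  subst hm
  have hp0 : p ≠ 0 := by rintro rfl; simp at hpm
  rw [resultant_eq_prod_eval _ _ _ hq (IsAlgClosed.splits p), mul_eq_zero,
    Multiset.prod_eq_zero_iff]
  have : p.leadingCoeff ^ k ≠ 0 := pow_ne_zero _ hpm
  simp only [this, false_or, Multiset.mem_map, mem_roots hp0, IsRoot]

theorem Yd_ne_zero_iff (n : ℕ) (f g : Fin (n + 5) → ℂ) :
    Yd n f g ≠ 0 ↔ (Jp n f g).coeff (2 * n + 6) ≠ 0 ∧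
      (∀ r, (Jp n f g).eval r = 0 → (derivative (Jp n f g)).eval r ≠ 0) ∧
      (∀ r, (Jp n f g).eval r = 0 → (cpoly g).eval r ≠ 0) := by
  unfold Yd
  rw [mul_ne_zero_iff, mul_ne_zero_iff, and_assoc]
  refine and_congr_right fun h => ?_
  rw [Ne, res_zero_iff _ _ _ _ (Jp_natDegree n f g) h, Ne,
    res_zero_iff _ _ _ _ (Jp_natDegree n f g) h (cpoly_natDegree (N := n + 4) g)]
  · push Not
    rfl
  · exact (natDegree_derivative_le _).trans (by have := Jp_natDegree n f g; omega)

theorem Bp_eq (n : ℕ) (f g : Fin (n + 5) → ℂ) (hY : Yd n f g ≠ 0) :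
    Bp n f g = C ((Jp n f g).leadingCoeff ^ (n + 4)) *
      ∏ r ∈ (Jp n f g).roots.toFinset, (C ((cpoly f).eval r) + X * C ((cpoly g).eval r)) := by
  obtain ⟨h1, h2, h3⟩ := (Yd_ne_zero_iff n f g).1 hY
  have hm : (Jp n f g).natDegree = 2 * n + 6 :=
    le_antisymm (Jp_natDegree n f g) (le_natDegree_of_ne_zero h1)
  have hJ0 : Jp n f g ≠ 0 := by intro h; simp [h] at h1
  have hnd : (Jp n f g).roots.Nodup := by
    rw [Multiset.nodup_iff_count_le_one]
    intro r
    rw [count_roots]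
    by_contra hr
    push Not at hr
    have := (one_lt_rootMultiplicity_iff_isRoot hJ0).1 hr
    exact h2 r this.1 this.2
  apply Polynomial.funext
  intro c
  have e1 : (Bp n f g).eval c = resultant (Jp n f g) (cpoly f + C c * cpoly g)
      (Jp n f g).natDegree (n + 4) := by
    rw [hm, ← coe_evalRingHom, Bp, ← resultant_map_map]
    have : (evalRingHom c).comp (C : ℂ →+* ℂ[X]) = RingHom.id ℂ := by ext; simp
    rw [Polynomial.map_add, Polynomial.map_mul, Polynomial.map_map, Polynomial.map_map,
      Polynomial.map_map, map_C, this, Polynomial.map_id, Polynomial.map_id, Polynomial.map_id,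
      coe_evalRingHom, eval_X]
  rw [e1, resultant_eq_prod_eval _ _ _ _ (IsAlgClosed.splits _)]
  · rw [Finset.prod, Multiset.toFinset_val, hnd.dedup]
    simp only [eval_mul, eval_C, eval_multiset_prod, Multiset.map_map, Function.comp_def, eval_add,
      eval_X]
  · refine (natDegree_add_le _ _).trans (max_le (cpoly_natDegree (N := n + 4) f) ?_)
    exact (natDegree_C_mul_le _ _).trans (cpoly_natDegree (N := n + 4) g)

theorem Bp_lin_natDegree (a b : ℂ) (hb : b ≠ 0) : (C a + X * C b : ℂ[X]).natDegree = 1 := by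
  rw [add_comm, mul_comm, natDegree_linear hb]

theorem Xd_zero_iff (n : ℕ) (f g : Fin (n + 5) → ℂ) (hY : Yd n f g ≠ 0) :
    Xd n f g = 0 ↔ ∃ c, (Bp n f g).eval c = 0 ∧ (derivative (Bp n f g)).eval c = 0 := by
  have hB := Bp_eq n f g hY
  obtain ⟨h1, h2, h3⟩ := (Yd_ne_zero_iff n f g).1 hY
  have hm : (Jp n f g).natDegree = 2 * n + 6 :=
    le_antisymm (Jp_natDegree n f g) (le_natDegree_of_ne_zero h1)
  have hJ0 : Jp n f g ≠ 0 := by intro h; simp [h] at h1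
  have hnd : (Jp n f g).roots.Nodup := by
    rw [Multiset.nodup_iff_count_le_one]
    intro r
    rw [count_roots]
    by_contra hr
    push Not at hr
    have := (one_lt_rootMultiplicity_iff_isRoot hJ0).1 hr
    exact h2 r this.1 this.2
  have hcard : (Jp n f g).roots.toFinset.card = 2 * n + 6 := by
    rw [Multiset.toFinset_card_of_nodup hnd, ← hm]
    exact (splits_iff_card_roots.1 (IsAlgClosed.splits _))
  have hne : ∀ r ∈ (Jp n f g).roots.toFinset, (cpoly g).eval r ≠ 0 := by
    intro r hr
    rw [Multiset.mem_toFinset, mem_roots hJ0] at hr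
    exact h3 r hr
  have hdeg : (Bp n f g).natDegree = 2 * n + 6 := by
    rw [hB, natDegree_C_mul (pow_ne_zero _ (leadingCoeff_ne_zero.2 hJ0)), natDegree_prod]
    · rw [Finset.sum_congr rfl (fun r hr => Bp_lin_natDegree _ _ (hne r hr))]
      simp [hcard]
    · intro r hr h0
      have := Bp_lin_natDegree ((cpoly f).eval r) _ (hne r hr)
      rw [h0] at this
      simp at this
  have hB0 : Bp n f g ≠ 0 := by intro h; rw [h] at hdeg; simp at hdeg
  unfold Xd
  refine res_zero_iff _ _ _ _ hdeg.le ?_ ?_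
  · rw [← hdeg, coeff_natDegree]
    exact leadingCoeff_ne_zero.2 hB0
  · exact (natDegree_derivative_le _).trans (by omega)

theorem mul_of_sq_dvd {a b : ℂ} (hab : a ≠ b) (T : ℂ[X]) (n : ℕ) (hT : T.natDegree ≤ n + 4)
    (ha : (X - C a) ^ 2 ∣ T) (hb : (X - C b) ^ 2 ∣ T) :
    ∃ h : ℂ[X], h.degree < (n + 1 : ℕ) ∧ T = (X - C a) ^ 2 * (X - C b) ^ 2 * h := by
  have hc : IsCoprime ((X - C a) ^ 2) ((X - C b) ^ 2) :=
    (isCoprime_X_sub_C_of_isUnit_sub (sub_ne_zero.2 hab).isUnit).pow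
  obtain ⟨h, rfl⟩ := hc.mul_dvd ha hb
  refine ⟨h, ?_, rfl⟩
  by_cases h0 : h = 0
  · rw [h0, degree_zero]; exact WithBot.bot_lt_coe _
  · rw [← natDegree_lt_iff_degree_lt h0]
    have hm : ((X - C a) ^ 2 * (X - C b) ^ 2 : ℂ[X]).Monic :=
      ((monic_X_sub_C a).pow 2).mul ((monic_X_sub_C b).pow 2)
    rw [hm.natDegree_mul' h0, ((monic_X_sub_C a).pow 2).natDegree_mul ((monic_X_sub_C b).pow 2),
      natDegree_pow, natDegree_pow, natDegree_X_sub_C, natDegree_X_sub_C] at hT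
    omega

theorem solF_of_Xd (n : ℕ) (f g : Fin (n + 5) → ℂ) (hY : Yd n f g ≠ 0) (hX : Xd n f g = 0) :
    BSolF n f g := by
  have hB := Bp_eq n f g hY
  obtain ⟨h1, h2, h3⟩ := (Yd_ne_zero_iff n f g).1 hY
  have hJ0 : Jp n f g ≠ 0 := by intro h; simp [h] at h1
  obtain ⟨c, hc, hc'⟩ := (Xd_zero_iff n f g hY).1 hX
  have hl : (Jp n f g).leadingCoeff ^ (n + 4) ≠ 0 := pow_ne_zero _ (leadingCoeff_ne_zero.2 hJ0)
  rw [hB, eval_mul, eval_C, mul_eq_zero, or_iff_right hl, eval_prod, Finset.prod_eq_zero_iff] at hc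
  obtain ⟨a, ha, hca⟩ := hc
  rw [hB, derivative_C_mul, eval_mul, eval_C, mul_eq_zero, or_iff_right hl,
    ← Finset.mul_prod_erase _ _ ha, derivative_mul, eval_add, eval_mul, eval_mul, hca, zero_mul,
    add_zero] at hc'
  rw [Multiset.mem_toFinset, mem_roots hJ0] at ha
  have hga := h3 a ha
  simp only [derivative_add, derivative_mul, derivative_C, derivative_X, zero_add, one_mul,
    mul_zero, add_zero, eval_C, mul_eq_zero, hga, false_or, eval_prod,
    Finset.prod_eq_zero_iff] at hc'
  obtain ⟨b, hb, hcb⟩ := hc'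
  rw [Finset.mem_erase, Multiset.mem_toFinset, mem_roots hJ0] at hb
  have key : ∀ r, (Jp n f g).IsRoot r → (C ((cpoly f).eval r) + X * C ((cpoly g).eval r)).eval c = 0
      → (X - C r) ^ 2 ∣ C 1 * cpoly f + C c * cpoly g := by
    intro r hr hr'
    have hgr := h3 r hr
    simp only [eval_add, eval_mul, eval_C, eval_X] at hr'
    apply sq_dvd_of_eval
    · simp only [eval_add, eval_mul, eval_C]; linear_combination hr'
    · apply mul_left_cancel₀ hgr
      have hr2 : (Jp n f g).eval r = 0 := hr
      simp only [Jp, eval_sub, eval_mul] at hr2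
      simp only [derivative_add, derivative_mul, derivative_C, zero_mul, zero_add, eval_add,
        eval_mul, eval_C]
      linear_combination hr2 + hr' * (derivative (cpoly g)).eval r
  obtain ⟨h, hh, hT⟩ := mul_of_sq_dvd hb.1.symm (C 1 * cpoly f + C c * cpoly g) n (by
    refine (natDegree_add_le _ _).trans (max_le ?_ ?_)
    · exact (natDegree_C_mul_le _ _).trans (cpoly_natDegree (N := n + 4) f)
    · exact (natDegree_C_mul_le _ _).trans (cpoly_natDegree (N := n + 4) g))
    (key a ha hca) (key b hb.2 hcb)
  exact ⟨1, c, a, b, h, Or.inl one_ne_zero, hb.1.symm, hh, hT⟩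

theorem Xd_of_solF (n : ℕ) (f g : Fin (n + 5) → ℂ) (hY : Yd n f g ≠ 0) (hs : BSolF n f g) :
    Xd n f g = 0 := by
  have hB := Bp_eq n f g hY
  obtain ⟨h1, h2, h3⟩ := (Yd_ne_zero_iff n f g).1 hY
  have hJ0 : Jp n f g ≠ 0 := by intro h; simp [h] at h1
  obtain ⟨c0, c1, a, b, h, hc, hab, -, hT⟩ := hs
  have key : ∀ r, (X - C r) ^ 2 ∣ C c0 * cpoly f + C c1 * cpoly g →
      c0 * (cpoly f).eval r + c1 * (cpoly g).eval r = 0 ∧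
      c0 * (derivative (cpoly f)).eval r + c1 * (derivative (cpoly g)).eval r = 0 ∧
      (Jp n f g).eval r = 0 := by
    rintro r ⟨k, hk⟩
    have e1 := congrArg (eval r) hk
    have e2 := congrArg (fun p => eval r (derivative p)) hk
    simp [pow_two, derivative_mul] at e1 e2
    refine ⟨e1, e2, ?_⟩
    simp only [Jp, eval_sub, eval_mul]
    rcases hc with hc | hc <;> apply mul_left_cancel₀ hc
    · linear_combination (cpoly g).eval r * e2 - (derivative (cpoly g)).eval r * e1
    · linear_combination -(cpoly f).eval r * e2 + (derivative (cpoly f)).eval r * e1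
  obtain ⟨a1, a2, a3⟩ := key a ⟨(X - C b) ^ 2 * h, by rw [hT]; ring⟩
  obtain ⟨b1, b2, b3⟩ := key b ⟨(X - C a) ^ 2 * h, by rw [hT]; ring⟩
  have hc0 : c0 ≠ 0 := by
    rintro rfl
    simp only [ne_eq, not_true_eq_false, false_or] at hc
    simp only [zero_mul, zero_add, mul_eq_zero, hc, false_or] at a1
    exact h3 a a3 a1
  rw [Xd_zero_iff n f g hY]
  have ha : a ∈ (Jp n f g).roots.toFinset := by
    rw [Multiset.mem_toFinset, mem_roots hJ0]; exact a3
  have hb : b ∈ (Jp n f g).roots.toFinset.erase a := by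
    rw [Finset.mem_erase, Multiset.mem_toFinset, mem_roots hJ0]; exact ⟨hab.symm, b3⟩
  rw [← Finset.mul_prod_erase _ _ ha, ← Finset.mul_prod_erase _ _ hb] at hB
  have a4 : (cpoly f).eval a + (cpoly g).eval a * (c1 / c0) = 0 := by
    field_simp; linear_combination a1
  have b4 : (cpoly f).eval b + (cpoly g).eval b * (c1 / c0) = 0 := by
    field_simp; linear_combination b1
  refine ⟨c1 / c0, ?_, ?_⟩
  · rw [hB]; simp [a4]
  · rw [hB]; simp [a4, b4, derivative_mul]

/-- `E` for the special example -/
def exE (n : ℕ) (s : ℂ) : ℂ[X] :=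
  C (4 : ℂ) * X * (X ^ n + C s) + (X ^ 2 - C 1) * derivative (X ^ n : ℂ[X])

def exf (n : ℕ) (s : ℂ) : ℂ[X] := (X ^ 2 - C 1) ^ 2 * (X ^ n + C s)

theorem exf_deriv (n : ℕ) (s : ℂ) : derivative (exf n s) = (X ^ 2 - C 1) * exE n s := by
  simp only [exf, exE, derivative_mul, derivative_pow, derivative_sub, derivative_add, derivative_C,
    derivative_X]
  simp only [map_natCast, Nat.cast_ofNat, map_ofNat]
  ring

theorem exE_eval (n : ℕ) (s r : ℂ) : (exE n s).eval r =
    (n + 4) * (r * r ^ n) + 4 * s * r - n * r ^ (n - 1) := by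
  simp [exE]
  rcases n with _ | n
  · simp; ring
  · simp; ring

theorem exE_deriv_eval (n : ℕ) (s r : ℂ) : (derivative (exE n s)).eval r =
    (n + 4) * (n + 1) * r ^ n + 4 * s - n * ((n - 1 : ℕ) : ℂ) * r ^ (n - 1 - 1) := by
  simp [exE, derivative_mul]
  rcases n with _ | _ | n
  · simp; ring
  · simp; ring
  · simp; ring

theorem exE_simple (n : ℕ) (r : ℂ) (h1 : (exE n ((n + 4) ^ 2)).eval r = 0) :
    (derivative (exE n ((n + 4) ^ 2))).eval r ≠ 0 := by
  intro h2
  rw [exE_eval] at h1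
  rw [exE_deriv_eval] at h2
  have key : ‖r‖ ≤ 1 ∨ n = 0 := by
    rcases n with _ | n
    · right; rfl
    left
    by_contra hr
    push Not at hr
    have hr0 : r ≠ 0 := by rintro rfl; simp at hr; linarith
    have h3 : ((n : ℂ) + 5) * r ^ 2 = (n - 1) := by
      have hn : ((n : ℂ) + 1) ≠ 0 := by exact_mod_cast Nat.succ_ne_zero n
      apply mul_left_cancel₀ (mul_ne_zero hn (pow_ne_zero n hr0))
      rcases n with _ | n
      · simp at h1 h2 ⊢
        linear_combination r * h2 - h1
      · simp only [Nat.cast_add, Nat.cast_one, Nat.add_sub_cancel] at h1 h2 ⊢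
        linear_combination r * h2 - h1
    have h4 := congrArg norm h3
    rw [norm_mul, norm_pow] at h4
    have h5 : ‖(n : ℂ) + 5‖ = n + 5 := by
      have : ((n : ℂ) + 5) = ((n + 5 : ℕ) : ℂ) := by push_cast; rfl
      rw [this, Complex.norm_natCast]; push_cast; rfl
    have h6 : ‖(n : ℂ) - 1‖ ≤ n + 1 := by
      refine (norm_sub_le _ _).trans ?_
      rw [Complex.norm_natCast]; simp
    rw [h5] at h4
    have : (0 : ℝ) ≤ n := Nat.cast_nonneg n
    have h7 : 1 < ‖r‖ ^ 2 := one_lt_pow₀ hr two_ne_zero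
    nlinarith [mul_lt_mul_of_pos_left h7 (by linarith : (0 : ℝ) < n + 5)]
  have hR : ‖r‖ ≤ 1 → False := by
    intro hr
    have h3 : (4 : ℂ) * (n + 4) ^ 2 =
        n * ((n - 1 : ℕ) : ℂ) * r ^ (n - 1 - 1) - (n + 4) * (n + 1) * r ^ n := by
      linear_combination h2
    have h4 := congrArg norm h3
    have h5 : ‖(4 : ℂ) * (n + 4) ^ 2‖ = 4 * (n + 4) ^ 2 := by
      have : (4 : ℂ) * (n + 4) ^ 2 = ((4 * (n + 4) ^ 2 : ℕ) : ℂ) := by push_cast; rfl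
      rw [this, Complex.norm_natCast]; push_cast; rfl
    have h6 : ‖(n : ℂ) * ((n - 1 : ℕ) : ℂ) * r ^ (n - 1 - 1)‖ ≤ n * n := by
      rw [norm_mul, norm_mul, Complex.norm_natCast, Complex.norm_natCast, norm_pow]
      have a1 : ‖r‖ ^ (n - 1 - 1) ≤ 1 := pow_le_one₀ (norm_nonneg _) hr
      have a2 : ((n - 1 : ℕ) : ℝ) ≤ n := by exact_mod_cast Nat.sub_le n 1
      calc (n : ℝ) * ((n - 1 : ℕ) : ℝ) * ‖r‖ ^ (n - 1 - 1) ≤ n * n * 1 := by gcongr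
        _ = _ := by ring
    have h7 : ‖((n : ℂ) + 4) * (n + 1) * r ^ n‖ ≤ (n + 4) * (n + 1) := by
      have : ((n : ℂ) + 4) * (n + 1) = (((n + 4) * (n + 1) : ℕ) : ℂ) := by push_cast; rfl
      rw [norm_mul, this, Complex.norm_natCast, norm_pow]
      have a1 : ‖r‖ ^ n ≤ 1 := pow_le_one₀ (norm_nonneg _) hr
      push_cast
      calc ((n : ℝ) + 4) * (n + 1) * ‖r‖ ^ n ≤ (n + 4) * (n + 1) * 1 := by gcongr
        _ = _ := by ring
    have h8 := norm_sub_le ((n : ℂ) * ((n - 1 : ℕ) : ℂ) * r ^ (n - 1 - 1))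
      (((n : ℂ) + 4) * (n + 1) * r ^ n)
    rw [← h4, h5] at h8
    have : (0 : ℝ) ≤ n := Nat.cast_nonneg n
    nlinarith
  rcases key with hr | hn
  · exact hR hr
  · subst hn
    simp at h2
    norm_num at h2

theorem exf_deriv_simple (n : ℕ) (r : ℂ) (h1 : (derivative (exf n ((n + 4) ^ 2))).eval r = 0) :
    (derivative (derivative (exf n ((n + 4) ^ 2)))).eval r ≠ 0 := by
  rw [exf_deriv] at h1 ⊢
  have hs : ∀ e : ℂ, ‖e‖ = 1 → e + (n + 4) ^ 2 ≠ 0 := by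
    intro e he h
    have : e = - ((n + 4) ^ 2 : ℂ) := by linear_combination h
    rw [this, norm_neg] at he
    have h3 : ((n + 4) ^ 2 : ℂ) = (((n + 4) ^ 2 : ℕ) : ℂ) := by push_cast; rfl
    rw [h3, Complex.norm_natCast] at he
    have : (n + 4) ^ 2 = 1 := by exact_mod_cast he
    have h5 := Nat.pow_le_pow_left (show 4 ≤ n + 4 by omega) 2
    omega
  simp only [derivative_mul, derivative_sub, derivative_pow, derivative_C, derivative_X]
  simp only [eval_mul, eval_add, eval_sub, eval_pow, eval_X, eval_C, mul_eq_zero, eval_zero,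
    eval_one] at h1 ⊢
  by_cases hr : r ^ 2 - 1 = 0
  · rw [hr]
    have hr1 : ‖r‖ = 1 := by
      have : r ^ 2 = 1 := by linear_combination hr
      have h2 := congrArg norm this
      rw [norm_pow, norm_one] at h2
      exact (pow_eq_one_iff_of_nonneg (norm_nonneg _) two_ne_zero).1 h2
    have hr0 : r ≠ 0 := by rintro rfl; simp at hr1
    have h3 : (exE n ((n + 4) ^ 2)).eval r = 4 * r * (r ^ n + (n + 4) ^ 2) := by
      simp [exE, hr]
    rw [h3]
    have := hs (r ^ n) (by rw [norm_pow, hr1, one_pow])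
    simp [hr0, this]
  · have h2 := h1.resolve_left hr
    rw [h2]
    have := exE_simple n r h2
    simp [this, hr]

theorem exf_monic (n : ℕ) (s : ℂ) (hs : n = 0 → s ≠ -1) : (exf n s).natDegree = n + 4 ∧
    (exf n s).leadingCoeff ≠ 0 := by
  have h2 : (X ^ n + C s : ℂ[X]) ≠ 0 ∧ (X ^ n + C s : ℂ[X]).natDegree = n := by
    rcases n with _ | n
    · have : (X ^ 0 + C s : ℂ[X]) = C (1 + s) := by simp
      rw [this]
      refine ⟨?_, by simp⟩
      rw [Ne, C_eq_zero]
      intro h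
      exact hs rfl (by linear_combination h)
    · exact ⟨(monic_X_pow_add_C s (Nat.succ_ne_zero n)).ne_zero, natDegree_X_pow_add_C⟩
  have h1 : ((X ^ 2 - C 1) ^ 2 : ℂ[X]).Monic := (monic_X_pow_sub_C 1 two_ne_zero).pow 2
  have h3 : (exf n s).natDegree = n + 4 := by
    unfold exf
    rw [h1.natDegree_mul' h2.1, h2.2, (monic_X_pow_sub_C 1 two_ne_zero).natDegree_pow,
      natDegree_X_pow_sub_C]
    ring
  refine ⟨h3, ?_⟩
  rw [Ne, leadingCoeff_eq_zero]
  intro h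
  rw [h] at h3; simp at h3

/-- pencil trick: a pencil of polynomials has few members with double roots. -/
theorem finite_double (J0 E : ℂ[X]) (hW : derivative J0 * E - J0 * derivative E ≠ 0)
    (hE : ∀ r, E.eval r = 0 → (derivative E).eval r ≠ 0) :
    {t : ℂ | ∃ r, (J0 + C t * E).eval r = 0 ∧ (derivative (J0 + C t * E)).eval r = 0}.Finite := by
  set W := derivative J0 * E - J0 * derivative E with hWd
  have hfin : (↑W.roots.toFinset : Set ℂ).Finite := Finset.finite_toSet _
  refine ((hfin.image (fun r => -(J0.eval r) / E.eval r)).union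
    (hfin.image (fun r => -((derivative J0).eval r) / (derivative E).eval r))).subset ?_
  rintro t ⟨r, h1, h2⟩
  simp only [derivative_add, derivative_mul, derivative_C, zero_mul, zero_add, eval_add, eval_mul,
    eval_C] at h1 h2
  have hr : r ∈ (↑W.roots.toFinset : Set ℂ) := by
    rw [Finset.mem_coe, Multiset.mem_toFinset, mem_roots hW, IsRoot, hWd]
    simp only [eval_sub, eval_mul]
    linear_combination E.eval r * h2 - (derivative E).eval r * h1
  by_cases he : E.eval r = 0
  · right
    refine ⟨r, hr, ?_⟩
    have := hE r he
    simp only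
    field_simp
    linear_combination -h2
  · left
    refine ⟨r, hr, ?_⟩
    simp only
    field_simp
    linear_combination -h1

theorem Jp_congr (n : ℕ) (f g : Fin (n + 5) → ℂ) (F G : ℂ[X]) (hf : cpoly f = F)
    (hg : cpoly g = G) : Jp n f g = derivative F * G - F * derivative G := by
  rw [Jp, hf, hg]

/-- coefficient vector -/
def cvec {R : Type*} [CommRing R] (N : ℕ) (p : R[X]) : Fin N → R := fun k => p.coeff k

theorem cpoly_cvec {R : Type*} [CommRing R] (N : ℕ) (p : R[X]) (hp : p.natDegree ≤ N) :
    cpoly (cvec (N + 1) p) = p := by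
  apply cpoly_of
  by_cases h : p = 0
  · rw [h, degree_zero]; exact WithBot.bot_lt_coe _
  · exact (natDegree_lt_iff_degree_lt h).1 (by omega)

theorem exists_good (n : ℕ) : ∃ h g : ℂ[X], h.natDegree ≤ n ∧ g.natDegree ≤ n + 4 ∧
    Yd n (cvec (n + 5) ((X ^ 2 - C 1) ^ 2 * h)) (cvec (n + 5) g) ≠ 0 := by
  set s : ℂ := (n + 4) ^ 2 with hs
  set f := exf n s with hf
  have hf1 : f.natDegree = n + 4 ∧ f.leadingCoeff ≠ 0 := by
    apply exf_monic
    rintro rfl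
    rw [hs]; norm_num
  have hfs : ∀ r, (derivative f).eval r = 0 → (derivative (derivative f)).eval r ≠ 0 :=
    exf_deriv_simple n
  set l := f.coeff (n + 4) with hl
  have hl0 : l ≠ 0 := by rw [hl, ← hf1.1]; exact hf1.2
  set J0 := derivative f * X ^ (n + 3) - f * derivative (X ^ (n + 3)) with hJ0
  have hf0 : f ≠ 0 := leadingCoeff_ne_zero.1 hf1.2
  have hdf : (derivative f).natDegree ≤ n + 3 := (natDegree_derivative_le _).trans (by omega)
  have hdfc : (derivative f).coeff (n + 3) = (n + 4) * l := by
    rw [coeff_derivative]; push_cast; ring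
  have hd2f : (derivative (derivative f)).natDegree ≤ n + 2 :=
    (natDegree_derivative_le _).trans (by omega)
  have hd2fc : (derivative (derivative f)).coeff (n + 2) = (n + 3) * ((n + 4) * l) := by
    rw [coeff_derivative, hdfc]; push_cast; ring
  have hJ0d : J0.natDegree ≤ 2 * n + 6 := by
    refine (natDegree_sub_le _ _).trans (max_le ?_ ?_)
    · refine natDegree_mul_le.trans ?_
      rw [natDegree_X_pow]; omega
    · refine natDegree_mul_le.trans ?_
      have := natDegree_derivative_le (X ^ (n + 3) : ℂ[X])
      rw [natDegree_X_pow] at this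
      omega
  have hJ0c : J0.coeff (2 * n + 6) = l := by
    have e1 : (derivative f * X ^ (n + 3)).coeff (2 * n + 6) = (n + 4) * l := by
      rw [show 2 * n + 6 = (n + 3) + (n + 3) by ring, coeff_mul_X_pow, hdfc]
    have e2 : (f * derivative (X ^ (n + 3))).coeff (2 * n + 6) = (n + 3) * l := by
      have : f * derivative (X ^ (n + 3)) = C ((n : ℂ) + 3) * (f * X ^ (n + 2)) := by
        rw [derivative_X_pow]; simp; ring
      rw [this, coeff_C_mul, show 2 * n + 6 = (n + 4) + (n + 2) by ring, coeff_mul_X_pow]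
    rw [hJ0, coeff_sub, e1, e2]; ring
  have hW : derivative J0 * derivative f - J0 * derivative (derivative f) ≠ 0 := by
    intro h0
    have e1 : (derivative J0 * derivative f).coeff ((2 * n + 5) + (n + 3)) =
        (2 * n + 6) * l * ((n + 4) * l) := by
      rw [coeff_mul_add_eq_of_natDegree_le ((natDegree_derivative_le _).trans (by omega)) hdf, hdfc,
        coeff_derivative, hJ0c]
      push_cast; ring
    have e2 : (J0 * derivative (derivative f)).coeff ((2 * n + 6) + (n + 2)) =
        l * ((n + 3) * ((n + 4) * l)) := by
      rw [coeff_mul_add_eq_of_natDegree_le hJ0d hd2f, hJ0c, hd2fc]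
    have e3 := congrArg (fun p => coeff p (3 * n + 8)) h0
    simp only [coeff_sub, coeff_zero] at e3
    rw [show 3 * n + 8 = (2 * n + 5) + (n + 3) by ring, e1,
      show (2 * n + 5) + (n + 3) = (2 * n + 6) + (n + 2) by ring, e2] at e3
    have e4 : l * l * ((n + 3 : ℕ) : ℂ) * ((n + 4 : ℕ) : ℂ) = 0 := by
      push_cast; linear_combination e3
    have h3 : ((n + 3 : ℕ) : ℂ) ≠ 0 := Nat.cast_ne_zero.2 (by omega)
    have h4 : ((n + 4 : ℕ) : ℂ) ≠ 0 := Nat.cast_ne_zero.2 (by omega)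
    simp only [mul_eq_zero, hl0, h3, h4, or_self] at e4
  have hfin1 := finite_double J0 (derivative f) hW hfs
  have hfin2 : ((fun r : ℂ => - r ^ (n + 3)) '' (↑f.roots.toFinset : Set ℂ)).Finite :=
    (Finset.finite_toSet _).image _
  obtain ⟨t, ht⟩ := ((hfin1.union hfin2).union (Set.finite_singleton (0 : ℂ))).exists_notMem
  simp only [Set.mem_union, not_or, Set.mem_singleton_iff] at ht
  obtain ⟨⟨ht1, ht2⟩, ht0⟩ := ht
  refine ⟨X ^ n + C s, X ^ (n + 3) + C t, natDegree_add_C.trans_le (natDegree_X_pow_le n),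
    natDegree_add_C.trans_le ((natDegree_X_pow_le _).trans (by omega)), ?_⟩
  have hcf : cpoly (cvec (n + 5) f) = f := cpoly_cvec (n + 4) f hf1.1.le
  have hcg : cpoly (cvec (n + 5) (X ^ (n + 3) + C t)) = X ^ (n + 3) + C t :=
    cpoly_cvec (n + 4) _ (natDegree_add_C.trans_le ((natDegree_X_pow_le _).trans (by omega)))
  change Yd n (cvec (n + 5) f) (cvec (n + 5) (X ^ (n + 3) + C t)) ≠ 0
  have hJ : Jp n (cvec (n + 5) f) (cvec (n + 5) (X ^ (n + 3) + C t)) =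
      J0 + C t * derivative f := by
    rw [Jp_congr n _ _ _ _ hcf hcg, hJ0]
    simp only [derivative_add, derivative_C, add_zero]
    ring
  rw [Yd_ne_zero_iff, hJ, hcg]
  refine ⟨?_, ?_, ?_⟩
  · rw [coeff_add, hJ0c, coeff_C_mul, coeff_eq_zero_of_natDegree_lt (p := derivative f) (by omega)]
    simpa using hl0
  · intro r h1 h2
    exact ht1 ⟨r, h1, h2⟩
  · intro r h1 h2
    have h3 : f.eval r * (derivative (X ^ (n + 3) : ℂ[X])).eval r = 0 := by
      simp only [hJ0, eval_add, eval_sub, eval_mul, eval_C, eval_pow, eval_X] at h1 h2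
      linear_combination -h1 + (derivative f).eval r * h2
    rw [mul_eq_zero] at h3
    simp only [eval_add, eval_pow, eval_X, eval_C] at h2
    rcases h3 with h3 | h3
    · refine ht2 ⟨r, ?_, by simp only; linear_combination -h2⟩
      rw [Finset.mem_coe, Multiset.mem_toFinset, mem_roots hf0]
      exact h3
    · rw [derivative_X_pow, eval_mul, eval_C, mul_eq_zero, eval_pow, eval_X] at h3
      have h4 : ((n + 3 : ℕ) : ℂ) ≠ 0 := Nat.cast_ne_zero.2 (by omega)
      have h5 : r = 0 := by simpa using h3.resolve_left h4
      rw [h5] at h2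
      simp at h2
      exact ht0 h2

theorem sqfree_part {A : Type*} [CommRing A] [IsDomain A] [UniqueFactorizationMonoid A] (x y : A) (hx : x ≠ 0) :
    ∃ S : A, Squarefree S ∧ S ∣ x ∧ (∀ P, Prime P → P ∣ S → ¬ P ∣ y) ∧ ∃ k, x ∣ (S * y) ^ k := by
  revert hx
  induction x using UniqueFactorizationMonoid.induction_on_prime with
  | h₁ => intro h; exact absurd rfl h
  | h₂ x hu =>
    intro _
    exact ⟨1, squarefree_one, one_dvd _, fun P hP h => absurd (isUnit_of_dvd_one h) hP.not_isUnit, 0,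
      by simpa using hu.dvd⟩
  | h₃ a p ha hp ih =>
    intro _
    obtain ⟨S, h1, h2, h3, k, h4⟩ := ih ha
    by_cases hc : p ∣ S * y
    · refine ⟨S, h1, h2.mul_left p, h3, k + 1, ?_⟩
      rw [pow_succ']; exact mul_dvd_mul hc h4
    · refine ⟨p * S, ?_, mul_dvd_mul_left p h2, ?_, k + 1, ?_⟩
      · rw [squarefree_mul_iff]
        refine ⟨?_, hp.irreducible.squarefree, h1⟩
        rw [hp.irreducible.isRelPrime_iff_not_dvd]
        exact fun h => hc (h.mul_right _)
      · intro P hP hPS hPy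
        rcases hP.dvd_or_dvd hPS with h | h
        · exact hc ((((hP.associated_of_dvd hp h).symm.dvd).trans hPy).mul_left _)
        · exact h3 P hP h hPy
      · rw [pow_succ']
        refine mul_dvd_mul ⟨S * y, by ring⟩ (h4.trans (pow_dvd_pow_of_dvd ⟨p, by ring⟩ k))

theorem sq_dvd_of_primes {A : Type*} [CommRing A] [IsDomain A] [UniqueFactorizationMonoid A] (S D : A) (hS : Squarefree S)
    (h : ∀ P, Prime P → P ∣ S → P ^ 2 ∣ D) : S ^ 2 ∣ D := by
  revert hS h
  induction S using UniqueFactorizationMonoid.induction_on_prime with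
  | h₁ => intro h; exact absurd h not_squarefree_zero
  | h₂ x hu => intro _ _; exact (hu.pow 2).dvd
  | h₃ a p ha hp ih =>
    intro hS h
    rw [squarefree_mul_iff] at hS
    rw [mul_pow]
    exact hS.1.pow.mul_dvd (h p hp (dvd_mul_right _ _)) (ih hS.2.2 fun P hP hd => h P hP (hd.mul_left _))

theorem prime_dvd_of_vanish {σ : Type*} [Finite σ] (P q : MvPolynomial σ ℂ) (hP : Prime P)
    (h : ∀ x : σ → ℂ, MvPolynomial.eval x P = 0 → MvPolynomial.eval x q = 0) : P ∣ q := by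
  have hI : (Ideal.span {P}).IsPrime := (Ideal.span_singleton_prime hP.ne_zero).2 hP
  have h1 := MvPolynomial.IsPrime.vanishingIdeal_zeroLocus (k := ℂ) (K := ℂ) (Ideal.span {P})
  rw [← Ideal.mem_span_singleton, ← h1, MvPolynomial.mem_vanishingIdeal_iff]
  intro x hx
  rw [MvPolynomial.zeroLocus_span] at hx
  have := h x (by simpa using hx)
  simpa using this

theorem sq_dvd_det {A : Type*} [CommRing A] [IsDomain A] {ι : Type*} [Fintype ι] [DecidableEq ι] [Nonempty ι]
    (M : Matrix ι ι A) (P : A) (hP : Prime P) (h : ∀ i j, P ∣ M.adjugate i j) : P ^ 2 ∣ M.det := by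
  choose B hB using h
  have h1 : M.adjugate = P • (Matrix.of B) := by
    ext i j; simp [hB]
  have h2 := congrArg Matrix.det h1
  rw [Matrix.det_adjugate, Matrix.det_smul] at h2
  obtain ⟨s, hs⟩ : ∃ s, Fintype.card ι = s + 1 := ⟨Fintype.card ι - 1, by have := Fintype.card_pos (α := ι); omega⟩
  rw [hs, Nat.add_sub_cancel] at h2
  have h3 : P ∣ M.det := hP.dvd_of_dvd_pow (n := s) ⟨P ^ s * (Matrix.of B).det, by rw [h2]; ring⟩
  obtain ⟨D1, hD1⟩ := h3
  rw [hD1, mul_pow, pow_succ, mul_assoc] at h2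
  have h4 := mul_left_cancel₀ (pow_ne_zero s hP.ne_zero) h2
  have h5 : P ∣ D1 := hP.dvd_of_dvd_pow (n := s) ⟨_, h4⟩
  rw [hD1, sq]
  exact mul_dvd_mul_left _ h5

abbrev AR (n : ℕ) := MvPolynomial (Fin (n + 5) ⊕ Fin (n + 5)) ℂ

def fG (n : ℕ) (k : Fin (n + 5)) : AR n := MvPolynomial.X (Sum.inl k)
def gG (n : ℕ) (k : Fin (n + 5)) : AR n := MvPolynomial.X (Sum.inr k)

def evA {R : Type*} [CommRing R] [Algebra ℂ R] {n : ℕ} (f g : Fin (n + 5) → R) : AR n →ₐ[ℂ] R :=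
  MvPolynomial.aeval (Sum.elim f g)

theorem evA_f {R : Type*} [CommRing R] [Algebra ℂ R] {n : ℕ} (f g : Fin (n + 5) → R) (k : Fin (n + 5)) :
    evA f g (fG n k) = f k := by simp [evA, fG]

theorem evA_g {R : Type*} [CommRing R] [Algebra ℂ R] {n : ℕ} (f g : Fin (n + 5) → R) (k : Fin (n + 5)) :
    evA f g (gG n k) = g k := by simp [evA, gG]

theorem evA_comp {R S : Type*} [CommRing R] [Algebra ℂ R] [CommRing S] [Algebra ℂ S] (φ : R →ₐ[ℂ] S)
    {n : ℕ} (f g : Fin (n + 5) → R) (P : AR n) :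
    φ (evA f g P) = evA (fun k => φ (f k)) (fun k => φ (g k)) P := by
  have : φ.comp (evA f g) = evA (fun k => φ (f k)) (fun k => φ (g k)) := by
    apply MvPolynomial.algHom_ext
    rintro (k | k) <;> simp [evA]
  exact DFunLike.congr_fun this P

theorem evA_D {R : Type*} [CommRing R] [Algebra ℂ R] {n : ℕ} (f g : Fin (n + 5) → R) :
    evA f g (BDet n (fG n) (gG n)) = BDet n f g := by
  have := BDet_map (evA f g).toRingHom n (fG n) (gG n)
  simpa [evA_f, evA_g] using this

theorem evA_Y {R : Type*} [CommRing R] [Algebra ℂ R] {n : ℕ} (f g : Fin (n + 5) → R) :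
    evA f g (Yd n (fG n) (gG n)) = Yd n f g := by
  have := Yd_map (evA f g).toRingHom n (fG n) (gG n)
  simpa [evA_f, evA_g] using this

theorem evA_X {R : Type*} [CommRing R] [Algebra ℂ R] {n : ℕ} (f g : Fin (n + 5) → R) :
    evA f g (Xd n (fG n) (gG n)) = Xd n f g := by
  have := Xd_map (evA f g).toRingHom n (fG n) (gG n)
  simpa [evA_f, evA_g] using this

theorem evA_eval {n : ℕ} (x : Fin (n + 5) ⊕ Fin (n + 5) → ℂ) (P : AR n) :
    MvPolynomial.eval x P = evA (fun k => x (Sum.inl k)) (fun k => x (Sum.inr k)) P := by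
  have : Sum.elim (fun k => x (Sum.inl k)) (fun k => x (Sum.inr k)) = x := by
    ext (k | k) <;> rfl
  rw [evA, this]
  rfl

theorem D_ex (n : ℕ) (z : Fin (n + 2) → ℂ) (hz : Function.Injective z) (t : ℂ)
    (ht : ∀ i j, i ≠ j → t ≠ z i * z j) :
    BDet n (cvec (n + 5) ((∏ i, (X - C (z i))) * (X ^ 2 + C t)))
      (cvec (n + 5) ((∏ i, (X - C (z i))) * X)) ≠ 0 := by
  have hp : (∏ i, (X - C (z i))).natDegree = n + 2 := by
    rw [natDegree_prod_of_monic _ _ (fun i _ => monic_X_sub_C _)]; simp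
  refine BDet_ne_zero n z hz t ht _ _ (cpoly_cvec (n + 4) _ ?_) (cpoly_cvec (n + 4) _ ?_)
  · refine natDegree_mul_le.trans ?_
    have : (X ^ 2 + C t : ℂ[X]).natDegree ≤ 2 := natDegree_add_C.trans_le (natDegree_X_pow_le _)
    omega
  · refine natDegree_mul_le.trans ?_
    have : (X : ℂ[X]).natDegree ≤ 1 := natDegree_X_le
    omega

theorem DG_ne_zero (n : ℕ) : BDet n (fG n) (gG n) ≠ 0 := by
  intro h
  have hinj : Function.Injective (fun i : Fin (n + 2) => ((i : ℕ) : ℂ) + 1) := by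
    intro i j hij
    have : ((i : ℕ) : ℂ) = (j : ℕ) := by simpa using hij
    exact Fin.ext (Nat.cast_injective this)
  refine D_ex n (fun i => (i : ℕ) + 1) hinj 0 ?_ ?_
  · intro i j _
    exact (mul_ne_zero (Nat.cast_add_one_ne_zero _) (Nat.cast_add_one_ne_zero _)).symm
  · rw [← evA_D, h, map_zero]

theorem YG_ne_zero (n : ℕ) : Yd n (fG n) (gG n) ≠ 0 := by
  intro h0
  obtain ⟨h, g, -, -, hY⟩ := exists_good n
  rw [← evA_Y, h0, map_zero] at hY
  exact hY rfl

instance (n : ℕ) : Nonempty (BCol n) := by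
  unfold BCol
  infer_instance

theorem BDet_eq_zero_of_solF (n : ℕ) (f g : Fin (n + 5) → ℂ) (hs : BSolF n f g) : BDet n f g = 0 := by
  have h1 := Matrix.mul_adjugate (BSq n f g)
  rw [adjugate_eq_zero_of_solF n f g hs, mul_zero] at h1
  obtain ⟨i⟩ := (inferInstance : Nonempty (BCol n))
  have := congrFun (congrFun h1 i) i
  simpa [BDet] using this.symm

theorem XG_ne_zero (n : ℕ) : Xd n (fG n) (gG n) ≠ 0 := by
  intro h0
  refine mul_ne_zero (DG_ne_zero n) (YG_ne_zero n) (MvPolynomial.funext fun x => ?_)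
  rw [map_zero, evA_eval, map_mul, evA_D, evA_Y]
  by_cases hY : Yd n (fun k => x (Sum.inl k)) (fun k => x (Sum.inr k)) = 0
  · rw [hY, mul_zero]
  · rw [BDet_eq_zero_of_solF n _ _ (solF_of_Xd n _ _ hY _), zero_mul]
    rw [← evA_X, h0, map_zero]

theorem exists_S (n : ℕ) : ∃ S E : AR n, Squarefree S ∧ BDet n (fG n) (gG n) = S ^ 2 * E ∧
    (∀ P, Prime P → P ∣ S → ¬ P ∣ Yd n (fG n) (gG n)) ∧
    (∀ f g : Fin (n + 5) → ℂ, Yd n f g ≠ 0 → (evA f g S = 0 ↔ BSolF n f g)) := by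
  obtain ⟨S, h1, h2, h3, k, h4⟩ := sqfree_part _ (Yd n (fG n) (gG n)) (XG_ne_zero n)
  have h5 : S ^ 2 ∣ BDet n (fG n) (gG n) := by
    refine sq_dvd_of_primes S _ h1 fun P hP hPS => ?_
    refine sq_dvd_det (BSq n (fG n) (gG n)) P hP fun i j => ?_
    refine (hP.dvd_or_dvd (prime_dvd_of_vanish P
      ((BSq n (fG n) (gG n)).adjugate i j * Yd n (fG n) (gG n)) hP fun x hx => ?_)).resolve_right
      (h3 P hP hPS)
    rw [evA_eval] at hx ⊢
    rw [map_mul, evA_Y]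
    by_cases hY : Yd n (fun k => x (Sum.inl k)) (fun k => x (Sum.inr k)) = 0
    · rw [hY, mul_zero]
    · obtain ⟨r, hr⟩ := hPS.trans h2
      have hX : Xd n (fun k => x (Sum.inl k)) (fun k => x (Sum.inr k)) = 0 := by
        rw [← evA_X, hr, map_mul, hx, zero_mul]
      have h6 := adjugate_eq_zero_of_solF n _ _ (solF_of_Xd n _ _ hY hX)
      have h7 := BSq_map (evA (fun k => x (Sum.inl k)) (fun k => x (Sum.inr k))).toRingHom n (fG n) (gG n)
      have h8 := RingHom.map_adjugate (evA (fun k => x (Sum.inl k)) (fun k => x (Sum.inr k))).toRingHom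
        (BSq n (fG n) (gG n))
      rw [RingHom.mapMatrix_apply, RingHom.mapMatrix_apply, h7] at h8
      simp only [AlgHom.toRingHom_eq_coe, RingHom.coe_coe, evA_f, evA_g] at h8
      rw [h6] at h8
      have := congrFun (congrFun h8 i) j
      simp only [Matrix.map_apply, Matrix.zero_apply, RingHom.coe_coe] at this
      rw [this, zero_mul]
  obtain ⟨E, hE⟩ := h5
  refine ⟨S, E, h1, hE, h3, fun f g hY => ?_⟩
  constructor
  · intro h0
    obtain ⟨r, hr⟩ := h2
    refine solF_of_Xd n f g hY ?_
    rw [← evA_X, hr, map_mul, h0, zero_mul]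
  · intro hs
    have hX := Xd_of_solF n f g hY hs
    obtain ⟨r, hr⟩ := h4
    have := congrArg (evA f g) hr
    rw [map_pow, map_mul, map_mul, evA_Y, evA_X, hX, zero_mul] at this
    exact (mul_eq_zero.1 (eq_zero_of_pow_eq_zero this)).resolve_right hY

theorem quad_split (q : ℂ[X]) (hq : q.natDegree ≤ 2) (ha : q.coeff 2 ≠ 0)
    (hd : q.coeff 1 ^ 2 - 4 * q.coeff 2 * q.coeff 0 ≠ 0) :
    ∃ r r' : ℂ, r ≠ r' ∧ q = C (q.coeff 2) * ((X - C r) * (X - C r')) := by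
  obtain ⟨s, hs⟩ := IsAlgClosed.exists_pow_nat_eq (q.coeff 1 ^ 2 - 4 * q.coeff 2 * q.coeff 0) (n := 2) (by norm_num)
  have hs0 : s ≠ 0 := by
    rintro rfl
    exact hd (by rw [← hs]; simp)
  have e := eq_quadratic_of_degree_le_two (degree_le_of_natDegree_le hq)
  set a := q.coeff 2
  set b := q.coeff 1
  set c := q.coeff 0
  refine ⟨(-b + s) / (2 * a), (-b - s) / (2 * a), ?_, ?_⟩
  · intro h
    rw [div_left_inj' (mul_ne_zero two_ne_zero ha)] at h
    apply hs0
    linear_combination h / 2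
  · have h1 : b = - a * ((-b + s) / (2 * a) + (-b - s) / (2 * a)) := by field_simp; ring
    have h2 : c = a * (((-b + s) / (2 * a)) * ((-b - s) / (2 * a))) := by
      field_simp
      linear_combination hs
    generalize (-b + s) / (2 * a) = r at *
    generalize (-b - s) / (2 * a) = r' at *
    rw [e, h1, h2]
    simp only [C_mul, C_neg, C_add]
    ring

theorem cvec_map {R T : Type*} [CommRing R] [CommRing T] (φ : R →+* T) (N : ℕ) (p : R[X]) :
    (fun k => φ (cvec N p k)) = cvec N (p.map φ) := by
  ext k; simp [cvec]

theorem solF_of_quad (n : ℕ) (q h g : ℂ[X]) (c : ℂ) (hq : q.natDegree ≤ 2) (hh : h.natDegree ≤ n)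
    (hg : g.natDegree ≤ n + 4) (ha : q.coeff 2 ≠ 0)
    (hd : q.coeff 1 ^ 2 - 4 * q.coeff 2 * q.coeff 0 ≠ 0) :
    BSolF n (cvec (n + 5) (q ^ 2 * h + C c * g)) (cvec (n + 5) g) := by
  obtain ⟨r, r', hr, e⟩ := quad_split q hq ha hd
  refine ⟨1, -c, r, r', C (q.coeff 2) ^ 2 * h, Or.inl one_ne_zero, hr, ?_, ?_⟩
  · refine lt_of_le_of_lt (degree_le_of_natDegree_le (n := n) ?_) (Nat.cast_lt.2 (Nat.lt_succ_self n))
    rw [← C_pow]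
    exact (natDegree_C_mul_le _ _).trans hh
  · have hqh : (q ^ 2 * h).natDegree ≤ n + 4 := by
      refine natDegree_mul_le.trans ?_
      have := natDegree_pow_le_of_le 2 hq
      omega
    rw [cpoly_cvec (n + 4) g hg, cpoly_cvec (n + 4)]
    · nth_rw 1 [e]
      simp only [C_neg, C_1]
      ring
    · exact natDegree_add_le_of_degree_le hqh ((natDegree_C_mul_le _ _).trans hg)

def lip (p q : ℂ[X]) : ℂ[X][X] := p.map C + C X * (q - p).map C

theorem lip_map (p q : ℂ[X]) (t : ℂ) : (lip p q).map (aeval t : ℂ[X] →ₐ[ℂ] ℂ).toRingHom = p + C t * (q - p) := by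
  have h : ∀ p : ℂ[X], (p.map C).map (aeval t : ℂ[X] →ₐ[ℂ] ℂ).toRingHom = p := by
    intro p
    rw [Polynomial.map_map]
    have : ((aeval t : ℂ[X] →ₐ[ℂ] ℂ).toRingHom).comp C = RingHom.id ℂ := by
      ext; simp
    rw [this, Polynomial.map_id]
  rw [lip, Polynomial.map_add, Polynomial.map_mul, h, h, map_C]
  simp

theorem lip_deg (p q : ℂ[X]) (t : ℂ) (N : ℕ) (hp : p.natDegree ≤ N) (hq : q.natDegree ≤ N) :
    (p + C t * (q - p)).natDegree ≤ N :=
  natDegree_add_le_of_degree_le hp ((natDegree_C_mul_le _ _).trans (natDegree_sub_le_of_le hq hp |>.trans (by simp)))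

theorem family_vanish (n : ℕ) (S : AR n)
    (hS : ∀ f g : Fin (n + 5) → ℂ, Yd n f g ≠ 0 → (evA f g S = 0 ↔ BSolF n f g))
    (q h g : ℂ[X]) (c : ℂ) (hq : q.natDegree ≤ 2) (hh : h.natDegree ≤ n) (hg : g.natDegree ≤ n + 4) :
    evA (cvec (n + 5) (q ^ 2 * h + C c * g)) (cvec (n + 5) g) S = 0 := by
  obtain ⟨h0, g0, hh0, hg0, hY0⟩ := exists_good n
  set q0 : ℂ[X] := X ^ 2 - C 1 with hq0
  have hq0d : q0.natDegree ≤ 2 := by rw [hq0]; compute_degree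
  set FL := (lip q0 q) ^ 2 * lip h0 h + C (C c * X) * lip g0 g with hFL
  have hF : ∀ t : ℂ, FL.map (aeval t : ℂ[X] →ₐ[ℂ] ℂ).toRingHom =
      (q0 + C t * (q - q0)) ^ 2 * (h0 + C t * (h - h0)) + C (c * t) * (g0 + C t * (g - g0)) := by
    intro t
    rw [hFL, Polynomial.map_add, Polynomial.map_mul, Polynomial.map_mul, Polynomial.map_pow, lip_map, lip_map,
      lip_map, map_C]
    simp
  set SL := evA (cvec (n + 5) FL) (cvec (n + 5) (lip g0 g)) S with hSL
  set YL := Yd n (cvec (n + 5) FL) (cvec (n + 5) (lip g0 g)) with hYL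
  have hSt : ∀ t : ℂ, SL.eval t = evA (cvec (n + 5) ((q0 + C t * (q - q0)) ^ 2 * (h0 + C t * (h - h0)) +
      C (c * t) * (g0 + C t * (g - g0)))) (cvec (n + 5) (g0 + C t * (g - g0))) S := by
    intro t
    have := evA_comp (aeval t : ℂ[X] →ₐ[ℂ] ℂ) (cvec (n + 5) FL) (cvec (n + 5) (lip g0 g)) S
    rw [← hF, ← lip_map, ← cvec_map, ← cvec_map]
    rw [← coe_aeval_eq_eval]
    exact this
  have hYt : ∀ t : ℂ, YL.eval t = Yd n (cvec (n + 5) ((q0 + C t * (q - q0)) ^ 2 * (h0 + C t * (h - h0)) +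
      C (c * t) * (g0 + C t * (g - g0)))) (cvec (n + 5) (g0 + C t * (g - g0))) := by
    intro t
    have := Yd_map (aeval t : ℂ[X] →ₐ[ℂ] ℂ).toRingHom n (cvec (n + 5) FL) (cvec (n + 5) (lip g0 g))
    rw [← hF, ← lip_map, ← cvec_map, ← cvec_map]
    rw [← coe_aeval_eq_eval]
    exact this
  set al := (lip q0 q).coeff 2 with hal
  set be := (lip q0 q).coeff 1 with hbe
  set ga := (lip q0 q).coeff 0 with hga
  have hco : ∀ (t : ℂ) (k : ℕ), ((lip q0 q).coeff k).eval t = (q0 + C t * (q - q0)).coeff k := by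
    intro t k
    rw [← lip_map, coeff_map]
    simp
  have hYne : YL ≠ 0 := by
    intro h
    have := hYt 0
    rw [h] at this
    simp only [eval_zero, C_0, zero_mul, add_zero, mul_zero] at this
    exact hY0 this.symm
  have hane : al ≠ 0 := by
    intro h
    have := hco 0 2
    rw [← hal, h] at this
    simp [hq0, coeff_one] at this
  have hdne : be ^ 2 - 4 * al * ga ≠ 0 := by
    intro h
    have := congrArg (eval 0) h
    simp only [eval_sub, eval_pow, eval_mul, hal, hbe, hga, hco] at this
    simp [hq0, coeff_one, coeff_X_pow] at this
  have hprod : SL * (YL * (al * (be ^ 2 - 4 * al * ga))) = 0 := by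
    refine Polynomial.funext fun t => ?_
    rw [eval_mul, eval_mul, eval_mul, eval_zero]
    by_contra hne
    simp only [mul_eq_zero, not_or] at hne
    obtain ⟨h1, h2, h3, h4⟩ := hne
    apply h1
    rw [hSt, hS _ _ (by rw [← hYt]; exact h2)]
    refine solF_of_quad n _ _ _ _ (lip_deg _ _ _ _ hq0d hq) (lip_deg _ _ _ _ hh0 hh) (lip_deg _ _ _ _ hg0 hg) ?_ ?_
    · rw [← hco]; exact h3
    · rw [← hco, ← hco, ← hco]
      simpa using h4
  have hS0 : SL = 0 := (mul_eq_zero.1 hprod).resolve_right (mul_ne_zero hYne (mul_ne_zero hane hdne))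
  have := hSt 1
  rw [hS0] at this
  simpa using this.symm

def nodeP {n : ℕ} (z : Fin (n + 2) → ℂ) : ℂ[X] := ∏ i, (X - C (z i))

theorem nodeP_natDegree {n : ℕ} (z : Fin (n + 2) → ℂ) : (nodeP z).natDegree = n + 2 := by
  rw [nodeP, natDegree_prod_of_monic _ _ (fun i _ => monic_X_sub_C _)]; simp

/-- four parameter values where the square part vanishes -/
theorem four_vanish (n : ℕ) (S : AR n)
    (hS : ∀ f g : Fin (n + 5) → ℂ, Yd n f g ≠ 0 → (evA f g S = 0 ↔ BSolF n f g))
    (p h : ℂ[X]) (a b : ℂ) (hh : h.natDegree ≤ n) (hp : p = (X - C a) * (X - C b) * h)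
    (s x y : ℂ) (hx : x ^ 2 = s ^ 2) (hy : y ^ 2 = s ^ 2) :
    evA (cvec (n + 5) (p * (X ^ 2 + C (a * b + 2 * (y * a - x * b) + (x - y) ^ 2)) + C (s ^ 2 * (a - b) ^ 2) * h))
      (cvec (n + 5) (p * X)) S = 0 := by
  have hpd : p.natDegree ≤ n + 2 := by
    rw [hp]
    refine natDegree_mul_le.trans ?_
    have : ((X - C a) * (X - C b)).natDegree ≤ 2 := by compute_degree
    omega
  have key := family_vanish n S hS ((X - C a) * (X - C b) + C x * (X - C b) - C y * (X - C a)) h (p * X)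
    ((a + b) - 2 * (x - y)) (by compute_degree) hh (by
      refine natDegree_mul_le.trans ?_
      have : (X : ℂ[X]).natDegree ≤ 1 := natDegree_X_le
      omega)
  convert key using 4
  rw [hp]
  have hx' : (C x : ℂ[X]) ^ 2 = C s ^ 2 := by rw [← C_pow, ← C_pow, hx]
  have hy' : (C y : ℂ[X]) ^ 2 = C s ^ 2 := by rw [← C_pow, ← C_pow, hy]
  simp only [C_mul, C_add, C_sub, C_pow]
  rw [show (C (2 : ℂ) : ℂ[X]) = 2 from rfl]
  linear_combination (-(C a - C b) ^ 2 * h + ((X - C a) * (X - C b) - (X - C b)^2 + (C a - C b)^2) * h) * hx' + (((X - C a) * (X - C b) - (X - C a) ^ 2) * h) * hy'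

theorem order4 (n : ℕ) (S : AR n)
    (hS : ∀ f g : Fin (n + 5) → ℂ, Yd n f g ≠ 0 → (evA f g S = 0 ↔ BSolF n f g))
    (p h : ℂ[X]) (a b : ℂ) (hh : h.natDegree ≤ n) (hp : p = (X - C a) * (X - C b) * h)
    (hne : a - b ≠ 0) (hsum : a + b ≠ 0) :
    (X - C (a * b)) ^ 4 ∣ evA (cvec (n + 5) (p.map C * (X ^ 2 + C X)))
      (cvec (n + 5) (p.map C * X)) S := by
  set ι : ℂ →+* ℂ[X][X] := algebraMap ℂ ℂ[X][X] with hι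
  set FL : ℂ[X][X][X] := p.map ι * (X ^ 2 + C X) + C (C (X ^ 2 * C ((a - b) ^ 2))) * h.map ι with hFL
  set GQ : ℂ[X][X][X] := p.map ι * X with hGQ
  set U := evA (cvec (n + 5) FL) (cvec (n + 5) GQ) S with hU
  -- roots
  have hroot : ∀ ε ε' : ℂ, ε ^ 2 = 1 → ε' ^ 2 = 1 →
      U.eval (C (a * b) + C (2 * (ε' * a - ε * b)) * X + C ((ε - ε') ^ 2) * X ^ 2) = 0 := by
    intro ε ε' h1 h2
    set ℓ : ℂ[X] := C (a * b) + C (2 * (ε' * a - ε * b)) * X + C ((ε - ε') ^ 2) * X ^ 2 with hℓ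
    refine Polynomial.funext fun s => ?_
    set φ : ℂ[X][X] →ₐ[ℂ] ℂ := (aeval s : ℂ[X] →ₐ[ℂ] ℂ).comp
      ((aeval ℓ : ℂ[X][X] →ₐ[ℂ[X]] ℂ[X]).restrictScalars ℂ) with hφ
    have e1 : eval s (eval ℓ U) = φ U := by simp [hφ]
    have e2 := evA_comp φ (cvec (n + 5) FL) (cvec (n + 5) GQ) S
    have e3 : ∀ r : ℂ[X], (r.map ι).map (φ : ℂ[X][X] →+* ℂ) = r := by
      intro r
      rw [Polynomial.map_map, hι, AlgHom.comp_algebraMap]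
      simp
    have e4 := cvec_map (φ : ℂ[X][X] →+* ℂ) (n + 5) FL
    have e5 := cvec_map (φ : ℂ[X][X] →+* ℂ) (n + 5) GQ
    have e6 : FL.map (φ : ℂ[X][X] →+* ℂ) = p * (X ^ 2 + C (a * b + 2 * ((ε' * s) * a - (ε * s) * b) + (ε * s - ε' * s) ^ 2)) + C (s ^ 2 * (a - b) ^ 2) * h := by
      rw [hFL]
      simp only [Polynomial.map_add, Polynomial.map_mul, e3, Polynomial.map_pow, map_X, map_C]
      have e7 : (φ : ℂ[X][X] →+* ℂ) X = a * b + 2 * ((ε' * s) * a - (ε * s) * b) + (ε * s - ε' * s) ^ 2 := by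
        simp [hφ, hℓ]; ring
      have e8 : (φ : ℂ[X][X] →+* ℂ) (C (X ^ 2 * C ((a - b) ^ 2))) = s ^ 2 * (a - b) ^ 2 := by
        simp [hφ]
      rw [e7, e8]
    have e7 : GQ.map (φ : ℂ[X][X] →+* ℂ) = p * X := by
      rw [hGQ]
      simp only [Polynomial.map_mul, e3, map_X]
    rw [e1, hU, e2, eval_zero]
    rw [e6] at e4
    rw [e7] at e5
    rw [← four_vanish n S hS p h a b hh hp s (ε * s) (ε' * s) (by rw [mul_pow, h1, one_mul]) (by rw [mul_pow, h2, one_mul])]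
    rw [← e4, ← e5]
    rfl
  -- divisibility
  have hdiv : (X - C (C (a * b) + C (2 * (1 * a - 1 * b)) * X + C ((1 - 1) ^ 2) * X ^ 2)) *
     ((X - C (C (a * b) + C (2 * (-1 * a - -1 * b)) * X + C ((-1 - -1) ^ 2) * X ^ 2)) *
     ((X - C (C (a * b) + C (2 * (-1 * a - 1 * b)) * X + C ((1 - -1) ^ 2) * X ^ 2)) *
     (X - C (C (a * b) + C (2 * (1 * a - -1 * b)) * X + C ((-1 - 1) ^ 2) * X ^ 2)))) ∣ U := by
    by_cases hU0 : U = 0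
    · rw [hU0]; exact dvd_zero _
    have r1 := hroot 1 1 (by norm_num) (by norm_num)
    have r2 := hroot (-1) (-1) (by norm_num) (by norm_num)
    have r3 := hroot 1 (-1) (by norm_num) (by norm_num)
    have r4 := hroot (-1) 1 (by norm_num) (by norm_num)
    have hc1 : ∀ u v w : ℂ, (C u + C v * X + C w * X ^ 2 : ℂ[X]).coeff 1 = v := by
      intro u v w; simp [coeff_X_pow, coeff_C]
    have hc2 : ∀ u v w : ℂ, (C u + C v * X + C w * X ^ 2 : ℂ[X]).coeff 2 = w := by
      intro u v w; simp [coeff_X, coeff_C]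
    have hnod : ({C (a * b) + C (2 * (1 * a - 1 * b)) * X + C ((1 - 1) ^ 2) * X ^ 2,
      C (a * b) + C (2 * (-1 * a - -1 * b)) * X + C ((-1 - -1) ^ 2) * X ^ 2,
      C (a * b) + C (2 * (-1 * a - 1 * b)) * X + C ((1 - -1) ^ 2) * X ^ 2,
      C (a * b) + C (2 * (1 * a - -1 * b)) * X + C ((-1 - 1) ^ 2) * X ^ 2} : Multiset ℂ[X]).Nodup := by
      simp only [Multiset.insert_eq_cons, Multiset.nodup_cons, Multiset.mem_cons, Multiset.mem_singleton, not_or,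
        Multiset.nodup_singleton, and_true]
      refine ⟨⟨?_, ?_, ?_⟩, ⟨?_, ?_⟩, ?_⟩
      · intro h
        have := congrArg (fun r => coeff r 1) h
        simp only [hc1] at this
        exact hne (by linear_combination this / 4)
      · intro h
        have := congrArg (fun r => coeff r 2) h
        simp only [hc2] at this
        norm_num at this
      · intro h
        have := congrArg (fun r => coeff r 2) h
        simp only [hc2] at this
        norm_num at this
      · intro h
        have := congrArg (fun r => coeff r 2) h
        simp only [hc2] at this
        norm_num at this
      · intro h
        have := congrArg (fun r => coeff r 2) h
        simp only [hc2] at this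
        norm_num at this
      · intro h
        have := congrArg (fun r => coeff r 1) h
        simp only [hc1] at this
        exact hsum (by linear_combination -this / 4)
    have := (Multiset.prod_X_sub_C_dvd_iff_le_roots hU0 _).2 ((Multiset.le_iff_subset hnod).2 (by
      intro r hr
      rw [mem_roots hU0, IsRoot.def]
      simp only [Multiset.insert_eq_cons, Multiset.mem_cons, Multiset.mem_singleton] at hr
      rcases hr with rfl | rfl | rfl | rfl
      · exact r1
      · exact r2
      · exact r3
      · exact r4))
    simpa only [Multiset.insert_eq_cons, Multiset.map_cons, Multiset.prod_cons, Multiset.map_singleton,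
      Multiset.prod_singleton] using this
  have h2 := map_dvd (mapAlgHom (aeval (0 : ℂ) : ℂ[X] →ₐ[ℂ] ℂ)) hdiv
  have e1 : (mapAlgHom (aeval (0 : ℂ) : ℂ[X] →ₐ[ℂ] ℂ)) U =
    evA (cvec (n + 5) (p.map C * (X ^ 2 + C X))) (cvec (n + 5) (p.map C * X)) S := by
    set φ : ℂ[X][X] →ₐ[ℂ] ℂ[X] := mapAlgHom (aeval (0 : ℂ) : ℂ[X] →ₐ[ℂ] ℂ) with hφ
    have e2 := evA_comp φ (cvec (n + 5) FL) (cvec (n + 5) GQ) S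
    have e3 : ∀ r : ℂ[X], (r.map ι).map (φ : ℂ[X][X] →+* ℂ[X]) = r.map C := by
      intro r
      rw [Polynomial.map_map, hι, AlgHom.comp_algebraMap]
      rfl
    have e4 := cvec_map (φ : ℂ[X][X] →+* ℂ[X]) (n + 5) FL
    have e5 := cvec_map (φ : ℂ[X][X] →+* ℂ[X]) (n + 5) GQ
    have e6 : FL.map (φ : ℂ[X][X] →+* ℂ[X]) = p.map C * (X ^ 2 + C X) := by
      rw [hFL]
      simp only [Polynomial.map_add, Polynomial.map_mul, e3, Polynomial.map_pow, map_X, map_C]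
      have e7 : (φ : ℂ[X][X] →+* ℂ[X]) X = X := by
        simp [hφ]
      have e8 : (φ : ℂ[X][X] →+* ℂ[X]) (C (X ^ 2 * C ((a - b) ^ 2))) = 0 := by
        simp [hφ]
      rw [e7, e8]
      simp
    have e7 : GQ.map (φ : ℂ[X][X] →+* ℂ[X]) = p.map C * X := by
      rw [hGQ]
      simp only [Polynomial.map_mul, e3, map_X]
    rw [hU, e2]
    rw [e6] at e4
    rw [e7] at e5
    rw [← e4, ← e5]
    rfl
  rw [e1] at h2
  refine dvd_trans (dvd_of_eq ?_) h2
  simp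
  ring

theorem deg_lower (n : ℕ) (S E : AR n)
    (hS : ∀ f g : Fin (n + 5) → ℂ, Yd n f g ≠ 0 → (evA f g S = 0 ↔ BSolF n f g))
    (hD : BDet n (fG n) (gG n) = S ^ 2 * E) (a : ℕ)
    (ha : ∀ (t : ℂ) (f g : Fin (n + 5) → ℂ), evA (fun k => t * f k) g S = t ^ a * evA f g S) :
    2 * (n + 1) * (n + 2) ≤ a := by
  set z : Fin (n + 2) → ℂ := fun i => (2 : ℂ) ^ (2 ^ (i : ℕ)) with hz
  set p := nodeP z with hp
  set V : ℂ[X] := evA (cvec (n + 5) (p.map C * (X ^ 2 + C X))) (cvec (n + 5) (p.map C * X)) S with hV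
  set W : ℂ[X] := evA (cvec (n + 5) (p.map C * (X ^ 2 * C X + 1))) (cvec (n + 5) (p.map C * X)) S with hW
  have hmapC : ∀ t : ℂ, (p.map C).map ((aeval t : ℂ[X] →ₐ[ℂ] ℂ) : ℂ[X] →+* ℂ) = p := by
    intro t
    rw [Polynomial.map_map]
    have : ((aeval t : ℂ[X] →ₐ[ℂ] ℂ) : ℂ[X] →+* ℂ).comp C = RingHom.id ℂ := by
      ext; simp
    rw [this, Polynomial.map_id]
  have hVt : ∀ t : ℂ, V.eval t = evA (cvec (n + 5) (p * (X ^ 2 + C t))) (cvec (n + 5) (p * X)) S := by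
    intro t
    have e := evA_comp (aeval t : ℂ[X] →ₐ[ℂ] ℂ) (cvec (n + 5) (p.map C * (X ^ 2 + C X))) (cvec (n + 5) (p.map C * X)) S
    have e4 := cvec_map ((aeval t : ℂ[X] →ₐ[ℂ] ℂ) : ℂ[X] →+* ℂ) (n + 5) (p.map C * (X ^ 2 + C X))
    have e5 := cvec_map ((aeval t : ℂ[X] →ₐ[ℂ] ℂ) : ℂ[X] →+* ℂ) (n + 5) (p.map C * X)
    simp only [Polynomial.map_mul, hmapC, Polynomial.map_add, Polynomial.map_pow, map_X, map_C] at e4 e5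
    rw [show ((aeval t : ℂ[X] →ₐ[ℂ] ℂ) : ℂ[X] →+* ℂ) X = t by simp] at e4
    rw [← e4, ← e5, ← coe_aeval_eq_eval]
    exact e
  have hWt : ∀ t : ℂ, W.eval t = evA (cvec (n + 5) (p * (X ^ 2 * C t + 1))) (cvec (n + 5) (p * X)) S := by
    intro t
    have e := evA_comp (aeval t : ℂ[X] →ₐ[ℂ] ℂ) (cvec (n + 5) (p.map C * (X ^ 2 * C X + 1))) (cvec (n + 5) (p.map C * X)) S
    have e4 := cvec_map ((aeval t : ℂ[X] →ₐ[ℂ] ℂ) : ℂ[X] →+* ℂ) (n + 5) (p.map C * (X ^ 2 * C X + 1))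
    have e5 := cvec_map ((aeval t : ℂ[X] →ₐ[ℂ] ℂ) : ℂ[X] →+* ℂ) (n + 5) (p.map C * X)
    simp only [Polynomial.map_mul, hmapC, Polynomial.map_add, Polynomial.map_pow, map_X, map_C, Polynomial.map_one] at e4 e5
    rw [show ((aeval t : ℂ[X] →ₐ[ℂ] ℂ) : ℂ[X] →+* ℂ) X = t by simp] at e4
    rw [← e4, ← e5, ← coe_aeval_eq_eval]
    exact e
  have hVW : ∀ t : ℂ, t ≠ 0 → V.eval t = t ^ a * W.eval t⁻¹ := by
    intro t ht
    rw [hVt, hWt, ← ha]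
    congr 2
    ext k
    simp only [cvec]
    rw [← coeff_C_mul]
    congr 1
    have : (C t * C t⁻¹ : ℂ[X]) = 1 := by rw [← C_mul, mul_inv_cancel₀ ht, C_1]
    linear_combination (-(p * X ^ 2)) * this
  -- degree of V at most a
  have hWV : X ^ W.natDegree * V = X ^ a * W.reverse := by
    refine Polynomial.eq_of_infinite_eval_eq _ _ (Set.Infinite.mono (s := {0}ᶜ) ?_ (Set.finite_singleton (0 : ℂ)).infinite_compl)
    intro t ht
    have ht0 : t ≠ 0 := ht
    simp only [Set.mem_ofPred_eq, eval_mul, eval_pow, eval_X]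
    rw [hVW t ht0]
    letI : Invertible t⁻¹ := invertibleOfNonzero (inv_ne_zero ht0)
    have := eval₂_reverse_mul_pow (RingHom.id ℂ) t⁻¹ W
    rw [invOf_eq_inv, inv_inv] at this
    change W.reverse.eval t * _ = W.eval t⁻¹ at this
    rw [← this]
    have h2 : t ^ W.natDegree * t⁻¹ ^ W.natDegree = 1 := by
      rw [← mul_pow, mul_inv_cancel₀ ht0, one_pow]
    linear_combination (t ^ a * eval t W.reverse) * h2
  have hzinj : ∀ s t : Finset (Fin (n + 2)), ∏ i ∈ s, z i = ∏ i ∈ t, z i → s = t := by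
    intro s t hst
    simp only [hz, Finset.prod_pow_eq_pow_sum] at hst
    have h1 : ((2 ^ (∑ i ∈ s, 2 ^ (i : ℕ)) : ℕ) : ℂ) = ((2 ^ (∑ i ∈ t, 2 ^ (i : ℕ)) : ℕ) : ℂ) := by
      push_cast; exact hst
    have h2 := Nat.pow_right_injective le_rfl (Nat.cast_injective h1)
    have h3 : ∑ i ∈ s.map Fin.valEmbedding, 2 ^ i = ∑ i ∈ t.map Fin.valEmbedding, 2 ^ i := by
      simpa using h2
    exact Finset.map_injective _ (Finset.geomSum_injective le_rfl h3)
  have hinj : Function.Injective z := by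
    intro i j hij
    have := hzinj {i} {j} (by simpa using hij)
    simpa using this
  have hV0 : V ≠ 0 := by
    intro h0
    have h1 := hVt 0
    rw [h0, eval_zero] at h1
    refine D_ex n z hinj 0 ?_ ?_
    · intro i j _
      simp [hz]
    · rw [← evA_D, hD, map_mul, map_pow]
      rw [hp, nodeP] at h1
      rw [← h1]; simp
  have hdiv : ∏ s ∈ Finset.powersetCard 2 (Finset.univ : Finset (Fin (n + 2))), (X - C (∏ i ∈ s, z i)) ^ 4 ∣ V := by
    refine Finset.prod_dvd_of_coprime ?_ ?_
    · intro s _ t _ hst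
      refine IsCoprime.pow ?_
      refine isCoprime_X_sub_C_of_isUnit_sub ?_
      rw [isUnit_iff_ne_zero, sub_ne_zero]
      exact fun h => hst (hzinj s t h)
    · intro s hs
      rw [Finset.mem_powersetCard] at hs
      obtain ⟨i, j, hij, rfl⟩ := Finset.card_eq_two.1 hs.2
      rw [Finset.prod_pair hij]
      refine order4 n S hS p (∏ k ∈ (Finset.univ.erase i).erase j, (X - C (z k))) (z i) (z j) ?_ ?_ ?_ ?_
      · rw [natDegree_prod_of_monic _ _ (fun i _ => monic_X_sub_C _)]
        simp only [natDegree_X_sub_C, Finset.sum_const, smul_eq_mul, mul_one]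
        rw [Finset.card_erase_of_mem (by simp [hij.symm]), Finset.card_erase_of_mem (by simp)]
        simp
      · rw [hp, nodeP, mul_assoc, Finset.mul_prod_erase _ (fun k => X - C (z k)) (by simp [hij.symm]),
          Finset.mul_prod_erase _ (fun k => X - C (z k)) (by simp)]
      · exact sub_ne_zero.2 fun h => hij (hinj h)
      · simp only [hz]
        have : ((2 ^ 2 ^ (i : ℕ) + 2 ^ 2 ^ (j : ℕ) : ℕ) : ℂ) ≠ 0 := by
          rw [Nat.cast_ne_zero]; positivity
        push_cast at this
        exact this
  have hd1 := natDegree_le_of_dvd hdiv hV0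
  rw [natDegree_prod_of_monic _ _ (fun i _ => (monic_X_sub_C _).pow 4)] at hd1
  simp only [natDegree_pow, natDegree_X_sub_C, Finset.sum_const, Finset.card_powersetCard, Finset.card_univ,
    Fintype.card_fin, smul_eq_mul] at hd1
  have hd2 := congrArg natDegree hWV
  have hW0 : W.reverse ≠ 0 := by
    intro h; rw [h, mul_zero] at hWV
    exact mul_ne_zero (pow_ne_zero _ X_ne_zero) hV0 hWV
  rw [natDegree_mul (pow_ne_zero _ X_ne_zero) hV0, natDegree_mul (pow_ne_zero _ X_ne_zero) hW0,
    natDegree_X_pow, natDegree_X_pow] at hd2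
  have hd3 := reverse_natDegree_le W
  have hch : (n + 2).choose 2 * 2 = (n + 2) * (n + 1) := by
    rw [Nat.choose_two_right]
    have := Nat.div_mul_cancel (Nat.even_mul_pred_self (n + 2)).two_dvd
    simpa using this
  nlinarith

theorem mono_split {A : Type*} [CommRing A] [IsDomain A] (u v : A[X]) (d : A) (hd : d ≠ 0) (m : ℕ)
    (h : u * v = C d * X ^ m) : u = C (u.eval 1) * X ^ u.natDegree ∧ u.natDegree + v.natDegree = m := by
  have h0 : u * v ≠ 0 := by
    rw [h]; exact mul_ne_zero (C_ne_zero.2 hd) (pow_ne_zero _ X_ne_zero)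
  have hu := left_ne_zero_of_mul h0
  have hv := right_ne_zero_of_mul h0
  have h1 := congrArg natDegree h
  rw [natDegree_mul hu hv, natDegree_C_mul_X_pow _ _ hd] at h1
  have h2 := congrArg natTrailingDegree h
  rw [natTrailingDegree_mul hu hv, C_mul_X_pow_eq_monomial, natTrailingDegree_monomial hd] at h2
  have h3 := natTrailingDegree_le_natDegree u
  have h4 := natTrailingDegree_le_natDegree v
  have h5 : u.natTrailingDegree = u.natDegree := by omega
  have h6 : u = C u.leadingCoeff * X ^ u.natDegree := by
    ext k
    rw [coeff_C_mul, coeff_X_pow]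
    rcases lt_trichotomy k u.natDegree with hk | hk | hk
    · rw [coeff_eq_zero_of_lt_natTrailingDegree (by omega), if_neg (by omega), mul_zero]
    · rw [hk]; simp
    · rw [coeff_eq_zero_of_natDegree_lt hk, if_neg (by omega), mul_zero]
  refine ⟨?_, h1⟩
  have h7 : u.eval 1 = u.leadingCoeff := by
    have := congrArg (eval 1) h6
    simpa using this
  rw [h7]; exact h6

theorem evA_id {n : ℕ} (P : AR n) : evA (fG n) (gG n) P = P := by
  have : evA (fG n) (gG n) = AlgHom.id ℂ (AR n) := by
    apply MvPolynomial.algHom_ext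
    rintro (k | k) <;> simp [evA, fG, gG]
  rw [this]; rfl

/-- evaluation `A[X] → R` -/
def evX {R : Type*} [CommRing R] [Algebra ℂ R] {n : ℕ} (f g : Fin (n + 5) → R) (t : R) : (AR n)[X] →ₐ[ℂ] R :=
  eval₂AlgHom (evA f g) t (fun _ => mul_comm _ _)

theorem evX_C {R : Type*} [CommRing R] [Algebra ℂ R] {n : ℕ} (f g : Fin (n + 5) → R) (t : R) (P : AR n) :
    evX f g t (C P) = evA f g P := by
  exact eval₂_C _ _

theorem evX_X {R : Type*} [CommRing R] [Algebra ℂ R] {n : ℕ} (f g : Fin (n + 5) → R) (t : R) :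
    evX f g t X = t := by
  exact eval₂_X _ _

theorem eval_one_evA {n : ℕ} (f g : Fin (n + 5) → (AR n)[X]) (t : AR n) (hf : ∀ k, (f k).eval t = fG n k)
    (hg : ∀ k, (g k).eval t = gG n k) (P : AR n) : (evA f g P).eval t = P := by
  have h := evA_comp ((aeval t : (AR n)[X] →ₐ[AR n] (AR n)).restrictScalars ℂ) f g P
  simp only [AlgHom.restrictScalars_apply, coe_aeval_eq_eval, hf, hg] at h
  rw [h]
  exact evA_id P

theorem BDet_C {n : ℕ} : BDet n (fun k => C (fG n k)) (fun k => C (gG n k)) = C (BDet n (fG n) (gG n)) :=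
  (BDet_map (C : AR n →+* (AR n)[X]) n (fG n) (gG n)).symm

theorem exists_S_final (n : ℕ) : ∃ S : AR n, Squarefree S ∧
    (∀ P, Prime P → P ∣ S → ¬ P ∣ Yd n (fG n) (gG n)) ∧
    (∀ f g : Fin (n + 5) → ℂ, Yd n f g ≠ 0 → evA f g S = 0 → BSolF n f g) ∧
    (∀ f g : Fin (n + 5) → ℂ, BSol n f g → evA f g S = 0) ∧
    evA (fun k : Fin (n + 5) => (X ^ (n + 4 - (k : ℕ)) * C (fG n k) : (AR n)[X]))
      (fun k : Fin (n + 5) => (X ^ (n + 4 - (k : ℕ)) * C (gG n k) : (AR n)[X])) S =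
      C S * X ^ ((n + 4) * (2 * (n + 1) * (n + 2))) := by
  obtain ⟨S, E, h1, hD, h3, h4⟩ := exists_S n
  have hDne := DG_ne_zero n
  have hDne' := hDne
  rw [hD] at hDne'
  have hE0 : E ≠ 0 := right_ne_zero_of_mul hDne'
  have hS0 : S ≠ 0 := by
    rintro rfl; exact not_squarefree_zero h1
  -- scaling in f
  set φ := evA (fun k : Fin (n + 5) => (X * C (fG n k) : (AR n)[X])) (fun k : Fin (n + 5) => (C (gG n k) : (AR n)[X])) with hφ
  have hφ1 : ∀ P, (φ P).eval 1 = P := fun P => eval_one_evA _ _ 1 (by simp) (by simp) P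
  have hφD : φ (BDet n (fG n) (gG n)) = C (BDet n (fG n) (gG n)) * X ^ (2 * (2 * (n + 1) * (n + 2))) := by
    rw [hφ, evA_D, BDet_smul_left, BDet_C, mul_comm]
    congr 2; ring
  have hφS : φ S * φ (S * E) = C (BDet n (fG n) (gG n)) * X ^ (2 * (2 * (n + 1) * (n + 2))) := by
    rw [← hφD, hD, ← map_mul]; congr 1; ring
  have hφE : φ E * φ (S ^ 2) = C (BDet n (fG n) (gG n)) * X ^ (2 * (2 * (n + 1) * (n + 2))) := by
    rw [← hφD, hD, ← map_mul]; congr 1; ring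
  obtain ⟨hs1, hs2⟩ := mono_split _ _ _ hDne _ hφS
  obtain ⟨he1, he2⟩ := mono_split _ _ _ hDne _ hφE
  rw [hφ1] at hs1 he1
  rw [map_pow, natDegree_pow] at he2
  set a := (φ S).natDegree with ha
  have hlow : 2 * (n + 1) * (n + 2) ≤ a := by
    refine deg_lower n S E h4 hD a fun t f g => ?_
    have := congrArg (evX f g t) hs1
    rw [hφ, evA_comp] at this
    simp only [map_mul, map_pow, evX_C, evX_X, evA_f, evA_g] at this
    rw [← mul_comm, ← this]
  have hb : (φ E).natDegree = 0 := by omega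
  rw [hb, pow_zero, mul_one] at he1
  -- shear
  set ψ := evA (fun k : Fin (n + 5) => (C (fG n k) : (AR n)[X])) (fun k : Fin (n + 5) => (C (gG n k) + X * C (fG n k) : (AR n)[X])) with hψ
  have hψ0 : ∀ P, (ψ P).eval 0 = P := fun P => eval_one_evA _ _ 0 (by simp) (by simp) P
  have hψD : ψ (BDet n (fG n) (gG n)) = C (BDet n (fG n) (gG n)) := by
    rw [hψ, evA_D, BDet_shear, BDet_C]
  have hψE : ψ E = C E := by
    have h5 : ψ E * ψ (S ^ 2) = C (BDet n (fG n) (gG n)) * X ^ 0 := by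
      rw [pow_zero, mul_one, ← hψD, hD, ← map_mul]; congr 1; ring
    obtain ⟨-, h6⟩ := mono_split _ _ _ hDne _ h5
    have h7 : (ψ E).natDegree = 0 := by omega
    rw [natDegree_eq_zero] at h7
    obtain ⟨c, hc⟩ := h7
    have := hψ0 E
    rw [← hc, eval_C] at this
    rw [← hc, this]
  -- E is constant
  obtain ⟨c, hc⟩ : ∃ c : ℂ, E = algebraMap ℂ (AR n) c := by
    refine ⟨evA 0 0 E, ?_⟩
    have r1 : ∀ (f g : Fin (n + 5) → AR n), evA f g E = evA (fun _ => 0) g E := by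
      intro f g
      have := congrArg (evX f g 0) he1
      rw [hφ, evA_comp] at this
      simp only [map_mul, evX_C, evX_X, evA_g, zero_mul] at this
      exact this.symm
    have r2 : evA (gG n) (gG n) E = evA (gG n) (fun _ => 0) E := by
      have := congrArg (evX (gG n) (fun _ => 0) 1) hψE
      rw [hψ, evA_comp] at this
      simp only [map_mul, map_add, evX_C, evX_X, evA_g, evA_f, one_mul, zero_add] at this
      exact this
    have r3 := evA_comp (Algebra.ofId ℂ (AR n)) (0 : Fin (n + 5) → ℂ) 0 E
    simp only [Pi.zero_apply, map_zero] at r3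
    have r4 := evA_id E
    rw [r1, ← r1 (gG n), r2, r1, ← r3] at r4
    exact r4.symm
  have hc0 : c ≠ 0 := by
    rintro rfl; exact hE0 (by rw [hc, map_zero])
  refine ⟨S, h1, h3, fun f g hY => (h4 f g hY).1, ?_, ?_⟩
  · intro f g hs
    have := BDet_eq_zero_of_sol n f g hs
    rw [← evA_D, hD, hc, map_mul, map_pow, AlgHom.commutes, mul_eq_zero] at this
    rcases this with h | h
    · exact eq_zero_of_pow_eq_zero h
    · exact absurd h hc0
  · set χ := evA (fun k : Fin (n + 5) => (X ^ (n + 4 - (k : ℕ)) * C (fG n k) : (AR n)[X]))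
      (fun k : Fin (n + 5) => (X ^ (n + 4 - (k : ℕ)) * C (gG n k) : (AR n)[X])) with hχ
    have hχ1 : ∀ P, (χ P).eval 1 = P := fun P => eval_one_evA _ _ 1 (by simp) (by simp) P
    have hχD : χ (BDet n (fG n) (gG n)) = C (BDet n (fG n) (gG n)) * X ^ (2 * ((n + 4) * (2 * (n + 1) * (n + 2)))) := by
      rw [hχ, evA_D, BDet_weight n _ _ X X_ne_zero, BDet_C, mul_comm]
    have hχS : χ S * χ (S * E) = C (BDet n (fG n) (gG n)) * X ^ (2 * ((n + 4) * (2 * (n + 1) * (n + 2)))) := by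
      rw [← hχD, hD, ← map_mul]; congr 1; ring
    obtain ⟨hs1, hs2⟩ := mono_split _ _ _ hDne _ hχS
    rw [hχ1] at hs1
    have h5 : (χ (S * E)).natDegree = (χ S).natDegree := by
      rw [map_mul, hc, AlgHom.commutes, Polynomial.algebraMap_apply, natDegree_mul_C]
      rw [Ne, map_eq_zero]; exact hc0
    rw [h5] at hs2
    have h6 : (χ S).natDegree = (n + 4) * (2 * (n + 1) * (n + 2)) := by omega
    rw [h6] at hs1
    exact hs1

theorem hom_deg {H : MvPolynomial (Fin 3) ℂ} {d : ℕ} (hH : H.IsHomogeneous d) (m : Fin 3 →₀ ℕ)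
    (hm : m ∈ H.support) : ∑ i, m i = d := by
  have h := hH (MvPolynomial.mem_support_iff.1 hm)
  rw [← h, Finsupp.weight_apply, Finsupp.sum_fintype _ _ (by simp)]
  simp

theorem hom_smul {H : MvPolynomial (Fin 3) ℂ} {d : ℕ} (hH : H.IsHomogeneous d) (t : ℂ) (v : Fin 3 → ℂ) :
    MvPolynomial.eval (fun i => t * v i) H = t ^ d * MvPolynomial.eval v H := by
  rw [MvPolynomial.eval_eq', MvPolynomial.eval_eq', Finset.mul_sum]
  refine Finset.sum_congr rfl fun m hm => ?_
  rw [← hom_deg hH m hm, ← Finset.prod_pow_eq_pow_sum]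
  simp only [mul_pow, Finset.prod_mul_distrib]
  ring

theorem linePoly_eval (H : MvPolynomial (Fin 3) ℂ) (v w : Fin 3 → ℂ) (t : ℂ) :
    (linePoly H v w).eval t = MvPolynomial.eval (fun i => v i + t * w i) H := by
  rw [linePoly, MvPolynomial.aeval_def, ← coe_evalRingHom, MvPolynomial.hom_eval₂]
  have : (evalRingHom t).comp (algebraMap ℂ ℂ[X]) = RingHom.id ℂ := by ext; simp
  rw [this]
  have e : (fun i => evalRingHom t (C (v i) + X * C (w i))) = fun i => v i + t * w i := by
    ext i
    simp only [coe_evalRingHom, eval_add, eval_mul, eval_C, eval_X]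
  rw [e]
  rfl

theorem linePoly_natDegree {H : MvPolynomial (Fin 3) ℂ} {d : ℕ} (hH : H.IsHomogeneous d) (v w : Fin 3 → ℂ) :
    (linePoly H v w).natDegree ≤ d := by
  have := MvPolynomial.aeval_natDegree_le (n := 1) H hH.totalDegree_le (fun i => C (v i) + X * C (w i))
    (fun i => by compute_degree)
  simpa [linePoly] using this

/-- change of parameter on a line -/
theorem linePoly_change {H : MvPolynomial (Fin 3) ℂ} {d : ℕ} (hH : H.IsHomogeneous d) (y x v w : Fin 3 → ℂ)
    (s0 s1 t0 t1 : ℂ) (hs : s0 ≠ 0 ∨ s1 ≠ 0)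
    (h0 : ∀ i, y i = s0 * v i + t0 * w i) (h1 : ∀ i, x i = s1 * v i + t1 * w i) :
    linePoly H y x = ∑ k ∈ Finset.range (d + 1), C ((linePoly H v w).coeff k) *
      ((C s0 + C s1 * X) ^ (d - k) * (C t0 + C t1 * X) ^ k) := by
  have hne : (C s0 + C s1 * X : ℂ[X]) ≠ 0 := by
    intro h
    have e0 := congrArg (fun p => coeff p 0) h
    have e1 := congrArg (fun p => coeff p 1) h
    simp [coeff_C] at e0 e1
    rcases hs with hs | hs
    · exact hs e0
    · exact hs e1
  refine Polynomial.eq_of_infinite_eval_eq _ _ (Set.Infinite.mono (s := {r | (C s0 + C s1 * X : ℂ[X]).IsRoot r}ᶜ) ?_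
    (finite_setOfPred_isRoot hne).infinite_compl)
  intro r hr
  have hr0 : s0 + s1 * r ≠ 0 := by
    intro h
    apply hr
    change eval r _ = 0
    simpa using h
  set s := s0 + s1 * r with hsdef
  set t := t0 + t1 * r with htdef
  rw [Set.mem_ofPred_eq, linePoly_eval]
  have e1 : (fun i => y i + r * x i) = fun i => s * (v i + (t / s) * w i) := by
    ext i
    rw [h0, h1]
    field_simp
    rw [hsdef, htdef]; ring
  rw [e1, hom_smul hH, ← linePoly_eval, eval_eq_sum_range' (Nat.lt_succ_of_le (linePoly_natDegree hH v w)),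
    Finset.mul_sum, eval_finsetSum]
  refine Finset.sum_congr rfl fun k hk => ?_
  have hk' : k ≤ d := Nat.lt_succ_iff.1 (Finset.mem_range.1 hk)
  simp only [eval_mul, eval_C, eval_pow, eval_add, eval_X]
  rw [← hsdef, ← htdef]
  have : s ^ d = s ^ (d - k) * s ^ k := by rw [← pow_add]; congr 1; omega
  rw [this, div_pow]
  field_simp

theorem linePoly_swap {H : MvPolynomial (Fin 3) ℂ} {d : ℕ} (hH : H.IsHomogeneous d) (v w : Fin 3 → ℂ)
    (k : ℕ) (hk : k ≤ d) : (linePoly H v w).coeff (d - k) = (linePoly H w v).coeff k := by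
  rw [linePoly_change hH w v v w 0 1 1 0 (Or.inr one_ne_zero) (by simp) (by simp)]
  simp only [finsetSum_coeff, C_0, C_1, zero_add, one_mul, zero_mul, add_zero, one_pow, mul_one, coeff_C_mul,
    coeff_X_pow]
  rw [Finset.sum_eq_single (d - k)]
  · rw [if_pos (by omega), mul_one]
  · intro j hj hjk
    have := Finset.mem_range.1 hj
    rw [if_neg (by omega), mul_zero]
  · intro h
    exact absurd (Finset.mem_range.2 (by omega)) h

theorem linePoly_of_bitangent {H : MvPolynomial (Fin 3) ℂ} {d : ℕ} (hH : H.IsHomogeneous d) (y x v w : Fin 3 → ℂ)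
    (s0 s1 t0 t1 : ℂ) (hs : s0 ≠ 0 ∨ s1 ≠ 0)
    (h0 : ∀ i, y i = s0 * v i + t0 * w i) (h1 : ∀ i, x i = s1 * v i + t1 * w i)
    (c1 : ContactLE H v w 2) (c2 : ContactLE H w v 2) :
    linePoly H y x = ∑ k ∈ (Finset.range (d + 1)).filter (fun k => 2 ≤ k ∧ k + 2 ≤ d), C ((linePoly H v w).coeff k) *
      ((C s0 + C s1 * X) ^ (d - k) * (C t0 + C t1 * X) ^ k) := by
  rw [linePoly_change hH y x v w s0 s1 t0 t1 hs h0 h1]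
  symm
  refine Finset.sum_subset (Finset.filter_subset _ _) ?_
  intro k hk hk2
  have hk' : k ≤ d := Nat.lt_succ_iff.1 (Finset.mem_range.1 hk)
  have hz : (linePoly H v w).coeff k = 0 := by
    unfold ContactLE at c1 c2
    rw [X_pow_dvd_iff] at c1 c2
    simp only [Finset.mem_filter, hk, true_and, not_and_or, not_le] at hk2
    rcases hk2 with h | h
    · exact c1 k h
    · have := linePoly_swap hH v w (d - k) (by omega)
      rw [show d - (d - k) = k by omega] at this
      rw [this]
      exact c2 _ (by omega)
  rw [hz, C_0, zero_mul]

theorem factor_of_bitangent {H : MvPolynomial (Fin 3) ℂ} {n : ℕ} (hH : H.IsHomogeneous (n + 4)) (y x v w : Fin 3 → ℂ)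
    (s0 s1 t0 t1 : ℂ) (hs : s0 ≠ 0 ∨ s1 ≠ 0)
    (h0 : ∀ i, y i = s0 * v i + t0 * w i) (h1 : ∀ i, x i = s1 * v i + t1 * w i)
    (c1 : ContactLE H v w 2) (c2 : ContactLE H w v 2) :
    ∃ h : ℂ[X], h.degree < (n + 1 : ℕ) ∧
      linePoly H y x = (C s1 * X - C (-s0)) ^ 2 * (C t1 * X - C (-t0)) ^ 2 * h := by
  refine ⟨∑ k ∈ (Finset.range (n + 4 + 1)).filter (fun k => 2 ≤ k ∧ k + 2 ≤ n + 4), C ((linePoly H v w).coeff k) *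
      ((C s0 + C s1 * X) ^ (n + 2 - k) * (C t0 + C t1 * X) ^ (k - 2)), ?_, ?_⟩
  · refine lt_of_le_of_lt (degree_le_of_natDegree_le (n := n) ?_) (Nat.cast_lt.2 (Nat.lt_succ_self n))
    refine natDegree_sum_le_of_forall_le _ _ fun k hk => ?_
    simp only [Finset.mem_filter] at hk
    refine (natDegree_C_mul_le _ _).trans (natDegree_mul_le.trans ?_)
    have e : ∀ a b : ℂ, (C a + C b * X : ℂ[X]).natDegree ≤ 1 := fun a b => by compute_degree
    have e1 := natDegree_pow_le_of_le (n + 2 - k) (e s0 s1)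
    have e2 := natDegree_pow_le_of_le (k - 2) (e t0 t1)
    omega
  · rw [linePoly_of_bitangent hH y x v w s0 s1 t0 t1 hs h0 h1 c1 c2, Finset.mul_sum]
    refine Finset.sum_congr rfl fun k hk => ?_
    simp only [Finset.mem_filter] at hk
    obtain ⟨j, rfl⟩ : ∃ j, k = j + 2 := ⟨k - 2, by omega⟩
    rw [show n + 4 - (j + 2) = (n + 2 - (j + 2)) + 2 by omega, show j + 2 - 2 = j by omega]
    generalize n + 2 - (j + 2) = l
    simp only [pow_add, C_neg]
    ring

theorem contact_of_factor {H : MvPolynomial (Fin 3) ℂ} {n : ℕ} (hH : H.IsHomogeneous (n + 4)) (y x : Fin 3 → ℂ)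
    (a b : ℂ) (h : ℂ[X]) (hh : h.degree < (n + 1 : ℕ))
    (e : linePoly H y x = (X - C a) ^ 2 * (X - C b) ^ 2 * h) :
    ContactLE H (fun i => y i + a * x i) (fun i => y i + b * x i) 2 := by
  have hn : h.natDegree ≤ n := by
    by_cases h0 : h = 0
    · simp [h0]
    · exact Nat.lt_succ_iff.1 ((natDegree_lt_iff_degree_lt h0).2 hh)
  refine ⟨C ((a - b) ^ 4) * ∑ k ∈ Finset.range (n + 1), C (h.coeff k) * ((1 + X) ^ (n - k) * (C a + C b * X) ^ k), ?_⟩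
  refine Polynomial.eq_of_infinite_eval_eq _ _ (Set.Infinite.mono (s := {-1}ᶜ) ?_
    (Set.finite_singleton (-1 : ℂ)).infinite_compl)
  intro r hr
  have hr0 : 1 + r ≠ 0 := by
    intro h; apply hr; rw [Set.mem_singleton_iff]; linear_combination h
  rw [Set.mem_ofPred_eq, linePoly_eval]
  have e1 : (fun i => y i + a * x i + r * (y i + b * x i)) = fun i => (1 + r) * (y i + ((a + b * r) / (1 + r)) * x i) := by
    ext i
    field_simp
    ring
  rw [e1, hom_smul hH, ← linePoly_eval, e]
  simp only [eval_mul, eval_pow, eval_sub, eval_X, eval_C, eval_finsetSum, eval_add, eval_one]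
  rw [eval_eq_sum_range' (Nat.lt_succ_of_le hn)]
  have e2 : (1 + r) ^ n * ∑ k ∈ Finset.range (n + 1), h.coeff k * ((a + b * r) / (1 + r)) ^ k =
      ∑ k ∈ Finset.range (n + 1), h.coeff k * ((1 + r) ^ (n - k) * (a + b * r) ^ k) := by
    rw [Finset.mul_sum]
    refine Finset.sum_congr rfl fun k hk => ?_
    have hk' : k ≤ n := Nat.lt_succ_iff.1 (Finset.mem_range.1 hk)
    have : (1 + r) ^ n = (1 + r) ^ (n - k) * (1 + r) ^ k := by rw [← pow_add]; congr 1; omega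
    rw [this, div_pow]
    field_simp
  rw [← e2]
  generalize ∑ k ∈ Finset.range (n + 1), h.coeff k * ((a + b * r) / (1 + r)) ^ k = Z
  field_simp
  ring

theorem exists_comb {A : Type*} [CommRing A] [IsDomain A] [UniqueFactorizationMonoid A] (p q : A[X]) (hp : p ≠ 0)
    (h : ∀ g : A[X], Prime g → g ∣ p → g ∣ q → g.natDegree = 0) :
    ∃ r : A, r ≠ 0 ∧ ∃ U V : A[X], U * p + V * q = C r := by
  classical
  let K := FractionRing A
  have hinj : Function.Injective (algebraMap A K) := IsFractionRing.injective A K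
  have hpK : p.map (algebraMap A K) ≠ 0 := (Polynomial.map_ne_zero_iff hinj).2 hp
  have hco : IsCoprime (p.map (algebraMap A K)) (q.map (algebraMap A K)) := by
    by_contra hcon
    have : ¬ IsUnit (gcd (p.map (algebraMap A K)) (q.map (algebraMap A K))) := by
      rwa [gcd_isUnit_iff]
    have hg0 : gcd (p.map (algebraMap A K)) (q.map (algebraMap A K)) ≠ 0 := by
      intro h0
      exact hpK ((gcd_eq_zero_iff _ _).1 h0).1
    obtain ⟨g, hgi, hg⟩ := WfDvdMonoid.exists_irreducible_factor this hg0
    have hgp : g ∣ p.map (algebraMap A K) := hg.trans (gcd_dvd_left _ _)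
    have hgq : g ∣ q.map (algebraMap A K) := hg.trans (gcd_dvd_right _ _)
    let : NormalizedGCDMonoid A := Nonempty.some inferInstance
    obtain ⟨c, c0, hc⟩ := IsLocalization.integerNormalization_spec (nonZeroDivisors A) g
    set G := IsLocalization.integerNormalization (nonZeroDivisors A) g with hG
    have hcK : algebraMap A K c ≠ 0 := by
      rw [Ne, map_eq_zero_iff _ hinj]
      exact nonZeroDivisors.ne_zero c0
    have hmap : G.map (algebraMap A K) = C (algebraMap A K c) * g := by
      rw [hc, ← smul_eq_C_mul, algebraMap_smul]
    have hG0 : G ≠ 0 := by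
      intro h0
      rw [h0, Polynomial.map_zero] at hmap
      exact (mul_ne_zero (C_ne_zero.2 hcK) hgi.ne_zero) hmap.symm
    have hcont : algebraMap A K G.content ≠ 0 := by
      rw [Ne, map_eq_zero_iff _ hinj, content_eq_zero_iff]
      exact hG0
    have hmap2 : C (algebraMap A K G.content) * G.primPart.map (algebraMap A K) = C (algebraMap A K c) * g := by
      rw [← hmap]
      conv_rhs => rw [G.eq_C_content_mul_primPart]
      rw [Polynomial.map_mul, map_C]
    have hass : Associated (G.primPart.map (algebraMap A K)) g := by
      have u1 : IsUnit (C (algebraMap A K G.content)) := (isUnit_C.2 (isUnit_iff_ne_zero.2 hcont))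
      have u2 : IsUnit (C (algebraMap A K c)) := (isUnit_C.2 (isUnit_iff_ne_zero.2 hcK))
      have a1 : Associated (C (algebraMap A K G.content) * G.primPart.map (algebraMap A K)) (G.primPart.map (algebraMap A K)) :=
        associated_unit_mul_left _ _ u1
      have a2 : Associated (C (algebraMap A K c) * g) g := associated_unit_mul_left _ _ u2
      rw [hmap2] at a1
      exact a1.symm.trans a2
    have hprim := G.isPrimitive_primPart
    have hirr : Irreducible G.primPart :=
      (hprim.irreducible_iff_irreducible_map_fraction_map (K := K)).2 (hass.symm.irreducible hgi)
    have hd := h G.primPart (UniqueFactorizationMonoid.irreducible_iff_prime.1 hirr)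
      (hprim.dvd_of_fraction_map_dvd_fraction_map (K := K) (hass.dvd.trans hgp))
      (hprim.dvd_of_fraction_map_dvd_fraction_map (K := K) (hass.dvd.trans hgq))
    have hd2 : (G.primPart.map (algebraMap A K)).natDegree = 0 := by
      rw [natDegree_map_eq_of_injective hinj, hd]
    have hne : G.primPart.map (algebraMap A K) ≠ 0 := (Polynomial.map_ne_zero_iff hinj).2 hirr.ne_zero
    rw [eq_C_of_natDegree_eq_zero hd2] at hne
    apply (hass.symm.irreducible hgi).not_isUnit
    rw [eq_C_of_natDegree_eq_zero hd2]
    exact isUnit_C.2 (isUnit_iff_ne_zero.2 (C_ne_zero.1 hne))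
  obtain ⟨U, V, hUV⟩ := hco
  obtain ⟨cu, cu0, hcu⟩ := IsLocalization.integerNormalization_spec (nonZeroDivisors A) U
  obtain ⟨cv, cv0, hcv⟩ := IsLocalization.integerNormalization_spec (nonZeroDivisors A) V
  refine ⟨cu * cv, mul_ne_zero (nonZeroDivisors.ne_zero cu0) (nonZeroDivisors.ne_zero cv0),
    C cv * IsLocalization.integerNormalization (nonZeroDivisors A) U,
    C cu * IsLocalization.integerNormalization (nonZeroDivisors A) V, ?_⟩
  apply map_injective _ hinj
  simp only [Polynomial.map_add, Polynomial.map_mul, map_C, hcu, hcv]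
  rw [← algebraMap_smul K cu U, ← algebraMap_smul K cv V, smul_eq_C_mul, smul_eq_C_mul, map_mul, C_mul]
  linear_combination (C (algebraMap A K cu) * C (algebraMap A K cv)) * hUV

/-- Squarefree polynomials in characteristic zero have no non-constant prime factor in common with the derivative. -/
theorem prime_deriv {A : Type*} [CommRing A] [IsDomain A] [CharZero A] (p : A[X])
    (hp : Squarefree p) (g : A[X]) (hg : Prime g) (h1 : g ∣ p) (h2 : g ∣ derivative p) : g.natDegree = 0 := by
  obtain ⟨h, rfl⟩ := h1
  rw [derivative_mul] at h2
  have h3 : g ∣ derivative g * h := (dvd_add_left (dvd_mul_right g _)).1 h2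
  rcases hg.dvd_or_dvd h3 with h4 | h4
  · rw [← derivative_eq_zero]
    by_contra hne
    exact not_dvd_of_degree_lt hne (degree_derivative_lt hg.ne_zero) h4
  · exact absurd (hp g (mul_dvd_mul_left g h4)) hg.not_isUnit

theorem squarefree_C_of {A : Type*} [CommRing A] [IsDomain A] (S : A) (hS : Squarefree S) :
    Squarefree (C S : A[X]) := by
  rintro x ⟨y, h⟩
  have hS0 : S ≠ 0 := hS.ne_zero
  have h0 : x * x * y ≠ 0 := by rw [← h]; exact C_ne_zero.2 hS0
  have hx : x ≠ 0 := by rintro rfl; simp at h0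
  have hy : y ≠ 0 := by rintro rfl; simp at h0
  have hd := congrArg natDegree h
  rw [natDegree_C, natDegree_mul (mul_ne_zero hx hx) hy, natDegree_mul hx hx] at hd
  rw [eq_C_of_natDegree_eq_zero (show x.natDegree = 0 by omega),
    eq_C_of_natDegree_eq_zero (show y.natDegree = 0 by omega), ← C_mul, ← C_mul, C_inj] at h
  rw [eq_C_of_natDegree_eq_zero (show x.natDegree = 0 by omega)]
  exact isUnit_C.2 (hS _ ⟨_, h⟩)

theorem no_common_C {A : Type*} [CommRing A] [IsDomain A] (S Y : A) (hS : S ≠ 0)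
    (h : ∀ P, Prime P → P ∣ S → ¬ P ∣ Y) (g : A[X]) (hg : Prime g) (h1 : g ∣ C S) (h2 : g ∣ C Y) : False := by
  have hd : g.natDegree = 0 := by
    have := natDegree_le_of_dvd h1 (C_ne_zero.2 hS)
    simpa using this
  rw [eq_C_of_natDegree_eq_zero hd] at hg h1 h2
  rw [C_dvd_iff_dvd_coeff] at h1 h2
  exact h _ (prime_C_iff.1 hg) (by simpa using h1 0) (by simpa using h2 0)

abbrev BR (d : ℕ) := MvPolynomial (Fin (d + 1) ⊕ Fin (d + 1)) ℂ

abbrev GR := MvPolynomial (((Fin 3 →₀ ℕ) ⊕ (Fin 3 →₀ ℕ)) ⊕ Fin 3) ℂ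

def evB {R : Type*} [CommRing R] [Algebra ℂ R] {d : ℕ} (f g : Fin (d + 1) → R) : BR d →ₐ[ℂ] R :=
  MvPolynomial.aeval (Sum.elim f g)

theorem evB_comp {R S : Type*} [CommRing R] [Algebra ℂ R] [CommRing S] [Algebra ℂ S] (φ : R →ₐ[ℂ] S)
    {d : ℕ} (f g : Fin (d + 1) → R) (P : BR d) :
    φ (evB f g P) = evB (fun k => φ (f k)) (fun k => φ (g k)) P := by
  have : φ.comp (evB f g) = evB (fun k => φ (f k)) (fun k => φ (g k)) := by
    apply MvPolynomial.algHom_ext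
    rintro (k | k) <;> simp [evB]
  exact DFunLike.congr_fun this P

theorem evB_l {R : Type*} [CommRing R] [Algebra ℂ R] {d : ℕ} (f g : Fin (d + 1) → R) (k : Fin (d + 1)) :
    evB f g (MvPolynomial.X (Sum.inl k)) = f k := by simp [evB]

theorem evB_r {R : Type*} [CommRing R] [Algebra ℂ R] {d : ℕ} (f g : Fin (d + 1) → R) (k : Fin (d + 1)) :
    evB f g (MvPolynomial.X (Sum.inr k)) = g k := by simp [evB]

def evBX {R : Type*} [CommRing R] [Algebra ℂ R] {d : ℕ} (f g : Fin (d + 1) → R) (t : R) : (BR d)[X] →ₐ[ℂ] R :=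
  eval₂AlgHom (evB f g) t (fun _ => mul_comm _ _)

theorem evBX_C {R : Type*} [CommRing R] [Algebra ℂ R] {d : ℕ} (f g : Fin (d + 1) → R) (t : R) (P : BR d) :
    evBX f g t (C P) = evB f g P := by
  exact eval₂_C _ _

theorem evBX_X {R : Type*} [CommRing R] [Algebra ℂ R] {d : ℕ} (f g : Fin (d + 1) → R) (t : R) :
    evBX f g t X = t := by
  exact eval₂_X _ _

/-- the restriction of a degree `d` form with coefficients `a` to the line through `v`, `w` -/
def lineG {R : Type*} [CommRing R] (d : ℕ) (a : (Fin 3 →₀ ℕ) → R) (v w : Fin 3 → R) : R[X] :=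
  ∑ m ∈ Finset.finsuppAntidiag (Finset.univ : Finset (Fin 3)) d, C (a m) * ∏ i, (C (v i) + X * C (w i)) ^ (m i)

theorem lineG_map {R T : Type*} [CommRing R] [CommRing T] (φ : R →+* T) (d : ℕ) (a : (Fin 3 →₀ ℕ) → R)
    (v w : Fin 3 → R) :
    (lineG d a v w).map φ = lineG d (fun m => φ (a m)) (fun i => φ (v i)) (fun i => φ (w i)) := by
  simp only [lineG, Polynomial.map_sum, Polynomial.map_mul, Polynomial.map_prod, Polynomial.map_pow,
    Polynomial.map_add, map_C, map_X]

theorem linePoly_eq_lineG {F : MvPolynomial (Fin 3) ℂ} {d : ℕ} (hF : F.IsHomogeneous d) (v w : Fin 3 → ℂ) :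
    linePoly F v w = lineG d (fun m => F.coeff m) v w := by
  rw [linePoly, MvPolynomial.aeval_def, MvPolynomial.eval₂_eq', lineG]
  refine Finset.sum_subset ?_ ?_
  · intro m hm
    rw [Finset.mem_finsuppAntidiag]
    exact ⟨hom_deg hF m hm, Finset.subset_univ _⟩
  · intro m _ hm
    rw [MvPolynomial.notMem_support_iff.1 hm]
    simp

/-- value of `P` at the restrictions of `F`, `G` -/
def lval {d : ℕ} (P : BR d) (F G : MvPolynomial (Fin 3) ℂ) (y x : Fin 3 → ℂ) : ℂ :=
  evB (cvec (d + 1) (linePoly F y x)) (cvec (d + 1) (linePoly G y x)) P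

def genLF (d : ℕ) : GR[X][X] :=
  lineG (R := GR[X]) d (fun m => C (MvPolynomial.X (Sum.inl (Sum.inl m)))) ![X, 1, 0]
      (fun i => C (MvPolynomial.X (Sum.inr i)))

def genLG (d : ℕ) : GR[X][X] :=
  lineG (R := GR[X]) d (fun m => C (MvPolynomial.X (Sum.inl (Sum.inr m)))) ![X, 1, 0]
      (fun i => C (MvPolynomial.X (Sum.inr i)))

def genP {d : ℕ} (P : BR d) : GR[X] :=
  evB (cvec (d + 1) (genLF d)) (cvec (d + 1) (genLG d)) P

def uvP {d : ℕ} (P : BR d) (F G : MvPolynomial (Fin 3) ℂ) (x : Fin 3 → ℂ) (v : Fin 3 → ℂ[X]) : ℂ[X] :=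
  evB (cvec (d + 1) (lineG d (fun m => C (F.coeff m)) v (fun i => C (x i))))
    (cvec (d + 1) (lineG d (fun m => C (G.coeff m)) v (fun i => C (x i)))) P

theorem genP_map {d : ℕ} (P : BR d) (F G : MvPolynomial (Fin 3) ℂ) (x : Fin 3 → ℂ) :
    (genP P).map (MvPolynomial.eval (Sum.elim (coeffs2 F G) x)) = uvP P F G x ![X, 1, 0] := by
  set p := Sum.elim (coeffs2 F G) x with hp
  have hv : (fun i => (mapRingHom (MvPolynomial.eval p)) ((![X, 1, 0] : Fin 3 → GR[X]) i)) = ![X, 1, 0] := by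
    ext1 i
    fin_cases i <;> simp
  have e := evB_comp (mapAlgHom (MvPolynomial.aeval p : GR →ₐ[ℂ] ℂ)) (cvec (d + 1) (genLF d)) (cvec (d + 1) (genLG d)) P
  have e4 := cvec_map (mapRingHom (MvPolynomial.eval p)) (d + 1) (genLF d)
  have e5 := cvec_map (mapRingHom (MvPolynomial.eval p)) (d + 1) (genLG d)
  have e6 : (genLF d).map (mapRingHom (MvPolynomial.eval p)) =
      lineG d (fun m => C (F.coeff m)) ![X, 1, 0] (fun i => C (x i)) := by
    rw [genLF, lineG_map, hv]
    simp only [coe_mapRingHom, map_C, MvPolynomial.eval_X]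
    rfl
  have e7 : (genLG d).map (mapRingHom (MvPolynomial.eval p)) =
      lineG d (fun m => C (G.coeff m)) ![X, 1, 0] (fun i => C (x i)) := by
    rw [genLG, lineG_map, hv]
    simp only [coe_mapRingHom, map_C, MvPolynomial.eval_X]
    rfl
  rw [uvP, ← e6, ← e7, ← e4, ← e5]
  exact e

theorem uvP_eval {d : ℕ} (P : BR d) {F G : MvPolynomial (Fin 3) ℂ} (hF : F.IsHomogeneous d) (hG : G.IsHomogeneous d)
    (x : Fin 3 → ℂ) (v : Fin 3 → ℂ[X]) (u : ℂ) :
    (uvP P F G x v).eval u = lval P F G (fun i => (v i).eval u) x := by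
  have e := evB_comp (aeval u : ℂ[X] →ₐ[ℂ] ℂ) (cvec (d + 1) (lineG d (fun m => C (F.coeff m)) v (fun i => C (x i))))
    (cvec (d + 1) (lineG d (fun m => C (G.coeff m)) v (fun i => C (x i)))) P
  have e4 := cvec_map (evalRingHom u) (d + 1) (lineG d (fun m => C (F.coeff m)) v (fun i => C (x i)))
  have e5 := cvec_map (evalRingHom u) (d + 1) (lineG d (fun m => C (G.coeff m)) v (fun i => C (x i)))
  rw [lineG_map] at e4 e5
  simp only [coe_evalRingHom, eval_C] at e4 e5
  rw [lval, linePoly_eq_lineG hF, linePoly_eq_lineG hG, ← e4, ← e5, ← coe_aeval_eq_eval]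
  exact e

/-- weighted homogeneity -/
def HasWt {d : ℕ} (S : BR d) (N : ℕ) : Prop :=
  evB (fun k => X ^ (d - (k : ℕ)) * C (MvPolynomial.X (Sum.inl k) : BR d))
    (fun k => X ^ (d - (k : ℕ)) * C (MvPolynomial.X (Sum.inr k))) S = C S * X ^ N

theorem HasWt.eval {d N : ℕ} {S : BR d} (h : HasWt S N) (f g : Fin (d + 1) → ℂ) (t : ℂ) :
    evB (fun k => t ^ (d - (k : ℕ)) * f k) (fun k => t ^ (d - (k : ℕ)) * g k) S = t ^ N * evB f g S := by
  have e := congrArg (evBX f g t) h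
  rw [evB_comp] at e
  simp only [map_mul, map_pow, evBX_C, evBX_X, evB_l, evB_r] at e
  rw [e, mul_comm]

theorem lval_smul {d N : ℕ} {S : BR d} (h : HasWt S N) {F G : MvPolynomial (Fin 3) ℂ} (hF : F.IsHomogeneous d)
    (hG : G.IsHomogeneous d) (x y : Fin 3 → ℂ) (t : ℂ) (ht : t ≠ 0) :
    lval S F G (fun i => t * y i) x = t ^ N * lval S F G y x := by
  have key : ∀ {H : MvPolynomial (Fin 3) ℂ}, H.IsHomogeneous d → cvec (d + 1) (linePoly H (fun i => t * y i) x) =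
      fun k : Fin (d + 1) => t ^ (d - (k : ℕ)) * cvec (d + 1) (linePoly H y x) k := by
    intro H hH
    ext k
    rw [cvec, linePoly_change hH (fun i => t * y i) x y x t 0 0 1 (Or.inl ht) (by simp) (by simp)]
    simp only [finsetSum_coeff, C_0, C_1, zero_add, one_mul, zero_mul, add_zero, coeff_C_mul, ← C_pow,
      coeff_X_pow]
    rw [Finset.sum_eq_single (k : ℕ)]
    · simp [cvec, mul_comm]
    · intro j _ hj
      rw [if_neg (Ne.symm hj)]; simp
    · intro hk
      exact absurd (Finset.mem_range.2 k.2) hk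
  rw [lval, key hF, key hG, h.eval]
  rfl

theorem deg_of_inv (V W : ℂ[X]) (N : ℕ) (h : ∀ t : ℂ, t ≠ 0 → V.eval t = t ^ N * W.eval t⁻¹) :
    V.natDegree ≤ N ∧ V.coeff N = W.eval 0 := by
  have hWV : X ^ W.natDegree * V = X ^ N * W.reverse := by
    refine Polynomial.eq_of_infinite_eval_eq _ _ (Set.Infinite.mono (s := {0}ᶜ) ?_ (Set.finite_singleton (0 : ℂ)).infinite_compl)
    intro t ht
    have ht0 : t ≠ 0 := ht
    simp only [Set.mem_ofPred_eq, eval_mul, eval_pow, eval_X]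
    rw [h t ht0]
    let : Invertible t⁻¹ := invertibleOfNonzero (inv_ne_zero ht0)
    have := eval₂_reverse_mul_pow (RingHom.id ℂ) t⁻¹ W
    rw [invOf_eq_inv, inv_inv] at this
    change W.reverse.eval t * _ = W.eval t⁻¹ at this
    rw [← this]
    have h2 : t ^ W.natDegree * t⁻¹ ^ W.natDegree = 1 := by
      rw [← mul_pow, mul_inv_cancel₀ ht0, one_pow]
    linear_combination (t ^ N * Polynomial.eval t W.reverse) * h2
  constructor
  · rw [natDegree_le_iff_coeff_eq_zero]
    intro j hj
    have := congrArg (fun p => coeff p (j + W.natDegree)) hWV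
    simp only [coeff_X_pow_mul] at this
    rw [this, show j + W.natDegree = (j - N + W.natDegree) + N by omega, coeff_X_pow_mul]
    apply coeff_eq_zero_of_natDegree_lt
    have := reverse_natDegree_le W
    omega
  · have := congrArg (fun p => coeff p (N + W.natDegree)) hWV
    simp only [coeff_X_pow_mul] at this
    rw [this, add_comm, coeff_X_pow_mul, coeff_reverse, revAt_le le_rfl, Nat.sub_self, coeff_zero_eq_eval_zero]

theorem uvP_deg {d N : ℕ} {S : BR d} (h : HasWt S N) {F G : MvPolynomial (Fin 3) ℂ} (hF : F.IsHomogeneous d)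
    (hG : G.IsHomogeneous d) (x : Fin 3 → ℂ) :
    (uvP S F G x ![X, 1, 0]).natDegree ≤ N ∧ (uvP S F G x ![X, 1, 0]).coeff N = lval S F G ![1, 0, 0] x := by
  have e2 := deg_of_inv (uvP S F G x ![X, 1, 0]) (uvP S F G x ![1, X, 0]) N ?_
  · refine ⟨e2.1, e2.2.trans ?_⟩
    rw [uvP_eval _ hF hG]
    congr 1
    ext i
    fin_cases i <;> simp
  · intro t ht
    rw [uvP_eval _ hF hG, uvP_eval _ hF hG, ← lval_smul h hF hG _ _ _ ht]
    congr 1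
    ext i
    fin_cases i <;> simp [ht]

def genQ {d : ℕ} (S Y : BR d) (N : ℕ) : GR :=
  MvPolynomial.X (Sum.inr 2) * (genP S).coeff N * resultant (genP S) (derivative (genP S)) N (N - 1) *
    resultant (genP S) (genP Y) N (genP Y).natDegree

theorem genQ_ne_zero_iff {d N : ℕ} {S : BR d} (Y : BR d) (h : HasWt S N) {F G : MvPolynomial (Fin 3) ℂ}
    (hF : F.IsHomogeneous d) (hG : G.IsHomogeneous d) (x : Fin 3 → ℂ) :
    MvPolynomial.eval (Sum.elim (coeffs2 F G) x) (genQ S Y N) ≠ 0 ↔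
      x 2 ≠ 0 ∧ lval S F G ![1, 0, 0] x ≠ 0 ∧
      (∀ u, (uvP S F G x ![X, 1, 0]).eval u = 0 → (derivative (uvP S F G x ![X, 1, 0])).eval u ≠ 0) ∧
      (∀ u, (uvP S F G x ![X, 1, 0]).eval u = 0 → (uvP Y F G x ![X, 1, 0]).eval u ≠ 0) := by
  set p := Sum.elim (coeffs2 F G) x with hp
  obtain ⟨h1, h2⟩ := uvP_deg h hF hG x
  have m1 := genP_map S F G x
  have m2 := genP_map Y F G x
  rw [← hp] at m1 m2
  have r1 : MvPolynomial.eval p (resultant (genP S) (derivative (genP S)) N (N - 1)) =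
      resultant (uvP S F G x ![X, 1, 0]) (derivative (uvP S F G x ![X, 1, 0])) N (N - 1) := by
    rw [← m1, derivative_map, resultant_map_map]
  have r2 : MvPolynomial.eval p (resultant (genP S) (genP Y) N (genP Y).natDegree) =
      resultant (uvP S F G x ![X, 1, 0]) (uvP Y F G x ![X, 1, 0]) N (genP Y).natDegree := by
    rw [← m1, ← m2, resultant_map_map]
  have r3 : MvPolynomial.eval p ((genP S).coeff N) = lval S F G ![1, 0, 0] x := by
    rw [← h2, ← m1, coeff_map]
  have r4 : MvPolynomial.eval p (MvPolynomial.X (Sum.inr 2)) = x 2 := by simp [hp]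
  have r5 : (uvP Y F G x ![X, 1, 0]).natDegree ≤ (genP Y).natDegree := by
    rw [← m2]; exact natDegree_map_le
  have r6 : (derivative (uvP S F G x ![X, 1, 0])).natDegree ≤ N - 1 :=
    (natDegree_derivative_le _).trans (Nat.sub_le_sub_right h1 1)
  rw [genQ, map_mul, map_mul, map_mul, r1, r2, r3, r4]
  by_cases hl : lval S F G ![1, 0, 0] x = 0
  · simp [hl]
  · have hl' := hl
    rw [← h2] at hl'
    simp only [ne_eq, mul_eq_zero, not_or, hl, not_false_eq_true, true_and, and_true,
      res_zero_iff _ _ _ _ h1 hl' r6, res_zero_iff _ _ _ _ h1 hl' r5, not_exists, not_and]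
    tauto

theorem ncard_roots (p : ℂ[X]) (N : ℕ) (hN : p.natDegree ≤ N) (hc : p.coeff N ≠ 0)
    (hd : ∀ u, p.eval u = 0 → (derivative p).eval u ≠ 0) :
    {u | p.eval u = 0}.Finite ∧ {u | p.eval u = 0}.ncard = N := by
  have hp : p ≠ 0 := by rintro rfl; simp at hc
  have hdeg : p.natDegree = N := le_antisymm hN (le_natDegree_of_ne_zero hc)
  have hset : {u | p.eval u = 0} = (p.roots.toFinset : Set ℂ) := by
    ext u
    simp [hp]
  rw [hset]
  refine ⟨Finset.finite_toSet _, ?_⟩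
  rw [Set.ncard_coe_finset, Multiset.toFinset_card_of_nodup, ← hdeg]
  · exact splits_iff_card_roots.1 (IsAlgClosed.splits p)
  · apply nodup_roots
    rw [separable_def]
    by_contra hcon
    rw [← gcd_isUnit_iff] at hcon
    have hg0 : gcd p (derivative p) ≠ 0 := fun h0 => hp ((gcd_eq_zero_iff _ _).1 h0).1
    obtain ⟨r, hr⟩ := IsAlgClosed.exists_root (gcd p (derivative p)) (by
      intro h0
      exact hcon (isUnit_iff_degree_eq_zero.2 h0))
    exact hd r (hr.dvd (gcd_dvd_left _ _)) (hr.dvd (gcd_dvd_right _ _))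

/-- `θ` -/
def theta {d : ℕ} (α β : Fin (d + 1) → ℂ) : (BR d)[X] →ₐ[ℂ] (BR d)[X] :=
  evBX (fun k => C (MvPolynomial.X (Sum.inl k)) + C (MvPolynomial.C (α k)) * X ^ (d - (k : ℕ)))
    (fun k => C (MvPolynomial.X (Sum.inr k)) + C (MvPolynomial.C (β k)) * X ^ (d - (k : ℕ))) X

theorem theta_inv {d : ℕ} (α β : Fin (d + 1) → ℂ) (P : (BR d)[X]) :
    theta (fun k => - α k) (fun k => - β k) (theta α β P) = P := by
  have hc : ∀ (α' β' : Fin (d + 1) → ℂ) (c : ℂ), theta α' β' (C (MvPolynomial.C c)) = C (MvPolynomial.C c) := by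
    intro α' β' c
    exact (theta α' β').commutes c
  have : ((theta (fun k => - α k) (fun k => - β k)).comp (theta α β)).toRingHom = RingHom.id _ := by
    apply Polynomial.ringHom_ext'
    · apply MvPolynomial.ringHom_ext
      · intro c
        simp [hc]
      · rintro (k | k)
        · have e : ∀ α' β' : Fin (d + 1) → ℂ, theta α' β' (C (MvPolynomial.X (Sum.inl k))) =
            C (MvPolynomial.X (Sum.inl k)) + C (MvPolynomial.C (α' k)) * X ^ (d - (k : ℕ)) := by
            intro α' β'
            rw [theta, evBX_C, evB_l]
          have e2 : ∀ α' β' : Fin (d + 1) → ℂ, theta α' β' X = X := fun α' β' => evBX_X _ _ _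
          simp [e, hc, e2]
          ring
        · have e : ∀ α' β' : Fin (d + 1) → ℂ, theta α' β' (C (MvPolynomial.X (Sum.inr k))) =
            C (MvPolynomial.X (Sum.inr k)) + C (MvPolynomial.C (β' k)) * X ^ (d - (k : ℕ)) := by
            intro α' β'
            rw [theta, evBX_C, evB_r]
          have e2 : ∀ α' β' : Fin (d + 1) → ℂ, theta α' β' X = X := fun α' β' => evBX_X _ _ _
          simp [e, hc, e2]
          ring
    · have e2 : ∀ α' β' : Fin (d + 1) → ℂ, theta α' β' X = X := fun α' β' => evBX_X _ _ _
      simp [e2]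
  exact DFunLike.congr_fun this P

def thetaE {d : ℕ} (α β : Fin (d + 1) → ℂ) : (BR d)[X] ≃ₐ[ℂ] (BR d)[X] :=
  AlgEquiv.ofAlgHom (theta α β) (theta (fun k => - α k) (fun k => - β k))
    (by
      refine AlgHom.ext fun P => ?_
      have := theta_inv (fun k => - α k) (fun k => - β k) P
      simpa using this)
    (by
      refine AlgHom.ext fun P => ?_
      exact theta_inv α β P)

def exF (d : ℕ) (a α : Fin (d + 1) → ℂ) : MvPolynomial (Fin 3) ℂ :=
  ∑ k : Fin (d + 1), (MvPolynomial.C (a k) * (MvPolynomial.X 2 ^ (k : ℕ) * MvPolynomial.X 1 ^ (d - (k : ℕ))) +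
    MvPolynomial.C (α k) * (MvPolynomial.X 2 ^ (k : ℕ) * MvPolynomial.X 0 ^ (d - (k : ℕ))))

theorem exF_hom (d : ℕ) (a α : Fin (d + 1) → ℂ) : (exF d a α).IsHomogeneous d := by
  refine MvPolynomial.IsHomogeneous.sum _ _ _ fun k _ => ?_
  have hk : (k : ℕ) ≤ d := Nat.lt_succ_iff.1 k.2
  have key : ∀ (c : ℂ) (i : Fin 3), (MvPolynomial.C c * (MvPolynomial.X 2 ^ (k : ℕ) *
      MvPolynomial.X i ^ (d - (k : ℕ))) : MvPolynomial (Fin 3) ℂ).IsHomogeneous d := by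
    intro c i
    have := (MvPolynomial.isHomogeneous_C (Fin 3) c).mul ((MvPolynomial.isHomogeneous_X_pow (R := ℂ) (2 : Fin 3) (k : ℕ)).mul
      (MvPolynomial.isHomogeneous_X_pow (R := ℂ) i (d - (k : ℕ))))
    rwa [show 0 + ((k : ℕ) + (d - (k : ℕ))) = d by omega] at this
  exact (key _ _).add (key _ _)

theorem exF_cvec (d : ℕ) (a α : Fin (d + 1) → ℂ) (p q : ℂ) :
    cvec (d + 1) (linePoly (exF d a α) ![p, q, 0] ![0, 0, 1]) =
      fun k => a k * q ^ (d - (k : ℕ)) + α k * p ^ (d - (k : ℕ)) := by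
  have e : linePoly (exF d a α) ![p, q, 0] ![0, 0, 1] =
      ∑ k : Fin (d + 1), C (a k * q ^ (d - (k : ℕ)) + α k * p ^ (d - (k : ℕ))) * X ^ (k : ℕ) := by
    rw [linePoly, exF, map_sum]
    refine Finset.sum_congr rfl fun k _ => ?_
    simp only [map_add, map_mul, map_pow, MvPolynomial.aeval_X, MvPolynomial.aeval_C]
    simp
    ring
  ext j
  rw [cvec, e]
  simp only [finsetSum_coeff, coeff_C_mul, coeff_X_pow]
  rw [Finset.sum_eq_single j]
  · simp
  · intro k _ hk
    rw [if_neg (fun h => hk (Fin.ext h.symm)), mul_zero]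
  · simp

theorem lval_theta {d : ℕ} (P : BR d) (a b α β : Fin (d + 1) → ℂ) (u : ℂ) :
    lval P (exF d a α) (exF d b β) ![u, 1, 0] ![0, 0, 1] =
      ((theta α β (C P)).map (MvPolynomial.eval (Sum.elim a b))).eval u := by
  rw [lval, exF_cvec, exF_cvec, theta, evBX_C]
  have e := evB_comp ((aeval u : ℂ[X] →ₐ[ℂ] ℂ).comp (mapAlgHom (MvPolynomial.aeval (Sum.elim a b) : BR d →ₐ[ℂ] ℂ)))
    (fun k => C (MvPolynomial.X (Sum.inl k)) + C (MvPolynomial.C (α k)) * X ^ (d - (k : ℕ)))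
    (fun k => C (MvPolynomial.X (Sum.inr k)) + C (MvPolynomial.C (β k)) * X ^ (d - (k : ℕ))) P
  refine Eq.trans ?_ e.symm
  congr 2
  · ext k; simp
  · ext k; simp

theorem exists_example {d N : ℕ} {S Y : BR d} (h : HasWt S N) (hS : Squarefree S)
    (hSY : ∀ P, Prime P → P ∣ S → ¬ P ∣ Y) :
    ∃ (F G : MvPolynomial (Fin 3) ℂ) (x : Fin 3 → ℂ), F.IsHomogeneous d ∧ G.IsHomogeneous d ∧ x ≠ 0 ∧
      MvPolynomial.eval (Sum.elim (coeffs2 F G) x) (genQ S Y N) ≠ 0 := by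
  have hS0 : S ≠ 0 := hS.ne_zero
  obtain ⟨z, hz⟩ : ∃ z, MvPolynomial.eval z S ≠ 0 := by
    by_contra! hcon
    exact hS0 (MvPolynomial.funext (fun z => by simpa using hcon z))
  set α : Fin (d + 1) → ℂ := fun k => z (Sum.inl k) with hα
  set β : Fin (d + 1) → ℂ := fun k => z (Sum.inr k) with hβ
  have hzz : Sum.elim α β = z := by ext (k | k) <;> rfl
  set p : (BR d)[X] := theta α β (C S) with hp
  have hpE : p = thetaE α β (C S) := rfl
  have hp0 : p ≠ 0 := by
    rw [hpE, Ne, map_eq_zero_iff _ (thetaE α β).injective]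
    exact C_ne_zero.2 hS0
  have hpsq : Squarefree p := by
    intro g hg
    rw [hpE] at hg
    have h1 : (thetaE α β).symm g * (thetaE α β).symm g ∣ C S := by
      have := map_dvd (thetaE α β).symm hg
      simpa using this
    have h2 := squarefree_C_of S hS _ h1
    have := h2.map (thetaE α β)
    simpa using this
  obtain ⟨r1, hr1, U1, V1, e1⟩ := exists_comb p (derivative p) hp0 (fun g hg h1 h2 => prime_deriv p hpsq g hg h1 h2)
  obtain ⟨r2, hr2, U2, V2, e2⟩ := exists_comb p (theta α β (C Y)) hp0 (fun g hg h1 h2 => by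
    exfalso
    refine no_common_C S Y hS0 hSY ((thetaE α β).symm g) ?_ ?_ ?_
    · exact (MulEquiv.prime_iff (thetaE α β).symm).2 hg
    · have := map_dvd (thetaE α β).symm h1
      rwa [hpE, AlgEquiv.symm_apply_apply] at this
    · have := map_dvd (thetaE α β).symm h2
      rwa [show theta α β (C Y) = thetaE α β (C Y) from rfl, AlgEquiv.symm_apply_apply] at this)
  set L : BR d := evB (fun k => MvPolynomial.X (Sum.inl k) * 0 ^ (d - (k : ℕ)) + MvPolynomial.C (α k))
    (fun k => MvPolynomial.X (Sum.inr k) * 0 ^ (d - (k : ℕ)) + MvPolynomial.C (β k)) S with hL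
  have hLev : ∀ a b : Fin (d + 1) → ℂ, MvPolynomial.eval (Sum.elim a b) L =
      lval S (exF d a α) (exF d b β) ![1, 0, 0] ![0, 0, 1] := by
    intro a b
    rw [lval, exF_cvec, exF_cvec]
    have e := evB_comp (MvPolynomial.aeval (Sum.elim a b) : BR d →ₐ[ℂ] ℂ)
      (fun k => MvPolynomial.X (Sum.inl k) * 0 ^ (d - (k : ℕ)) + MvPolynomial.C (α k))
      (fun k => MvPolynomial.X (Sum.inr k) * 0 ^ (d - (k : ℕ)) + MvPolynomial.C (β k)) S
    refine Eq.trans e ?_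
    congr 2
    · ext k; simp
    · ext k; simp
  have hL0 : L ≠ 0 := by
    intro h0
    have := hLev (fun _ => 0) (fun _ => 0)
    rw [h0, map_zero, lval, exF_cvec, exF_cvec] at this
    simp only [zero_mul, zero_add, one_pow, mul_one] at this
    apply hz
    rw [this, ← hzz]
    rfl
  obtain ⟨y, hy⟩ : ∃ y, MvPolynomial.eval y (r1 * r2 * L) ≠ 0 := by
    by_contra! hcon
    exact mul_ne_zero (mul_ne_zero hr1 hr2) hL0 (MvPolynomial.funext (fun z => by simpa using hcon z))
  set a : Fin (d + 1) → ℂ := fun k => y (Sum.inl k) with ha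
  set b : Fin (d + 1) → ℂ := fun k => y (Sum.inr k) with hb
  have hyy : y = Sum.elim a b := by ext (k | k) <;> rfl
  rw [hyy, map_mul, map_mul] at hy
  have y1 : MvPolynomial.eval (Sum.elim a b) r1 ≠ 0 := fun h => hy (by rw [h]; ring)
  have y2 : MvPolynomial.eval (Sum.elim a b) r2 ≠ 0 := fun h => hy (by rw [h]; ring)
  have y3 : MvPolynomial.eval (Sum.elim a b) L ≠ 0 := fun h => hy (by rw [h]; ring)
  have huv : ∀ P : BR d, uvP P (exF d a α) (exF d b β) ![0, 0, 1] ![X, 1, 0] =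
      (theta α β (C P)).map (MvPolynomial.eval (Sum.elim a b)) := by
    intro P
    refine Polynomial.funext fun u => ?_
    rw [← lval_theta, uvP_eval _ (exF_hom _ _ _) (exF_hom _ _ _)]
    congr 1
    ext i
    fin_cases i <;> simp
  refine ⟨exF d a α, exF d b β, ![0, 0, 1], exF_hom _ _ _, exF_hom _ _ _, ?_, ?_⟩
  · intro h0
    have := congrFun h0 2
    simp at this
  · rw [genQ_ne_zero_iff Y h (exF_hom _ _ _) (exF_hom _ _ _)]
    refine ⟨by simp, ?_, ?_, ?_⟩
    · rw [← hLev]; exact y3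
    · intro u h1 h2
      rw [huv] at h1 h2
      rw [derivative_map] at h2
      have := congrArg (fun q => (q.map (MvPolynomial.eval (Sum.elim a b))).eval u) e1
      simp only [Polynomial.map_add, Polynomial.map_mul, eval_add, eval_mul, map_C, eval_C] at this
      rw [h1, h2] at this
      apply y1
      rw [← this]; ring
    · intro u h1 h2
      rw [huv] at h1 h2
      have := congrArg (fun q => (q.map (MvPolynomial.eval (Sum.elim a b))).eval u) e2
      simp only [Polynomial.map_add, Polynomial.map_mul, eval_add, eval_mul, map_C, eval_C] at this
      rw [h1, h2] at this
      apply y2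
      rw [← this]; ring

theorem partII {d N : ℕ} {S Y : BR d} (h : HasWt S N) {F G : MvPolynomial (Fin 3) ℂ}
    (hF : F.IsHomogeneous d) (hG : G.IsHomogeneous d) (x : Fin 3 → ℂ)
    (hQ : MvPolynomial.eval (Sum.elim (coeffs2 F G) x) (genQ S Y N) ≠ 0) :
    x 2 ≠ 0 ∧ lval S F G ![1, 0, 0] x ≠ 0 ∧ {u | lval S F G ![u, 1, 0] x = 0}.Finite ∧
      {u | lval S F G ![u, 1, 0] x = 0}.ncard = N ∧
      ∀ u, lval S F G ![u, 1, 0] x = 0 → lval Y F G ![u, 1, 0] x ≠ 0 := by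
  rw [genQ_ne_zero_iff Y h hF hG] at hQ
  obtain ⟨h1, h2, h3, h4⟩ := hQ
  have huv : ∀ (P : BR d) (u : ℂ), (uvP P F G x ![X, 1, 0]).eval u = lval P F G ![u, 1, 0] x := by
    intro P u
    rw [uvP_eval _ hF hG]
    congr 1
    ext i
    fin_cases i <;> simp
  obtain ⟨d1, d2⟩ := uvP_deg h hF hG x
  have := ncard_roots _ N d1 (by rw [d2]; exact h2) h3
  simp only [huv] at this h4
  exact ⟨h1, h2, this.1, this.2, h4⟩

theorem pencil_hom {F G : MvPolynomial (Fin 3) ℂ} {d : ℕ} (hF : F.IsHomogeneous d) (hG : G.IsHomogeneous d)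
    (c0 c1 : ℂ) : (c0 • F + c1 • G).IsHomogeneous d := by
  rw [MvPolynomial.smul_eq_C_mul, MvPolynomial.smul_eq_C_mul]
  have h1 := (MvPolynomial.isHomogeneous_C (Fin 3) c0).mul hF
  have h2 := (MvPolynomial.isHomogeneous_C (Fin 3) c1).mul hG
  rw [zero_add] at h1 h2
  exact h1.add h2

theorem linePoly_pencil (F G : MvPolynomial (Fin 3) ℂ) (c0 c1 : ℂ) (y x : Fin 3 → ℂ) :
    linePoly (c0 • F + c1 • G) y x = C c0 * linePoly F y x + C c1 * linePoly G y x := by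
  simp only [linePoly, map_add, map_smul, smul_eq_C_mul]

theorem rep_ne (c : Projectivization ℂ (Fin 2 → ℂ)) : c.rep 0 ≠ 0 ∨ c.rep 1 ≠ 0 := by
  by_contra! h
  apply c.rep_nonzero
  ext i
  fin_cases i
  · exact h.1
  · exact h.2

theorem exists_comb_of_mem {W : Submodule ℂ (Fin 3 → ℂ)} (hW : Module.finrank ℂ W = 2) {v w : Fin 3 → ℂ}
    (hv : v ∈ W) (hw : w ∈ W) (hl : LinearIndependent ℂ ![v, w]) {y : Fin 3 → ℂ} (hy : y ∈ W) :
    ∃ s t : ℂ, ∀ i, y i = s * v i + t * w i := by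
  have hspan : Submodule.span ℂ (Set.range ![v, w]) = W := by
    apply Submodule.eq_of_le_of_finrank_eq
    · rw [Submodule.span_le]
      rintro _ ⟨i, rfl⟩
      fin_cases i
      · exact hv
      · exact hw
    · rw [hW, finrank_span_eq_card hl]; simp
  rw [← hspan] at hy
  simp only [Matrix.range_cons, Matrix.range_empty, Set.union_empty, Set.singleton_union] at hy
  obtain ⟨s, t, h⟩ := Submodule.mem_span_pair.1 hy
  exact ⟨s, t, fun i => by rw [← h]; simp⟩

theorem li_of {x y : Fin 3 → ℂ} (hx : x 2 ≠ 0) (hy2 : y 2 = 0) (hy : y ≠ 0) : LinearIndependent ℂ ![x, y] := by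
  rw [LinearIndependent.pair_iff]
  intro s t h
  have h2 := congrFun h 2
  simp [hy2, hx] at h2
  refine ⟨h2, ?_⟩
  rw [h2, zero_smul, zero_add] at h
  exact (smul_eq_zero.1 h).resolve_right hy

theorem bit_expr {F G : MvPolynomial (Fin 3) ℂ} {x y : Fin 3 → ℂ} {W : Submodule ℂ (Fin 3 → ℂ)}
    (hW : W ∈ bitangentLinesThrough F G x) (hyW : y ∈ W) (hx : x 2 ≠ 0) (hy2 : y 2 = 0) (hy : y ≠ 0) :
    ∃ (c0 c1 : ℂ) (v w : Fin 3 → ℂ) (s0 s1 t0 t1 : ℂ), (c0 ≠ 0 ∨ c1 ≠ 0) ∧ (s0 ≠ 0 ∨ s1 ≠ 0) ∧ (t0 ≠ 0 ∨ t1 ≠ 0) ∧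
      (∀ i, y i = s0 * v i + t0 * w i) ∧ (∀ i, x i = s1 * v i + t1 * w i) ∧
      ContactLE (c0 • F + c1 • G) v w 2 ∧ ContactLE (c0 • F + c1 • G) w v 2 := by
  obtain ⟨hxW, hfr, c, v, w, hv, hw, hl, k1, k2⟩ := hW
  obtain ⟨s0, t0, e0⟩ := exists_comb_of_mem hfr hv hw hl hyW
  obtain ⟨s1, t1, e1⟩ := exists_comb_of_mem hfr hv hw hl hxW
  have key : ∀ (r0 r1 : ℂ) (z : Fin 3 → ℂ), (∀ i, y i = r0 * z i) → (∀ i, x i = r1 * z i) → False := by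
    intro r0 r1 z f0 f1
    have hz : z 2 ≠ 0 := by
      intro h0; apply hx; rw [f1, h0, mul_zero]
    have hr : r0 = 0 := by
      have := f0 2
      rw [hy2] at this
      exact (mul_eq_zero.1 this.symm).resolve_right hz
    apply hy
    ext i
    rw [f0, hr, zero_mul]; rfl
  refine ⟨c.rep 0, c.rep 1, v, w, s0, s1, t0, t1, rep_ne c, ?_, ?_, e0, e1, k1, k2⟩
  · by_contra! h
    refine key t0 t1 w (fun i => ?_) (fun i => ?_)
    · rw [e0, h.1]; ring
    · rw [e1, h.2]; ring
  · by_contra! h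
    refine key s0 s1 v (fun i => ?_) (fun i => ?_)
    · rw [e0, h.1]; ring
    · rw [e1, h.2]; ring

theorem line_cases {x : Fin 3 → ℂ} {W : Submodule ℂ (Fin 3 → ℂ)} (hxW : x ∈ W) (hfr : Module.finrank ℂ W = 2)
    (hx : x 2 ≠ 0) : (∃ u : ℂ, ![u, 1, 0] ∈ W) ∨ ![1, 0, 0] ∈ W := by
  obtain ⟨z, hz, hzx⟩ : ∃ z ∈ W, z ∉ Submodule.span ℂ {x} := by
    by_contra! hcon
    have h1 : W ≤ Submodule.span ℂ {x} := hcon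
    have h2 := Submodule.finrank_mono h1
    have h3 := finrank_span_le_card (R := ℂ) ({x} : Set (Fin 3 → ℂ))
    simp at h3
    omega
  set y := z - (z 2 / x 2) • x with hy
  have hyW : y ∈ W := W.sub_mem hz (W.smul_mem _ hxW)
  have hy2 : y 2 = 0 := by
    simp [hy, hx]
  have hy0 : y ≠ 0 := by
    intro h0
    apply hzx
    rw [Submodule.mem_span_singleton]
    exact ⟨z 2 / x 2, (sub_eq_zero.1 (hy ▸ h0)).symm⟩
  by_cases h1 : y 1 = 0
  · right
    have h0 : y 0 ≠ 0 := by
      intro h0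
      apply hy0
      ext i
      fin_cases i
      · exact h0
      · exact h1
      · exact hy2
    have : ![1, 0, 0] = (y 0)⁻¹ • y := by
      ext i
      fin_cases i <;> simp [h0, h1, hy2]
    rw [this]
    exact W.smul_mem _ hyW
  · left
    refine ⟨(y 1)⁻¹ * y 0, ?_⟩
    have : ![(y 1)⁻¹ * y 0, 1, 0] = (y 1)⁻¹ • y := by
      ext i
      fin_cases i <;> simp [h1, hy2]
    rw [this]
    exact W.smul_mem _ hyW

def lineU (x : Fin 3 → ℂ) (u : ℂ) : Submodule ℂ (Fin 3 → ℂ) := Submodule.span ℂ {x, ![u, 1, 0]}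

theorem vec_ne (u : ℂ) : (![u, 1, 0] : Fin 3 → ℂ) ≠ 0 := by
  intro h
  have := congrFun h 1
  simp at this

theorem lineU_inj {x : Fin 3 → ℂ} (hx : x 2 ≠ 0) : Function.Injective (lineU x) := by
  intro u u' h
  have h1 : ![u, 1, 0] ∈ lineU x u' := by
    rw [← h]
    exact Submodule.subset_span (by simp)
  obtain ⟨a, b, e⟩ := Submodule.mem_span_pair.1 h1
  have e2 := congrFun e 2
  have e1 := congrFun e 1
  have e0 := congrFun e 0
  simp [hx] at e2
  simp [e2] at e0 e1
  rw [e1, one_mul] at e0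
  exact e0.symm

theorem lineU_finrank {x : Fin 3 → ℂ} (hx : x 2 ≠ 0) (u : ℂ) : Module.finrank ℂ (lineU x u) = 2 := by
  have := finrank_span_eq_card (li_of hx (y := ![u, 1, 0]) (by simp) (vec_ne u))
  have e : Set.range ![x, ![u, 1, 0]] = {x, ![u, 1, 0]} := by
    simp only [Matrix.range_cons, Matrix.range_empty, Set.union_empty, Set.singleton_union]
  rw [e] at this
  rw [lineU, this]
  simp

theorem eq_lineU {x : Fin 3 → ℂ} {W : Submodule ℂ (Fin 3 → ℂ)} (hxW : x ∈ W) (hfr : Module.finrank ℂ W = 2)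
    (hx : x 2 ≠ 0) {u : ℂ} (hu : ![u, 1, 0] ∈ W) : W = lineU x u := by
  symm
  apply Submodule.eq_of_le_of_finrank_eq
  · rw [lineU, Submodule.span_le]
    rintro z (rfl | rfl)
    · exact hxW
    · exact hu
  · rw [lineU_finrank hx, hfr]

theorem linePoly_cvec_zero {F G : MvPolynomial (Fin 3) ℂ}
    (hl : ¬ LinearIndependent ℂ ![F, G]) : ∃ c0 c1 : ℂ, (c0 ≠ 0 ∨ c1 ≠ 0) ∧ ∀ y x : Fin 3 → ℂ,
      C c0 * linePoly F y x + C c1 * linePoly G y x = 0 := by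
  rw [LinearIndependent.pair_iff] at hl
  push Not at hl
  obtain ⟨c0, c1, h, hne⟩ := hl
  refine ⟨c0, c1, ?_, fun y x => ?_⟩
  · by_contra! hc
    exact hne hc.1 hc.2
  · rw [← linePoly_pencil, h]
    simp [linePoly]

theorem count_four (n : ℕ) : BitangentLinesCountEq (n + 4) ((n + 4) * (2 * (n + 1) * (n + 2))) := by
  obtain ⟨S, hsq, hSY, hF1, hF2, hwt⟩ := exists_S_final n
  have hW : HasWt (d := n + 4) S ((n + 4) * (2 * (n + 1) * (n + 2))) := hwt
  have hval : ∀ (F G : MvPolynomial (Fin 3) ℂ) (y x : Fin 3 → ℂ), lval (d := n + 4) S F G y x =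
      evA (cvec (n + 5) (linePoly F y x)) (cvec (n + 5) (linePoly G y x)) S := fun _ _ _ _ => rfl
  have hvalY : ∀ (F G : MvPolynomial (Fin 3) ℂ) (y x : Fin 3 → ℂ), lval (d := n + 4) (Yd n (fG n) (gG n)) F G y x =
      Yd n (cvec (n + 5) (linePoly F y x)) (cvec (n + 5) (linePoly G y x)) := fun _ _ _ _ => evA_Y _ _
  refine ⟨genQ (d := n + 4) S (Yd n (fG n) (gG n)) ((n + 4) * (2 * (n + 1) * (n + 2))), ?_, ?_⟩
  · obtain ⟨F, G, x, hF, hG, hx, hQ⟩ := exists_example hW hsq hSY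
    refine ⟨F, G, x, hF, hG, ?_, hx, hQ⟩
    by_contra hl
    obtain ⟨c0, c1, hc, h0⟩ := linePoly_cvec_zero hl
    obtain ⟨-, h2, -⟩ := partII hW hF hG x hQ
    apply h2
    rw [hval]
    refine hF2 _ _ ⟨c0, c1, 1, 0, 1, 0, 0, hc, Or.inl one_ne_zero, Or.inl one_ne_zero, ?_, ?_⟩
    · rw [degree_zero]; exact WithBot.bot_lt_coe _
    · rw [cpoly_cvec (n + 4) _ (linePoly_natDegree hF _ _), cpoly_cvec (n + 4) _ (linePoly_natDegree hG _ _), h0, mul_zero]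
  · intro F G x hF hG _ _ hQ
    obtain ⟨hx, h2, h3, h4, h5⟩ := partII hW hF hG x hQ
    have hS0 : ∀ (W : Submodule ℂ (Fin 3 → ℂ)) (y : Fin 3 → ℂ), W ∈ bitangentLinesThrough F G x → y ∈ W → y 2 = 0 →
        y ≠ 0 → lval (d := n + 4) S F G y x = 0 := by
      intro W y hWb hyW hy2 hy
      obtain ⟨c0, c1, v, w, s0, s1, t0, t1, hc, hs, ht, e0, e1, k1, k2⟩ := bit_expr hWb hyW hx hy2 hy
      obtain ⟨h, hh, e⟩ := factor_of_bitangent (pencil_hom hF hG c0 c1) y x v w s0 s1 t0 t1 hs e0 e1 k1 k2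
      rw [hval]
      refine hF2 _ _ ⟨c0, c1, s1, -s0, t1, -t0, h, hc, ?_, ?_, hh, ?_⟩
      · rcases hs with hs | hs
        · exact Or.inr (neg_ne_zero.2 hs)
        · exact Or.inl hs
      · rcases ht with ht | ht
        · exact Or.inr (neg_ne_zero.2 ht)
        · exact Or.inl ht
      · rw [cpoly_cvec (n + 4) _ (linePoly_natDegree hF _ _), cpoly_cvec (n + 4) _ (linePoly_natDegree hG _ _),
          ← linePoly_pencil, e]
    have hset : bitangentLinesThrough F G x = lineU x '' {u | lval (d := n + 4) S F G ![u, 1, 0] x = 0} := by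
      ext W
      constructor
      · intro hWb
        have hWb' := hWb
        obtain ⟨hxW, hfr, -⟩ := hWb'
        rcases line_cases hxW hfr hx with ⟨u, hu⟩ | hu
        · exact ⟨u, hS0 W _ hWb hu (by simp) (vec_ne u), (eq_lineU hxW hfr hx hu).symm⟩
        · refine absurd (hS0 W _ hWb hu (by simp) ?_) h2
          intro h0
          have := congrFun h0 0
          simp at this
      · rintro ⟨u, hu, rfl⟩
        have hu' : lval (d := n + 4) S F G ![u, 1, 0] x = 0 := hu
        have hY := h5 u hu'
        rw [hvalY] at hY
        rw [hval] at hu'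
        obtain ⟨c0, c1, a, b, h, hc, hab, hh, e⟩ := hF1 _ _ hY hu'
        rw [cpoly_cvec (n + 4) _ (linePoly_natDegree hF _ _), cpoly_cvec (n + 4) _ (linePoly_natDegree hG _ _),
          ← linePoly_pencil] at e
        have hxm : x ∈ lineU x u := Submodule.subset_span (by simp)
        have hym : ![u, 1, 0] ∈ lineU x u := Submodule.subset_span (by simp)
        have hc2 : (![c0, c1] : Fin 2 → ℂ) ≠ 0 := by
          intro h0
          have i0 := congrFun h0 0
          have i1 := congrFun h0 1
          simp at i0 i1
          rcases hc with hc | hc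
          · exact hc i0
          · exact hc i1
        obtain ⟨r, hr⟩ := Projectivization.exists_smul_eq_mk_rep ℂ ![c0, c1] hc2
        have hpm : pencilMember F G (Projectivization.mk ℂ ![c0, c1] hc2) = (r : ℂ) • (c0 • F + c1 • G) := by
          rw [pencilMember, ← hr, smul_add, smul_smul, smul_smul]
          rfl
        have hcon : ∀ v w : Fin 3 → ℂ, ContactLE (c0 • F + c1 • G) v w 2 →
            ContactLE (pencilMember F G (Projectivization.mk ℂ ![c0, c1] hc2)) v w 2 := by
          intro v w hvw
          rw [hpm]
          unfold ContactLE at *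
          have : linePoly ((r : ℂ) • (c0 • F + c1 • G)) v w = C (r : ℂ) * linePoly (c0 • F + c1 • G) v w := by
            rw [linePoly, map_smul, smul_eq_C_mul]; rfl
          rw [this]
          exact hvw.mul_left _
        refine ⟨hxm, lineU_finrank hx u, Projectivization.mk ℂ ![c0, c1] hc2,
          (fun i => (![u, 1, 0] : Fin 3 → ℂ) i + a * x i), (fun i => (![u, 1, 0] : Fin 3 → ℂ) i + b * x i), ?_, ?_, ?_, ?_, ?_⟩
        · exact Submodule.add_mem _ hym (Submodule.smul_mem _ a hxm)
        · exact Submodule.add_mem _ hym (Submodule.smul_mem _ b hxm)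
        · rw [LinearIndependent.pair_iff]
          intro s t hst
          have i1 := congrFun hst 1
          have i2 := congrFun hst 2
          simp at i1 i2
          have i3 : s * a + t * b = 0 := by
            have : (s * a + t * b) * x 2 = 0 := by linear_combination i2
            exact (mul_eq_zero.1 this).resolve_right hx
          have i4 : s + t = 0 := by linear_combination i1 - x 1 * i3
          have i5 : s * (a - b) = 0 := by linear_combination i3 - b * i4
          have i6 : s = 0 := (mul_eq_zero.1 i5).resolve_right (sub_ne_zero.2 hab)
          exact ⟨i6, by linear_combination i4 - i6⟩
        · exact hcon _ _ (contact_of_factor (pencil_hom hF hG c0 c1) _ x a b h hh e)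
        · refine hcon _ _ (contact_of_factor (pencil_hom hF hG c0 c1) _ x b a h hh ?_)
          rw [e]; ring
    rw [hset]
    exact ⟨h3.image _, by rw [Set.ncard_image_of_injective _ (lineU_inj hx), h4]⟩

/-- The cubic case. -/
def S3 : BR 3 := MvPolynomial.X (Sum.inl 3) * MvPolynomial.X (Sum.inr 2) - MvPolynomial.X (Sum.inl 2) * MvPolynomial.X (Sum.inr 3)
def Y3 : BR 3 := MvPolynomial.X (Sum.inl 3) * MvPolynomial.X (Sum.inr 1) - MvPolynomial.X (Sum.inl 1) * MvPolynomial.X (Sum.inr 3)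

theorem S3_wt : HasWt S3 1 := by
  unfold HasWt S3
  simp only [map_sub, map_mul, evB_l, evB_r]
  simp
  ring

theorem lval_S3 (F G : MvPolynomial (Fin 3) ℂ) (y x : Fin 3 → ℂ) : lval S3 F G y x =
    (linePoly F y x).coeff 3 * (linePoly G y x).coeff 2 - (linePoly F y x).coeff 2 * (linePoly G y x).coeff 3 := by
  rw [lval, S3]
  simp only [map_sub, map_mul, evB_l, evB_r]
  rfl

theorem lval_Y3 (F G : MvPolynomial (Fin 3) ℂ) (y x : Fin 3 → ℂ) : lval Y3 F G y x =
    (linePoly F y x).coeff 3 * (linePoly G y x).coeff 1 - (linePoly F y x).coeff 1 * (linePoly G y x).coeff 3 := by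
  rw [lval, Y3]
  simp only [map_sub, map_mul, evB_l, evB_r]
  rfl

theorem S3_irr : Irreducible S3 := by
  have h := MvPolynomial.irreducible_mul_X_add (MvPolynomial.X (Sum.inl 3) : BR 3)
    (- (MvPolynomial.X (Sum.inl 2) * MvPolynomial.X (Sum.inr 3))) (Sum.inr 2) (MvPolynomial.X_ne_zero _)
    (by simp [MvPolynomial.vars_X]) (by
      rw [MvPolynomial.vars_neg]
      intro h
      have := MvPolynomial.vars_mul _ _ h
      simp [MvPolynomial.vars_X] at this) (by
      rw [IsRelPrime.neg_right_iff]
      have key : ∀ i : Fin 4 ⊕ Fin 4, Sum.inl 3 ≠ i →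
        IsRelPrime (MvPolynomial.X (Sum.inl 3) : BR 3) (MvPolynomial.X i) := by
        intro i hi
        refine (MvPolynomial.X_prime (i := Sum.inl 3) (R := ℂ)).irreducible.isRelPrime_iff_not_dvd.2 ?_
        intro hd
        exact hi ((MvPolynomial.X_dvd_X).1 hd)
      exact (key _ (by simp)).mul_right (key _ (by simp)))
  rw [S3, sub_eq_add_neg]
  exact h

theorem S3_Y3 (P : BR 3) (hP : Prime P) (h1 : P ∣ S3) : ¬ P ∣ Y3 := by
  intro h2
  have ha : Associated P S3 := hP.irreducible.associated_of_dvd S3_irr h1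
  have hd : S3 ∣ Y3 := ha.symm.dvd.trans h2
  obtain ⟨q, hq⟩ := hd
  have := congrArg (MvPolynomial.eval (Sum.elim ![0, 0, 0, 1] ![0, 1, 0, 0])) hq
  rw [map_mul, S3, Y3] at this
  simp at this

theorem count_three : BitangentLinesCountEq 3 0 := by
  have key : ∀ (F G : MvPolynomial (Fin 3) ℂ) (y x : Fin 3 → ℂ) (c0 c1 : ℂ), (c0 ≠ 0 ∨ c1 ≠ 0) →
      C c0 * linePoly F y x + C c1 * linePoly G y x = 0 → lval S3 F G y x = 0 ∧ lval Y3 F G y x = 0 := by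
    intro F G y x c0 c1 hc h
    have hk : ∀ k, c0 * (linePoly F y x).coeff k + c1 * (linePoly G y x).coeff k = 0 := by
      intro k
      have := congrArg (fun p => coeff p k) h
      simpa using this
    rw [lval_S3, lval_Y3]
    have h3 := hk 3
    have h2 := hk 2
    have h1 := hk 1
    rcases hc with hc | hc
    · constructor
      · apply mul_left_cancel₀ hc
        linear_combination (linePoly G y x).coeff 2 * h3 - (linePoly G y x).coeff 3 * h2
      · apply mul_left_cancel₀ hc
        linear_combination (linePoly G y x).coeff 1 * h3 - (linePoly G y x).coeff 3 * h1
    · constructor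
      · apply mul_left_cancel₀ hc
        linear_combination (linePoly F y x).coeff 3 * h2 - (linePoly F y x).coeff 2 * h3
      · apply mul_left_cancel₀ hc
        linear_combination (linePoly F y x).coeff 3 * h1 - (linePoly F y x).coeff 1 * h3
  refine ⟨genQ S3 Y3 1, ?_, ?_⟩
  · obtain ⟨F, G, x, hF, hG, hx, hQ⟩ := exists_example S3_wt S3_irr.squarefree S3_Y3
    refine ⟨F, G, x, hF, hG, ?_, hx, hQ⟩
    by_contra hl
    obtain ⟨c0, c1, hc, h0⟩ := linePoly_cvec_zero hl
    obtain ⟨-, h2, -⟩ := partII S3_wt hF hG x hQ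
    exact h2 (key F G _ _ c0 c1 hc (h0 _ _)).1
  · intro F G x hF hG _ _ hQ
    obtain ⟨hx, h2, h3, h4, h5⟩ := partII S3_wt hF hG x hQ
    have hS0 : ∀ (W : Submodule ℂ (Fin 3 → ℂ)) (y : Fin 3 → ℂ), W ∈ bitangentLinesThrough F G x → y ∈ W → y 2 = 0 →
        y ≠ 0 → lval S3 F G y x = 0 ∧ lval Y3 F G y x = 0 := by
      intro W y hWb hyW hy2 hy
      obtain ⟨c0, c1, v, w, s0, s1, t0, t1, hc, hs, ht, e0, e1, k1, k2⟩ := bit_expr hWb hyW hx hy2 hy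
      refine key F G y x c0 c1 hc ?_
      rw [← linePoly_pencil,
        linePoly_of_bitangent (pencil_hom hF hG c0 c1) y x v w s0 s1 t0 t1 hs e0 e1 k1 k2]
      refine Finset.sum_eq_zero fun k hk => ?_
      simp only [Finset.mem_filter] at hk
      omega
    have hset : bitangentLinesThrough F G x = ∅ := by
      rw [Set.eq_empty_iff_forall_notMem]
      intro W hWb
      have hWb' := hWb
      obtain ⟨hxW, hfr, -⟩ := hWb'
      rcases line_cases hxW hfr hx with ⟨u, hu⟩ | hu
      · have h := hS0 W _ hWb hu (by simp) (vec_ne u)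
        exact h5 u h.1 h.2
      · refine absurd (hS0 W _ hWb hu (by simp) ?_).1 h2
        intro h0
        have := congrFun h0 0
        simp at this
    rw [hset]
    simp

end Aux

/-- The recursion `M(d) = M(d−2) + 4(d−2)(3d−10)` for the generic number `M(e)` of
lines through a general point bitangent to some member of a general pencil of
degree-`e` plane curves. -/
theorem bitangent_lines_count_recursion (d : ℕ) (hd : 5 ≤ d) :
    ∃ Md Md2 : ℕ, BitangentLinesCountEq d Md ∧ BitangentLinesCountEq (d - 2) Md2 ∧
      (Md : ℤ) = (Md2 : ℤ) + 4 * ((d : ℤ) - 2) * (3 * (d : ℤ) - 10) := by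
  obtain ⟨n, rfl⟩ : ∃ n, d = n + 5 := ⟨d - 5, by omega⟩
  refine ⟨(n + 1 + 4) * (2 * (n + 1 + 1) * (n + 1 + 2)), ?_⟩
  rcases n with _ | m
  · exact ⟨0, count_four 1, count_three, by norm_num⟩
  · refine ⟨(m + 4) * (2 * (m + 1) * (m + 2)), count_four (m + 1 + 1), count_four m, ?_⟩
    push_cast
    ring
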